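/- Let n ≥ 1 and δ > (n-1)/2. Let p(·) : ℝ^n → (0,1] be globally log-Hölder continuous and assume p_- := essinf p ≥ 2n/(n+1+2δ). Then there exists a constant C > 0 such that for every Schwartz function f on ℝ^n and every ε > 0, ‖M(B^δ_{1/ε}(f), Φ)‖_{WL^{p(·)}} ≤ C ‖M(f,Φ)‖_{L^{p(·)}}; that is, the Bochner–Riesz means of order δ is bounded from the variable Hardy space H^{p(·)}(ℝ^n) to the weak variable Hardy space WH^{p(·)}(ℝ^n), uniformly in ε. -/

import Mathlib

noncomputable section

open MeasureTheory Real Set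
open scoped ENNReal NNReal

abbrev En (n : ℕ) : Type := EuclideanSpace ℝ (Fin n)

/-- The Bochner–Riesz kernel of order `δ`: the Fourier transform of `ξ ↦ ((1-|ξ|²)⁺)^δ`. -/
def brKernel (n : ℕ) (δ : ℝ) (x : En n) : ℂ :=
  ∫ ξ : En n, (((max (1 - ‖ξ‖ ^ 2) 0) ^ δ : ℝ) : ℂ) *
    Complex.exp (-(2 * Real.pi) * Complex.I * ((∑ i, x i * ξ i : ℝ) : ℂ))

/-- The dilated kernel `φ_ε(x) = ε^{-n} φ(x/ε)`. -/
def brKernelDil (n : ℕ) (δ ε : ℝ) (x : En n) : ℂ :=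
  (ε ^ n)⁻¹ • brKernel n δ (ε⁻¹ • x)

/-- The Bochner–Riesz means `B^δ_{1/ε} f = f * φ_ε`. -/
def brMeans (n : ℕ) (δ ε : ℝ) (f : En n → ℂ) (x : En n) : ℂ :=
  ∫ y, f y * brKernelDil n δ ε (x - y)

/-- The maximal Bochner–Riesz means `B^δ_* f`. -/
def brMax (n : ℕ) (δ : ℝ) (f : En n → ℂ) (x : En n) : ℝ≥0∞ :=
  ⨆ (ε : ℝ) (_ : 0 < ε), (‖brMeans n δ ε f x‖₊ : ℝ≥0∞)

/-- The radial maximal function `M(f,Φ)(x) = sup_{t>0} |(Φ_t * f)(x)|`. -/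
def radMax (n : ℕ) (Φ : En n → ℂ) (f : En n → ℂ) (x : En n) : ℝ≥0∞ :=
  ⨆ (t : ℝ) (_ : 0 < t), (‖∫ y, (t ^ n)⁻¹ • Φ (t⁻¹ • (x - y)) * f y‖₊ : ℝ≥0∞)

/-- The variable Lebesgue norm `‖g‖_{L^{p(·)}}` of a nonnegative function. -/
def vlQ (n : ℕ) (p : En n → ℝ) (g : En n → ℝ≥0∞) : ℝ≥0∞ :=
  sInf {lam : ℝ≥0∞ | 0 < lam ∧ lam < ⊤ ∧ (∫⁻ x, (g x / lam) ^ (p x)) ≤ 1}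

/-- The weak variable Lebesgue quasinorm `‖g‖_{WL^{p(·)}}`. -/
def vlWQ (n : ℕ) (p : En n → ℝ) (g : En n → ℝ≥0∞) : ℝ≥0∞ :=
  ⨆ (β : ℝ≥0) (_ : 0 < β),
    (β : ℝ≥0∞) * vlQ n p ({x | (β : ℝ≥0∞) < g x}.indicator 1)

/-- `p(·)` is globally log-Hölder continuous. -/
def GlobalLogHolder (n : ℕ) (p : En n → ℝ) : Prop :=
  ∃ (C₀ pinf : ℝ), 0 < C₀ ∧
    (∀ x y : En n, x ≠ y →
      |p x - p y| ≤ C₀ / Real.log (Real.exp 1 + 1 / ‖x - y‖)) ∧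
    (∀ x : En n, |p x - pinf| ≤ C₀ / Real.log (Real.exp 1 + ‖x‖))

section Part1

section Kernels
variable {n : ℕ}

/-- the basic `L¹`-normalised polynomially decaying kernel -/
def pk (a s : ℝ) (x : En n) : ℝ≥0∞ := ENNReal.ofReal ((s ^ n)⁻¹ * (1 + ‖x‖ / s) ^ (-a))

/-- its total mass -/
def Kc (n : ℕ) (a : ℝ) : ℝ≥0∞ := ∫⁻ x : En n, ENNReal.ofReal ((1 + ‖x‖) ^ (-a))

lemma Kc_lt_top {a : ℝ} (ha : (n : ℝ) < a) : Kc n a < ⊤ := by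
  unfold Kc
  apply finite_integral_one_add_norm
  simpa using ha

lemma pk_meas (a s : ℝ) : Measurable (pk a s : En n → ℝ≥0∞) := by
  unfold pk
  fun_prop

lemma lintegral_scale (s : ℝ) (hs : 0 < s) (g : En n → ℝ≥0∞) (hg : Measurable g) :
    ∫⁻ x, ENNReal.ofReal ((s ^ n)⁻¹) * g (s⁻¹ • x) = ∫⁻ x, g x := by
  have h1 := Measure.map_addHaar_smul (volume : Measure (En n)) (r := s⁻¹) (by positivity)
  have h2 : ∫⁻ x, g (s⁻¹ • x) = ∫⁻ x, g x ∂(Measure.map (s⁻¹ • ·) volume) := by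
    rw [lintegral_map hg (by fun_prop)]
  rw [lintegral_const_mul _ (by fun_prop), h2, h1, lintegral_smul_measure, smul_eq_mul,
    ← mul_assoc, ← ENNReal.ofReal_mul (by positivity)]
  have : (s ^ n)⁻¹ * |((s⁻¹) ^ Module.finrank ℝ (En n))⁻¹| = 1 := by
    rw [abs_of_nonneg (by positivity)]
    simp
    field_simp
  rw [this]; simp

lemma pk_eq (a s : ℝ) (hs : 0 < s) (x : En n) :
    pk a s x = ENNReal.ofReal ((s ^ n)⁻¹) * ENNReal.ofReal ((1 + ‖s⁻¹ • x‖) ^ (-a)) := by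
  rw [pk, ENNReal.ofReal_mul (by positivity), norm_smul, norm_inv, Real.norm_of_nonneg hs.le,
    inv_mul_eq_div]

lemma lintegral_pk (a s : ℝ) (hs : 0 < s) : ∫⁻ x : En n, pk a s x = Kc n a := by
  simp_rw [pk_eq a s hs]
  exact lintegral_scale s hs (fun x => ENNReal.ofReal ((1 + ‖x‖) ^ (-a))) (by fun_prop)

lemma lintegral_pk_sub_left (a s : ℝ) (hs : 0 < s) (x : En n) :
    ∫⁻ u : En n, pk a s (x - u) = Kc n a := by
  rw [lintegral_sub_left_eq_self (pk a s), lintegral_pk a s hs]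

lemma lintegral_pk_sub_right (a s : ℝ) (hs : 0 < s) (x : En n) :
    ∫⁻ u : En n, pk a s (u - x) = Kc n a := by
  rw [lintegral_sub_right_eq_self (pk a s), lintegral_pk a s hs]

lemma pk_pointwise {a s t : ℝ} (ha : (n : ℝ) < a) (hs : 0 < s) (hst : s ≤ t) (x u v : En n) :
    pk a s (x - u) ≤ ENNReal.ofReal (4 ^ a) * pk a t (x - v) ∨
      pk a t (u - v) ≤ ENNReal.ofReal (4 ^ a) * pk a t (x - v) := by
  have ht : 0 < t := hs.trans_le hst
  have ha0 : 0 < a := lt_of_le_of_lt (Nat.cast_nonneg n) ha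
  have key : ∀ y z : ℝ, 0 < y → y ≤ 4 * z → z ^ (-a) ≤ 4 ^ a * y ^ (-a) := by
    intro y z hy hyz
    have hz : 0 < z := by linarith
    rw [Real.rpow_neg hz.le, Real.rpow_neg hy.le, ← div_eq_mul_inv, inv_eq_one_div,
      div_le_div_iff₀ (by positivity) (by positivity), one_mul, ← Real.mul_rpow (by norm_num) hz.le]
    exact Real.rpow_le_rpow hy.le hyz ha0.le
  have htri : ‖x - v‖ ≤ ‖x - u‖ + ‖u - v‖ := by
    simpa using norm_add_le (x - u) (u - v)
  simp only [pk]
  rw [← ENNReal.ofReal_mul (by positivity)]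
  by_cases h : 1 + ‖x - v‖ / t ≤ 4 * (1 + ‖u - v‖ / t)
  · right
    apply ENNReal.ofReal_le_ofReal
    have := key _ _ (by positivity) h
    calc _ ≤ (t ^ n)⁻¹ * (4 ^ a * (1 + ‖x - v‖ / t) ^ (-a)) := by gcongr
      _ = _ := by ring
  · left
    push Not at h
    apply ENNReal.ofReal_le_ofReal
    have h' : 3 * t + 4 * ‖u - v‖ < ‖x - v‖ := by
      have : (4 * (1 + ‖u - v‖ / t)) * t < (1 + ‖x - v‖ / t) * t := by gcongr
      rw [add_mul, mul_assoc, add_mul, div_mul_cancel₀ _ ht.ne', div_mul_cancel₀ _ ht.ne'] at this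
      linarith
    have hs1 : (s ^ n)⁻¹ * (1 + ‖x - u‖ / s) ^ (-a) ≤ t ^ (a - n) * (‖x - u‖) ^ (-a) := by
      have hxu : 0 < ‖x - u‖ := by nlinarith [norm_nonneg (u - v)]
      have e1 : (1 + ‖x - u‖ / s) ^ (-a) ≤ (‖x - u‖ / s) ^ (-a) := by
        apply Real.rpow_le_rpow_of_nonpos (by positivity) (by linarith) (by linarith)
      have e2 : (s ^ n)⁻¹ * (‖x - u‖ / s) ^ (-a) = s ^ (a - n) * ‖x - u‖ ^ (-a) := by
        rw [Real.div_rpow (by positivity) hs.le, Real.rpow_neg hs.le a, Real.rpow_sub hs,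
          Real.rpow_natCast]
        field_simp
      calc _ ≤ (s ^ n)⁻¹ * (‖x - u‖ / s) ^ (-a) := by gcongr
        _ = s ^ (a - n) * ‖x - u‖ ^ (-a) := e2
        _ ≤ _ := by
          gcongr
    have e3 : t ^ (a - n) * (‖x - u‖) ^ (-a) = (t ^ n)⁻¹ * (‖x - u‖ / t) ^ (-a) := by
      rw [Real.div_rpow (by positivity) ht.le, Real.rpow_neg ht.le a, Real.rpow_sub ht,
          Real.rpow_natCast]
      field_simp
    rw [e3] at hs1
    refine hs1.trans ?_
    have e4 : (1 + ‖x - v‖ / t) ≤ 4 * (‖x - u‖ / t) := by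
      have : t + ‖x - v‖ ≤ 4 * ‖x - u‖ := by nlinarith [norm_nonneg (u - v)]
      calc 1 + ‖x - v‖ / t = (t + ‖x - v‖) / t := by field_simp
        _ ≤ (4 * ‖x - u‖) / t := by gcongr
        _ = _ := by ring
    have := key _ _ (by positivity) e4
    calc _ ≤ (t ^ n)⁻¹ * (4 ^ a * (1 + ‖x - v‖ / t) ^ (-a)) := by gcongr
      _ = _ := by ring

lemma pk_conv {a s t : ℝ} (ha : (n : ℝ) < a) (hs : 0 < s) (hst : s ≤ t) (x v : En n) :
    ∫⁻ u, pk a s (x - u) * pk a t (u - v) ≤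
      (ENNReal.ofReal (4 ^ a) * (2 * Kc n a)) * pk a t (x - v) := by
  have ht : 0 < t := hs.trans_le hst
  calc ∫⁻ u, pk a s (x - u) * pk a t (u - v)
      ≤ ∫⁻ u, (ENNReal.ofReal (4 ^ a) * pk a t (x - v)) * (pk a s (x - u) + pk a t (u - v)) := by
        apply lintegral_mono
        intro u
        dsimp only
        rcases pk_pointwise ha hs hst x u v with h | h
        · calc _ ≤ (ENNReal.ofReal (4 ^ a) * pk a t (x - v)) * pk a t (u - v) := by gcongr
            _ ≤ _ := by gcongr; exact le_add_self
        · calc _ ≤ pk a s (x - u) * (ENNReal.ofReal (4 ^ a) * pk a t (x - v)) := by gcongr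
            _ = (ENNReal.ofReal (4 ^ a) * pk a t (x - v)) * pk a s (x - u) := by ring
            _ ≤ _ := by gcongr; exact le_self_add
    _ = (ENNReal.ofReal (4 ^ a) * pk a t (x - v)) * (Kc n a + Kc n a) := by
        rw [lintegral_const_mul, lintegral_add_left, lintegral_pk_sub_left a s hs,
          lintegral_pk_sub_right a t ht]
        · exact (pk_meas a s).comp (by fun_prop)
        · exact ((pk_meas a s).comp (by fun_prop)).add ((pk_meas a t).comp (by fun_prop))
    _ = _ := by ring

lemma pk_conv' {a s t : ℝ} (ha : (n : ℝ) < a) (hs : 0 < s) (hst : s ≤ t) (x v : En n) :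
    ∫⁻ u, pk a t (x - u) * pk a s (u - v) ≤
      (ENNReal.ofReal (4 ^ a) * (2 * Kc n a)) * pk a t (x - v) := by
  have hsym : ∀ (s : ℝ) (y z : En n), pk a s (y - z) = pk a s (z - y) := by
    intro s y z; simp only [pk, norm_sub_rev]
  calc _ = ∫⁻ u, pk a s (v - u) * pk a t (u - x) := by
        apply lintegral_congr; intro u
        rw [hsym t x u, hsym s u v, mul_comm]
    _ ≤ _ := pk_conv ha hs hst v x
    _ = _ := by rw [hsym t v x]

lemma pk_scale {a κ s : ℝ} (ha : 0 < a) (hκ : 0 < κ) (hs : 0 < s) (x : En n) :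
    pk a (κ * s) x ≤ ENNReal.ofReal ((κ ^ n)⁻¹ * (1 + κ) ^ a) * pk a s x := by
  simp only [pk]
  rw [← ENNReal.ofReal_mul (by positivity)]
  apply ENNReal.ofReal_le_ofReal
  have h1 : 1 + ‖x‖ / s ≤ (1 + κ) * (1 + ‖x‖ / (κ * s)) := by
    have : (1 + κ) * (1 + ‖x‖ / (κ * s)) = 1 + ‖x‖ / s + κ + ‖x‖ / (κ * s) := by
      field_simp; ring
    rw [this]
    have : 0 ≤ ‖x‖ / (κ * s) := by positivity
    linarith
  have h2 : (1 + ‖x‖ / (κ * s)) ^ (-a) ≤ (1 + κ) ^ a * (1 + ‖x‖ / s) ^ (-a) := by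
    rw [Real.rpow_neg (by positivity), Real.rpow_neg (by positivity), ← div_eq_mul_inv,
      inv_eq_one_div, div_le_div_iff₀ (by positivity) (by positivity), one_mul,
      ← Real.mul_rpow (by positivity) (by positivity)]
    exact Real.rpow_le_rpow (by positivity) h1 ha.le
  calc _ ≤ ((κ * s) ^ n)⁻¹ * ((1 + κ) ^ a * (1 + ‖x‖ / s) ^ (-a)) := by gcongr
    _ = _ := by rw [mul_pow, mul_inv]; ring

end Kernels

end Part1

section Part2

section Levels

/-- dyadic levels -/
def lv (j : ℤ) : ℝ≥0∞ := (2 : ℝ≥0∞) ^ j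

lemma lv_ne_zero (j : ℤ) : lv j ≠ 0 := by
  unfold lv; exact (ENNReal.zpow_pos (by norm_num) (by norm_num) j).ne'

lemma lv_ne_top (j : ℤ) : lv j ≠ ⊤ := by
  unfold lv; exact (ENNReal.zpow_lt_top (by norm_num) (by norm_num) j).ne

lemma lv_succ (j : ℤ) : lv (j + 1) = 2 * lv j := by
  unfold lv; rw [ENNReal.zpow_add (by norm_num) (by norm_num), zpow_one, mul_comm]

lemma lv_zero : lv 0 = 1 := by simp [lv]

lemma lv_mono {i j : ℤ} (h : i ≤ j) : lv i ≤ lv j := by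
  unfold lv; exact ENNReal.zpow_le_of_le (by norm_num) h

lemma lv_rpow_sub (j : ℤ) (k : ℕ) (σ : ℝ) :
    (lv (j - k)) ^ σ = (lv j) ^ σ * ((2 : ℝ≥0∞) ^ (-σ)) ^ k := by
  induction k with
  | zero => simp
  | succ k ih =>
    have h1 : lv (j - k) = 2 * lv (j - (k + 1 : ℕ)) := by
      rw [← lv_succ]; congr 1; push_cast; ring
    rw [pow_succ, ← mul_assoc, ← ih, h1, ENNReal.mul_rpow_of_ne_top (by norm_num) (lv_ne_top _),
      mul_comm (2 ^ σ), mul_assoc, ← ENNReal.rpow_add _ _ (by norm_num) (by norm_num)]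
    simp

/-- geometric constant -/
def gc (σ : ℝ) : ℝ≥0∞ := (1 - (2 : ℝ≥0∞) ^ (-σ))⁻¹

lemma gc_lt_top {σ : ℝ} (hσ : 0 < σ) : gc σ < ⊤ := by
  unfold gc
  rw [ENNReal.inv_lt_top, tsub_pos_iff_lt]
  exact ENNReal.rpow_lt_one_of_one_lt_of_neg (by norm_num) (by linarith)

lemma gc_ne_zero (σ : ℝ) : gc σ ≠ 0 := by
  unfold gc
  simp

lemma gc_anti {σ τ : ℝ} (h : σ ≤ τ) : gc τ ≤ gc σ := by
  unfold gc
  gcongr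
  norm_num

lemma geo_upper {σ : ℝ} (hσ : 0 < σ) (x : ℝ≥0∞) :
    ∑' j : ℤ, (if lv j < x then (lv j) ^ σ else 0) ≤ gc σ * x ^ σ := by
  rcases eq_or_ne x 0 with rfl | hx0
  · simp
  rcases eq_or_ne x ⊤ with rfl | hxt
  · rw [ENNReal.top_rpow_of_pos hσ, ENNReal.mul_top (gc_ne_zero σ)]
    exact le_top
  obtain ⟨j0, h1, h2⟩ := ENNReal.exists_mem_Ioc_zpow hx0 hxt (y := 2) (by norm_num) (by norm_num)
  have hinj : Function.Injective (fun k : ℕ => j0 - (k : ℤ)) := by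
    intro a b hab; simpa using hab
  rw [← hinj.tsum_eq]
  · calc _ ≤ ∑' k : ℕ, (lv j0) ^ σ * ((2 : ℝ≥0∞) ^ (-σ)) ^ k := by
          apply ENNReal.tsum_le_tsum
          intro k
          split_ifs
          · rw [lv_rpow_sub]
          · exact zero_le
      _ = (lv j0) ^ σ * gc σ := by
          rw [ENNReal.tsum_mul_left, ENNReal.tsum_geometric, gc]
      _ ≤ gc σ * x ^ σ := by
          rw [mul_comm]
          gcongr
          exact h1.le
  · intro j hj
    simp only [Function.mem_support, ne_eq, ite_eq_right_iff, Classical.not_imp] at hj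
    have : j ≤ j0 := by
      by_contra hlt
      push Not at hlt
      have : lv (j0 + 1) ≤ lv j := lv_mono (by omega)
      exact absurd (hj.1.trans_le h2) (not_lt.mpr this)
    refine ⟨(j0 - j).toNat, ?_⟩
    simp only
    omega

lemma geo_lower {σ : ℝ} (hσ : 0 < σ) (x : ℝ≥0∞) :
    x ^ σ ≤ 2 ^ σ * ∑' j : ℤ, (if lv j < x then (lv j) ^ σ else 0) := by
  rcases eq_or_ne x 0 with rfl | hx0
  · simp [hσ]
  rcases eq_or_ne x ⊤ with rfl | hxt
  · have hinj : Function.Injective (fun k : ℕ => (k : ℤ)) := by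
      intro a b hab; simpa using hab
    have : ∑' j : ℤ, (if lv j < ⊤ then (lv j) ^ σ else 0) = ⊤ := by
      rw [eq_top_iff]
      calc (⊤ : ℝ≥0∞) = ∑' k : ℕ, (1 : ℝ≥0∞) := by
            rw [ENNReal.tsum_const_eq_top_of_ne_zero]; norm_num
        _ ≤ ∑' k : ℕ, (if lv (k : ℤ) < ⊤ then (lv (k : ℤ)) ^ σ else 0) := by
            apply ENNReal.tsum_le_tsum
            intro k
            rw [if_pos (lv_ne_top _).lt_top]
            apply ENNReal.one_le_rpow _ hσ
            rw [← lv_zero]; exact lv_mono (by omega)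
        _ ≤ _ := ENNReal.tsum_comp_le_tsum_of_injective hinj
            (fun j : ℤ => if lv j < ⊤ then (lv j) ^ σ else 0)
    rw [this, ENNReal.mul_top]
    · exact le_top
    · simp
  obtain ⟨j0, h1, h2⟩ := ENNReal.exists_mem_Ioc_zpow hx0 hxt (y := 2) (by norm_num) (by norm_num)
  calc x ^ σ ≤ (lv (j0 + 1)) ^ σ := by gcongr; exact h2
    _ = 2 ^ σ * (if lv j0 < x then (lv j0) ^ σ else 0) := by
        rw [if_pos (show lv j0 < x from h1), lv_succ, ENNReal.mul_rpow_of_ne_top (by norm_num) (lv_ne_top _)]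
    _ ≤ _ := by gcongr; exact ENNReal.le_tsum j0

end Levels

end Part2

section Part3

section HL
variable {n : ℕ}

/-- average over a ball -/
def bavg (w : En n → ℝ≥0∞) (c : En n) (ρ : ℝ) : ℝ≥0∞ :=
  (volume (Metric.ball c ρ))⁻¹ * ∫⁻ y in Metric.ball c ρ, w y

/-- uncentred Hardy–Littlewood maximal function -/
def HLM (w : En n → ℝ≥0∞) (x : En n) : ℝ≥0∞ :=
  ⨆ (c : En n) (ρ : ℝ) (_ : dist x c < ρ), bavg w c ρ

lemma bavg_le_HLM (w : En n → ℝ≥0∞) {x c : En n} {ρ : ℝ} (h : dist x c < ρ) :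
    bavg w c ρ ≤ HLM w x := by
  unfold HLM
  exact le_iSup_of_le c (le_iSup_of_le ρ (le_iSup_of_le h le_rfl))

lemma lt_HLM_iff {w : En n → ℝ≥0∞} {x : En n} {l : ℝ≥0∞} :
    l < HLM w x ↔ ∃ c ρ, dist x c < ρ ∧ l < bavg w c ρ := by
  unfold HLM
  simp only [lt_iSup_iff, exists_prop]

lemma isOpen_HLM (w : En n → ℝ≥0∞) (l : ℝ≥0∞) : IsOpen {x | l < HLM w x} := by
  have : {x | l < HLM w x} = ⋃ (c : En n) (ρ : ℝ) (_ : l < bavg w c ρ), Metric.ball c ρ := by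
    ext x
    simp only [mem_ofPred_eq, lt_HLM_iff, mem_iUnion, Metric.mem_ball, exists_prop]
    constructor
    · rintro ⟨c, ρ, h1, h2⟩; exact ⟨c, ρ, h2, h1⟩
    · rintro ⟨c, ρ, h1, h2⟩; exact ⟨c, ρ, h2, h1⟩
  rw [this]
  exact isOpen_iUnion fun c => isOpen_iUnion fun ρ => isOpen_iUnion fun _ => Metric.isOpen_ball

lemma measurable_HLM (w : En n → ℝ≥0∞) : Measurable (HLM w) :=
  measurable_of_Ioi fun l => (isOpen_HLM w l).measurableSet

lemma vol_ball (c : En n) {ρ : ℝ} (hρ : 0 < ρ) :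
    volume (Metric.ball c ρ) = ENNReal.ofReal (ρ ^ n) * volume (Metric.ball (0 : En n) 1) := by
  rw [Measure.addHaar_ball_of_pos _ _ hρ]; simp

lemma vol_ball_pos (c : En n) {ρ : ℝ} (hρ : 0 < ρ) : volume (Metric.ball c ρ) ≠ 0 :=
  (Metric.measure_ball_pos _ _ hρ).ne'

lemma vol_ball_top (c : En n) (ρ : ℝ) : volume (Metric.ball c ρ) ≠ ⊤ :=
  measure_ball_lt_top.ne

lemma mul_bavg (w : En n → ℝ≥0∞) (c : En n) {ρ : ℝ} (hρ : 0 < ρ) :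
    volume (Metric.ball c ρ) * bavg w c ρ = ∫⁻ y in Metric.ball c ρ, w y := by
  rw [bavg, ← mul_assoc, ENNReal.mul_inv_cancel (vol_ball_pos c hρ) (vol_ball_top c ρ), one_mul]

lemma HLM_weak (hn : 1 ≤ n) (w : En n → ℝ≥0∞) (l : ℝ≥0∞) (hl : l ≠ 0) (hlt : l ≠ ⊤) :
    l * volume {x | l < HLM w x} ≤ ENNReal.ofReal (5 ^ n) * ∫⁻ y, w y := by
  rcases eq_or_ne (∫⁻ y, w y) ⊤ with hW | hW
  · rw [hW, ENNReal.mul_top (by simp)]; exact le_top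
  set t : Set (En n × ℝ) := {q | 0 < q.2 ∧ l < bavg w q.1 q.2} with ht
  have hv : ∀ q ∈ t, l * volume (Metric.ball q.1 q.2) ≤ ∫⁻ y in Metric.ball q.1 q.2, w y := by
    rintro ⟨c, ρ⟩ ⟨h1, h2⟩
    rw [← mul_bavg w c h1, mul_comm]
    gcongr
  set V := volume (Metric.ball (0 : En n) 1) with hV
  have hV0 : V ≠ 0 := vol_ball_pos 0 one_pos
  have hVt : V ≠ ⊤ := vol_ball_top 0 1
  have hR : ∀ q ∈ t, q.2 ≤ max 1 ((∫⁻ y, w y) / (l * V)).toReal := by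
    rintro ⟨c, ρ⟩ hq
    have h1 : 0 < ρ := hq.1
    rcases le_or_gt ρ 1 with h | h
    · exact h.trans (le_max_left _ _)
    · refine le_trans ?_ (le_max_right _ _)
      have h3 := (hv _ hq).trans (setLIntegral_le_lintegral _ _)
      rw [vol_ball _ h1] at h3
      have h4 : ENNReal.ofReal (ρ ^ n) ≤ (∫⁻ y, w y) / (l * V) := by
        rw [ENNReal.le_div_iff_mul_le (Or.inl (mul_ne_zero hl hV0))
          (Or.inl (ENNReal.mul_ne_top hlt hVt))]
        calc _ = l * (ENNReal.ofReal (ρ ^ n) * V) := by ring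
          _ ≤ _ := h3
      have h5 : (∫⁻ y, w y) / (l * V) ≠ ⊤ :=
        ENNReal.div_ne_top hW (mul_ne_zero hl hV0)
      rw [ENNReal.ofReal_le_iff_le_toReal h5] at h4
      exact (le_self_pow₀ h.le (by omega)).trans h4
  obtain ⟨u, hut, hdis, hcov⟩ := Vitali.exists_disjoint_subfamily_covering_enlargement_closedBall
    t (fun q => q.1) (fun q => q.2) _ hR 5 (by norm_num)
  have hdis' : u.PairwiseDisjoint fun q => Metric.ball q.1 q.2 :=
    hdis.mono_on fun q _ => Metric.ball_subset_closedBall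
  have hcount : u.Countable := by
    apply hdis'.countable_of_isOpen (fun q _ => Metric.isOpen_ball)
    intro q hq
    exact ⟨q.1, Metric.mem_ball_self (hut hq).1⟩
  have hsub : {x | l < HLM w x} ⊆ ⋃ q ∈ u, Metric.closedBall q.1 (5 * q.2) := by
    intro x hx
    obtain ⟨c, ρ, h1, h2⟩ := lt_HLM_iff.mp hx
    have h0 : 0 < ρ := dist_nonneg.trans_lt h1
    obtain ⟨b, hb, hb2⟩ := hcov (c, ρ) ⟨h0, h2⟩
    simp only [mem_iUnion, exists_prop]
    exact ⟨b, hb, hb2 (Metric.mem_closedBall.mpr h1.le)⟩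
  have := hcount.to_subtype
  calc l * volume {x | l < HLM w x}
      ≤ l * ∑' q : u, volume (Metric.closedBall q.1.1 (5 * q.1.2)) := by
        gcongr
        exact (measure_mono hsub).trans (measure_biUnion_le _ hcount _)
    _ = ∑' q : u, l * volume (Metric.closedBall q.1.1 (5 * q.1.2)) := by
        rw [ENNReal.tsum_mul_left]
    _ ≤ ∑' q : u, ENNReal.ofReal (5 ^ n) * ∫⁻ y in Metric.ball q.1.1 q.1.2, w y := by
        apply ENNReal.tsum_le_tsum
        intro q
        have hq := hut q.2
        have : volume (Metric.closedBall q.1.1 (5 * q.1.2)) =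
            ENNReal.ofReal (5 ^ n) * volume (Metric.ball q.1.1 q.1.2) := by
          rw [Measure.addHaar_closedBall _ _ (by linarith [hq.1]), finrank_euclideanSpace_fin,
            vol_ball _ hq.1, mul_pow, ENNReal.ofReal_mul (by positivity)]
          ring
        rw [this]
        calc _ = ENNReal.ofReal (5 ^ n) * (l * volume (Metric.ball q.1.1 q.1.2)) := by ring
          _ ≤ _ := by gcongr; exact hv _ hq
    _ = ENNReal.ofReal (5 ^ n) * ∑' q : u, ∫⁻ y in Metric.ball q.1.1 q.1.2, w y := by
        rw [ENNReal.tsum_mul_left]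
    _ ≤ _ := by
        gcongr
        rw [← lintegral_biUnion hcount (fun q _ => measurableSet_ball) hdis']
        exact setLIntegral_le_lintegral _ _

lemma bavg_mono {w v : En n → ℝ≥0∞} (h : w ≤ v) (c : En n) (ρ : ℝ) : bavg w c ρ ≤ bavg v c ρ := by
  unfold bavg
  gcongr
  exact h _

lemma HLM_mono {w v : En n → ℝ≥0∞} (h : w ≤ v) (x : En n) : HLM w x ≤ HLM v x := by
  unfold HLM
  exact iSup_mono fun c => iSup_mono fun ρ => iSup_mono fun _ => bavg_mono h c ρ

lemma bavg_add {w v : En n → ℝ≥0∞} (hw : Measurable w) (c : En n) (ρ : ℝ) :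
    bavg (fun x => w x + v x) c ρ = bavg w c ρ + bavg v c ρ := by
  unfold bavg
  rw [lintegral_add_left hw, mul_add]

lemma bavg_const_le (k : ℝ≥0∞) (c : En n) (ρ : ℝ) : bavg (fun _ => k) c ρ ≤ k := by
  unfold bavg
  rw [setLIntegral_const, mul_comm, mul_assoc]
  calc _ ≤ k * 1 := by gcongr; exact ENNReal.mul_inv_le_one _
    _ = k := mul_one k

lemma HLM_add_le {w v : En n → ℝ≥0∞} (hw : Measurable w) (x : En n) :
    HLM (fun x => w x + v x) x ≤ HLM w x + HLM v x := by
  conv_lhs => unfold HLM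
  refine iSup_le fun c => iSup_le fun ρ => iSup_le fun h => ?_
  rw [bavg_add hw]
  exact add_le_add (bavg_le_HLM w h) (bavg_le_HLM v h)

lemma HLM_const_le (k : ℝ≥0∞) (x : En n) : HLM (fun _ => k) x ≤ k := by
  unfold HLM
  exact iSup_le fun c => iSup_le fun ρ => iSup_le fun h => bavg_const_le k c ρ

lemma HLM_strong (hn : 1 ≤ n) {σ : ℝ} (hσ : 1 < σ) (w : En n → ℝ≥0∞) (hw : Measurable w) :
    ∫⁻ x, (HLM w x) ^ σ ≤
      (2 ^ σ * 2 ^ σ * ENNReal.ofReal (5 ^ n) * gc (σ - 1)) * ∫⁻ x, (w x) ^ σ := by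
  have hσ0 : 0 < σ := by linarith
  set A := ENNReal.ofReal ((5 : ℝ) ^ n)
  have hmset : ∀ l, MeasurableSet {x | l < w x} := fun l => measurableSet_lt measurable_const hw
  have hlevel : ∀ j : ℤ, (lv (j + 1)) ^ σ * volume {x | lv (j + 1) < HLM w x} ≤
      (2 ^ σ * A) * ∫⁻ x, w x * (if lv j < w x then (lv j) ^ (σ - 1) else 0) := by
    intro j
    set wj : En n → ℝ≥0∞ := fun x => if lv j < w x then w x else 0 with hwj
    have hwjm : Measurable wj := Measurable.ite (hmset _) hw measurable_const
    have hsub : {x | lv (j + 1) < HLM w x} ⊆ {x | lv j < HLM wj x} := by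
      intro x hx
      simp only [mem_ofPred_eq] at hx ⊢
      have h1 : HLM w x ≤ HLM wj x + lv j := by
        calc HLM w x ≤ HLM (fun x => wj x + lv j) x := by
              apply HLM_mono
              intro y
              simp only [hwj]
              split_ifs with h
              · exact le_self_add
              · simpa using h
          _ ≤ HLM wj x + HLM (fun _ => lv j) x := HLM_add_le hwjm x
          _ ≤ _ := by gcongr; exact HLM_const_le _ _
      rw [lv_succ, two_mul] at hx
      by_contra hcon
      push Not at hcon
      exact absurd (hx.trans_le h1) (not_lt.mpr (by gcongr))
    have hw1 := HLM_weak hn wj (lv j) (lv_ne_zero j) (lv_ne_top j)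
    calc _ ≤ (lv (j + 1)) ^ σ * volume {x | lv j < HLM wj x} := by gcongr
      _ = 2 ^ σ * (lv j) ^ (σ - 1) * (lv j * volume {x | lv j < HLM wj x}) := by
          rw [lv_succ, ENNReal.mul_rpow_of_ne_top (by norm_num) (lv_ne_top _)]
          have : (lv j) ^ σ = (lv j) ^ (σ - 1) * lv j := by
            conv_rhs => rw [← ENNReal.rpow_one (lv j), ← ENNReal.rpow_mul, one_mul,
              ← ENNReal.rpow_add _ _ (lv_ne_zero j) (lv_ne_top j)]
            simp
          rw [this]; ring
      _ ≤ 2 ^ σ * (lv j) ^ (σ - 1) * (A * ∫⁻ y, wj y) := by gcongr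
      _ = (2 ^ σ * A) * ((lv j) ^ (σ - 1) * ∫⁻ y, wj y) := by ring
      _ = _ := by
          rw [← lintegral_const_mul _ hwjm]
          congr 1
          apply lintegral_congr
          intro x
          simp only [hwj]
          split_ifs <;> ring
  calc ∫⁻ x, (HLM w x) ^ σ
      ≤ ∫⁻ x, 2 ^ σ * ∑' j : ℤ, (if lv j < HLM w x then (lv j) ^ σ else 0) := by
        apply lintegral_mono; intro x; exact geo_lower hσ0 _
    _ = 2 ^ σ * ∑' j : ℤ, (lv j) ^ σ * volume {x | lv j < HLM w x} := by
        have hm : ∀ j, Measurable fun x => (if lv j < HLM w x then (lv j) ^ σ else 0) :=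
          fun j => Measurable.ite (isOpen_HLM w _).measurableSet measurable_const measurable_const
        rw [lintegral_const_mul _ (Measurable.tsum hm), lintegral_tsum
          (fun j => (hm j).aemeasurable)]
        congr 1
        apply tsum_congr
        intro j
        rw [← lintegral_indicator_const (isOpen_HLM w _).measurableSet]
        apply lintegral_congr
        intro x
        simp [indicator]
    _ = 2 ^ σ * ∑' j : ℤ, (lv (j + 1)) ^ σ * volume {x | lv (j + 1) < HLM w x} := by
        congr 1
        exact ((Equiv.addRight (1 : ℤ)).tsum_eq
          (fun j => (lv j) ^ σ * volume {x | lv j < HLM w x})).symm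
    _ ≤ 2 ^ σ * ∑' j : ℤ, (2 ^ σ * A) *
          ∫⁻ x, w x * (if lv j < w x then (lv j) ^ (σ - 1) else 0) := by
        exact mul_le_mul_right (ENNReal.tsum_le_tsum hlevel) _
    _ = 2 ^ σ * (2 ^ σ * A) * ∫⁻ x, w x * ∑' j : ℤ, (if lv j < w x then (lv j) ^ (σ - 1) else 0) := by
        have hm : ∀ j, Measurable fun x => w x * (if lv j < w x then (lv j) ^ (σ - 1) else 0) :=
          fun j => hw.mul (Measurable.ite (hmset _) measurable_const measurable_const)
        rw [ENNReal.tsum_mul_left, ← lintegral_tsum (fun j => (hm j).aemeasurable)]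
        simp_rw [ENNReal.tsum_mul_left]
        ring
    _ ≤ 2 ^ σ * (2 ^ σ * A) * ∫⁻ x, gc (σ - 1) * (w x) ^ σ := by
        refine mul_le_mul_right (lintegral_mono fun x => ?_) _
        calc w x * ∑' j : ℤ, (if lv j < w x then (lv j) ^ (σ - 1) else 0)
            ≤ w x * (gc (σ - 1) * (w x) ^ (σ - 1)) := by
              gcongr; exact geo_upper (by linarith) _
          _ = gc (σ - 1) * ((w x) ^ (1 : ℝ) * (w x) ^ (σ - 1)) := by
              rw [ENNReal.rpow_one]; ring
          _ = _ := by
              rw [← ENNReal.rpow_add_of_nonneg _ _ (by norm_num) (by linarith)]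
              congr 2; ring
    _ = _ := by
        rw [lintegral_const_mul _ (hw.pow_const _)]
        ring

end HL

end Part3

section Part4

variable {n : ℕ}

/-- packaged log-Hölder exponents with bounds -/
structure LH (n : ℕ) (q : En n → ℝ) (lo hi C qinf : ℝ) : Prop where
  meas : Measurable q
  lo_pos : 0 < lo
  lo_le : ∀ x, lo ≤ q x
  le_hi : ∀ x, q x ≤ hi
  C_pos : 0 < C
  loc : ∀ x y : En n, x ≠ y → |q x - q y| ≤ C / Real.log (Real.exp 1 + 1 / ‖x - y‖)
  infty : ∀ x : En n, |q x - qinf| ≤ C / Real.log (Real.exp 1 + ‖x‖)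
  lo_inf : lo ≤ qinf
  inf_hi : qinf ≤ hi

lemma one_le_log_e_add {y : ℝ} (hy : 0 ≤ y) : 1 ≤ Real.log (Real.exp 1 + y) := by
  rw [Real.le_log_iff_exp_le (by positivity)]; linarith

lemma LH.div {q : En n → ℝ} {lo hi C qinf : ℝ} (h : LH n q lo hi C qinf) {r : ℝ} (hr : 0 < r) :
    LH n (fun x => q x / r) (lo / r) (hi / r) (C / r) (qinf / r) where
  meas := h.meas.div_const r
  lo_pos := div_pos h.lo_pos hr
  lo_le x := by have := h.lo_le x; gcongr
  le_hi x := by have := h.le_hi x; gcongr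
  C_pos := div_pos h.C_pos hr
  loc x y hxy := by
    have := h.loc x y hxy
    rw [← sub_div, abs_div, abs_of_pos hr, div_right_comm]; gcongr
  infty x := by
    have := h.infty x
    rw [← sub_div, abs_div, abs_of_pos hr, div_right_comm]; gcongr
  lo_inf := by have := h.lo_inf; gcongr
  inf_hi := by have := h.inf_hi; gcongr

lemma eq_real {g s1 s2 s0 C X : ℝ} {N : ℝ} (hN : 0 < N) (hg0 : 0 ≤ g) (hg : g ≤ 1) (hs0 : 0 < s0)
    (h1 : s0 ≤ s1) (h2 : 0 < s2) (hC : 0 < C) (hX : 0 ≤ X)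
    (h : |s1 - s2| ≤ C / Real.log (Real.exp 1 + X)) :
    g ^ s1 ≤ Real.exp (C * (N / s0)) * g ^ s2 + (1 + X) ^ (-N) := by
  have hL := one_le_log_e_add hX
  have hE : 0 < Real.exp 1 + X := by positivity
  rcases le_or_gt g ((Real.exp 1 + X) ^ (-(N / s0))) with hle | hlt
  · have : g ^ s1 ≤ (1 + X) ^ (-N) := by
      calc g ^ s1 ≤ g ^ s0 := Real.rpow_le_rpow_of_exponent_ge' hg0 hg hs0.le h1
        _ ≤ ((Real.exp 1 + X) ^ (-(N / s0))) ^ s0 := by gcongr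
        _ = (Real.exp 1 + X) ^ (-N) := by
          rw [← Real.rpow_mul hE.le]; congr 1; field_simp
        _ ≤ (1 + X) ^ (-N) := by
          apply Real.rpow_le_rpow_of_nonpos (by positivity) _ (by linarith)
          have := Real.add_one_le_exp (1:ℝ); linarith
    have : 0 ≤ Real.exp (C * (N / s0)) * g ^ s2 := by positivity
    linarith
  · have hgp : 0 < g := lt_of_le_of_lt (by positivity) hlt
    have hK : g ^ s1 ≤ Real.exp (C * (N / s0)) * g ^ s2 := by
      rcases le_total s2 s1 with hs | hs
      · calc g ^ s1 ≤ g ^ s2 := Real.rpow_le_rpow_of_exponent_ge hgp hg hs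
          _ = 1 * g ^ s2 := (one_mul _).symm
          _ ≤ _ := by
            gcongr
            rw [Real.one_le_exp_iff]; positivity
      · have hlg : -(N / s0) * Real.log (Real.exp 1 + X) ≤ Real.log g := by
          rw [← Real.log_rpow hE]; exact Real.log_le_log (by positivity) hlt.le
        have hd : s2 - s1 ≤ C / Real.log (Real.exp 1 + X) := by
          rw [abs_sub_comm, abs_of_nonneg (by linarith)] at h; exact h
        have hd2 : (s2 - s1) * Real.log (Real.exp 1 + X) ≤ C := by
          rwa [le_div_iff₀ (by linarith)] at hd
        rw [Real.rpow_def_of_pos hgp, Real.rpow_def_of_pos hgp, ← Real.exp_add]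
        apply Real.exp_le_exp.mpr
        have h3 : 0 < N / s0 := by positivity
        nlinarith [mul_le_mul_of_nonneg_left hlg (by linarith : 0 ≤ s2 - s1),
          mul_le_mul_of_nonneg_left hd2 h3.le]
    have : 0 ≤ (1 + X) ^ (-N) := by positivity
    linarith

lemma eq_enn {g : ℝ≥0∞} {s1 s2 s0 C X N : ℝ} (hN : 0 < N) (hg : g ≤ 1) (hs0 : 0 < s0)
    (h1 : s0 ≤ s1) (h2 : 0 < s2) (hC : 0 < C) (hX : 0 ≤ X)
    (h : |s1 - s2| ≤ C / Real.log (Real.exp 1 + X)) :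
    g ^ s1 ≤ ENNReal.ofReal (Real.exp (C * (N / s0))) * g ^ s2 + ENNReal.ofReal ((1 + X) ^ (-N)) := by
  have hgt : g ≠ ⊤ := ne_top_of_le_ne_top (by simp) hg
  have hr : g.toReal ≤ 1 := by simpa using ENNReal.toReal_mono (by simp) hg
  have := eq_real hN ENNReal.toReal_nonneg hr hs0 h1 h2 hC hX h
  rw [← ENNReal.ofReal_toReal hgt, ENNReal.ofReal_rpow_of_nonneg (by simp) (by linarith),
    ENNReal.ofReal_rpow_of_nonneg (by simp) h2.le, ← ENNReal.ofReal_mul (by positivity),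
    ← ENNReal.ofReal_add (by positivity) (by positivity)]
  exact ENNReal.ofReal_le_ofReal this

lemma bavg_jensen {w : En n → ℝ≥0∞} (hw : Measurable w) {s : ℝ} (hs : 1 ≤ s) (c : En n) {ρ : ℝ}
    (hρ : 0 < ρ) : (bavg w c ρ) ^ s ≤ bavg (fun y => w y ^ s) c ρ := by
  rcases hs.eq_or_lt with rfl | hs1
  · simp
  have hs0 : 0 < s := by linarith
  set V := volume (Metric.ball c ρ)
  have hV0 : V ≠ 0 := vol_ball_pos c hρ
  have hVt : V ≠ ⊤ := vol_ball_top c ρ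
  have hc := Real.HolderConjugate.conjExponent hs1
  have h := ENNReal.lintegral_mul_le_Lp_mul_Lq (volume.restrict (Metric.ball c ρ)) hc
    hw.aemeasurable (g := fun _ => 1) aemeasurable_const
  simp only [Pi.mul_apply, mul_one, ENNReal.one_rpow, lintegral_const, one_mul,
    Measure.restrict_apply_univ] at h
  have h2 := ENNReal.rpow_le_rpow h hs0.le
  rw [ENNReal.mul_rpow_of_nonneg _ _ hs0.le, ← ENNReal.rpow_mul, ← ENNReal.rpow_mul,
    one_div_mul_cancel hs0.ne', ENNReal.rpow_one] at h2
  have he : 1 / Real.conjExponent s * s = s - 1 := by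
    rw [Real.conjExponent]; field_simp
  rw [he] at h2
  change (V⁻¹ * _) ^ s ≤ V⁻¹ * _
  rw [ENNReal.mul_rpow_of_nonneg _ _ hs0.le]
  calc V⁻¹ ^ s * (∫⁻ y in Metric.ball c ρ, w y) ^ s
      ≤ V⁻¹ ^ s * ((∫⁻ y in Metric.ball c ρ, w y ^ s) * V ^ (s - 1)) := by gcongr
    _ = (V⁻¹ ^ s * V ^ (s - 1)) * (∫⁻ y in Metric.ball c ρ, w y ^ s) := by ring
    _ = V⁻¹ * ∫⁻ y in Metric.ball c ρ, w y ^ s := by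
        congr 1
        rw [ENNReal.inv_rpow, ← ENNReal.rpow_neg, ← ENNReal.rpow_add _ _ hV0 hVt]
        rw [show -s + (s-1) = -1 by ring, ENNReal.rpow_neg_one]

end Part4

section Part5

variable {n : ℕ}

lemma LH.loc' {q : En n → ℝ} {lo hi C qinf : ℝ} (h : LH n q lo hi C qinf) {x y : En n} {D : ℝ}
    (hD : 0 < D) (hxy : ‖x - y‖ ≤ D) :
    |q x - q y| ≤ C / Real.log (Real.exp 1 + 1 / D) := by
  have hL := one_le_log_e_add (by positivity : 0 ≤ 1 / D)
  rcases eq_or_ne x y with rfl | hne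
  · simp only [sub_self, abs_zero]
    have := h.C_pos
    positivity
  refine (h.loc x y hne).trans ?_
  have h0 : 0 < ‖x - y‖ := norm_pos_iff.mpr (sub_ne_zero.mpr hne)
  have := h.C_pos
  gcongr

/-- constant for the local estimate -/
def Kloc (n : ℕ) (C : ℝ) : ℝ≥0∞ :=
  (max 1 (volume (Metric.ball (0 : En n) 1))⁻¹) ^ C * ENNReal.ofReal (Real.exp (2 * n * C))

lemma Kloc_lt_top (C : ℝ) (hC : 0 < C) : Kloc n C < ⊤ := by
  unfold Kloc
  refine ENNReal.mul_lt_top ?_ (by simp)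
  apply ENNReal.rpow_lt_top_of_nonneg hC.le
  have := vol_ball_pos (0 : En n) one_pos
  simp [this]

lemma loc_pow {C ρ κ : ℝ} (hC : 0 < C) (hρ : 0 < ρ) (m : ℝ≥0∞) (c : En n)
    (hm : m ≤ (volume (Metric.ball c ρ))⁻¹)
    (hκ0 : 0 ≤ κ) (hκ : κ ≤ C / Real.log (Real.exp 1 + 1 / (2 * ρ))) : m ^ κ ≤ Kloc n C := by
  have hL := one_le_log_e_add (by positivity : 0 ≤ 1 / (2 * ρ))
  set L := Real.log (Real.exp 1 + 1 / (2 * ρ)) with hLd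
  have hκL : κ * L ≤ C := by rwa [le_div_iff₀ (by linarith)] at hκ
  have hκC : κ ≤ C := by nlinarith
  rw [vol_ball c hρ, ENNReal.mul_inv (Or.inr (vol_ball_top _ _)) (Or.inl (by simp))] at hm
  calc m ^ κ ≤ ((ENNReal.ofReal (ρ ^ n))⁻¹ * (volume (Metric.ball (0 : En n) 1))⁻¹) ^ κ := by gcongr
    _ = (ENNReal.ofReal (ρ ^ n))⁻¹ ^ κ * (volume (Metric.ball (0 : En n) 1))⁻¹ ^ κ :=
        ENNReal.mul_rpow_of_nonneg _ _ hκ0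
    _ ≤ ENNReal.ofReal (Real.exp (2 * n * C)) * (max 1 (volume (Metric.ball (0 : En n) 1))⁻¹) ^ C := by
        gcongr ?_ * ?_
        · rw [← ENNReal.ofReal_inv_of_pos (by positivity), ENNReal.ofReal_rpow_of_pos (by positivity)]
          apply ENNReal.ofReal_le_ofReal
          rw [Real.rpow_def_of_pos (by positivity)]
          apply Real.exp_le_exp.mpr
          rw [Real.log_inv, Real.log_pow]
          have h2 : -Real.log ρ ≤ 2 * L := by
            have : Real.log (1 / (2 * ρ)) ≤ L :=
              Real.log_le_log (by positivity) (by have := Real.exp_pos 1; linarith)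
            rw [one_div, Real.log_inv, Real.log_mul (by norm_num) hρ.ne'] at this
            have := Real.log_two_lt_d9
            linarith
          have hn : (0:ℝ) ≤ n := Nat.cast_nonneg n
          nlinarith [mul_le_mul_of_nonneg_left h2 (mul_nonneg hn hκ0),
            mul_le_mul_of_nonneg_left hκL hn]
        · calc _ ≤ (max 1 (volume (Metric.ball (0 : En n) 1))⁻¹) ^ κ := by
                gcongr; exact le_max_right _ _
            _ ≤ _ := ENNReal.rpow_le_rpow_of_exponent_le (le_max_left _ _) hκC
    _ = Kloc n C := by rw [Kloc, mul_comm]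

lemma H_local {q : En n → ℝ} {hi C qinf : ℝ} (h : LH n q 2 hi C qinf)
    (w : En n → ℝ≥0∞) (hw : Measurable w) (hw1 : ∀ x, w x = 0 ∨ 1 ≤ w x)
    (hI : ∫⁻ x, (w x) ^ (q x) ≤ 1) (x : En n) :
    (HLM w x) ^ (q x) ≤ Kloc n C * (HLM (fun y => w y ^ (q y / 2)) x) ^ (2:ℝ) := by
  have hqx : 0 < q x := by have := h.lo_le x; linarith
  have hq2 := h.lo_le x
  -- sup inside
  have key : ∀ c ρ, dist x c < ρ →
      (bavg w c ρ) ^ (q x) ≤ Kloc n C * (HLM (fun y => w y ^ (q y / 2)) x) ^ (2:ℝ) := by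
    intro c ρ hd
    have hρ : 0 < ρ := lt_of_le_of_lt dist_nonneg hd
    set κ := C / Real.log (Real.exp 1 + 1 / (2 * ρ))
    have hL := one_le_log_e_add (by positivity : 0 ≤ 1 / (2 * ρ))
    have hκ0 : 0 ≤ κ := by have := h.C_pos; positivity
    set q' := max (q x - κ) 2
    have hq'x : q' ≤ q x := by apply max_le <;> linarith
    have hq'2 : 2 ≤ q' := le_max_right _ _
    have hdiff : q x - q' ≤ κ := by have : q x - κ ≤ q' := le_max_left _ _; linarith
    have hq'y : ∀ y ∈ Metric.ball c ρ, q' ≤ q y := by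
      intro y hy
      apply max_le _ (h.lo_le y)
      have h1 : ‖x - y‖ ≤ 2 * ρ := by
        rw [← dist_eq_norm]
        have := dist_triangle_right x y c
        rw [Metric.mem_ball] at hy; linarith
      have := abs_le.mp (h.loc' (by positivity) h1)
      linarith [this.2]
    set m := bavg w c ρ with hm
    have hJ : m ^ (q' / 2) ≤ HLM (fun y => w y ^ (q y / 2)) x := by
      refine (bavg_jensen hw (by linarith) c hρ).trans (le_trans ?_ (bavg_le_HLM _ hd))
      unfold bavg
      refine mul_le_mul_right ?_ _
      apply setLIntegral_mono' measurableSet_ball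
      intro y hy
      have hy' := hq'y y hy
      rcases hw1 y with h0 | h1
      · rw [h0, ENNReal.zero_rpow_of_pos (by linarith)]; exact zero_le
      · exact ENNReal.rpow_le_rpow_of_exponent_le h1 (by linarith)
    have hJ2 : m ^ q' ≤ (HLM (fun y => w y ^ (q y / 2)) x) ^ (2:ℝ) := by
      have := ENNReal.rpow_le_rpow hJ (by norm_num : (0:ℝ) ≤ 2)
      rwa [← ENNReal.rpow_mul, div_mul_cancel₀ _ (by norm_num)] at this
    have hmV : m ≤ (volume (Metric.ball c ρ))⁻¹ := by
      rw [hm, bavg]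
      calc _ ≤ (volume (Metric.ball c ρ))⁻¹ * 1 := by
            gcongr
            refine le_trans ?_ hI
            refine (setLIntegral_le_lintegral _ _).trans (lintegral_mono fun y => ?_)
            have := h.lo_le y
            rcases hw1 y with h0 | h1
            · rw [h0]; exact zero_le
            · calc w y = w y ^ (1:ℝ) := (ENNReal.rpow_one _).symm
                _ ≤ _ := ENNReal.rpow_le_rpow_of_exponent_le h1 (by linarith)
        _ = _ := mul_one _
    have hK := loc_pow (κ := q x - q') h.C_pos hρ m c hmV (by linarith) hdiff
    calc m ^ (q x) = m ^ ((q x - q') + q') := by ring_nf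
      _ = m ^ (q x - q') * m ^ q' := ENNReal.rpow_add_of_nonneg _ _ (by linarith) (by linarith)
      _ ≤ _ := mul_le_mul' hK hJ2
  have : HLM w x ≤ (Kloc n C * (HLM (fun y => w y ^ (q y / 2)) x) ^ (2:ℝ)) ^ (q x)⁻¹ := by
    conv_lhs => unfold HLM
    refine iSup_le fun c => iSup_le fun ρ => iSup_le fun hd => ?_
    rw [ENNReal.le_rpow_inv_iff hqx]
    exact key c ρ hd
  rwa [ENNReal.le_rpow_inv_iff hqx] at this

lemma H_inf (hn : 1 ≤ n) {q : En n → ℝ} {hi C qinf : ℝ} (h : LH n q 2 hi C qinf) :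
    ∃ K : ℝ≥0∞, K < ⊤ ∧ ∀ (w : En n → ℝ≥0∞) (_ : Measurable w) (_ : ∀ x, w x ≤ 1)
    (_ : ∫⁻ x, (w x) ^ (q x) ≤ 1), ∫⁻ x, (HLM w x) ^ (q x) ≤ K := by
  set E := ENNReal.ofReal (Real.exp (C * ((n+1:ℝ) / 2)))
  have hqi : 2 ≤ qinf := h.lo_inf
  set S := (2 ^ qinf * 2 ^ qinf * ENNReal.ofReal (5 ^ n) * gc (qinf - 1)) with hS
  have hN : (0:ℝ) < n + 1 := by positivity
  have hKc : Kc n (n+1:ℝ) < ⊤ := Kc_lt_top (by linarith)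
  have hSt : S < ⊤ := by
    have h2 : (2:ℝ≥0∞) ^ qinf < ⊤ := ENNReal.rpow_lt_top_of_nonneg (by linarith) (by norm_num)
    exact ENNReal.mul_lt_top (ENNReal.mul_lt_top (ENNReal.mul_lt_top h2 h2) (by simp))
      (gc_lt_top (by linarith))
  have hEt : E < ⊤ := by simp [E]
  have herr : Measurable (fun x : En n => ENNReal.ofReal ((1 + ‖x‖) ^ (-(n+1:ℝ)))) := by fun_prop
  refine ⟨E * (S * (E * 1 + Kc n (n+1:ℝ))) + Kc n (n+1:ℝ), ?_, ?_⟩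
  · refine ENNReal.add_lt_top.mpr ⟨ENNReal.mul_lt_top hEt (ENNReal.mul_lt_top hSt
      (ENNReal.add_lt_top.mpr ⟨by simpa using hEt, hKc⟩)), hKc⟩
  intro w hw hw1 hI
  have hH1 : ∀ x, HLM w x ≤ 1 := fun x => (HLM_mono (v := fun _ => 1) hw1 x).trans (HLM_const_le 1 x)
  have st1 : ∫⁻ x, (w x) ^ qinf ≤ E * 1 + Kc n (n+1:ℝ) := by
    calc ∫⁻ x, (w x) ^ qinf ≤ ∫⁻ x, (E * (w x) ^ (q x) + ENNReal.ofReal ((1 + ‖x‖) ^ (-(n+1:ℝ)))) := by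
          refine lintegral_mono fun x => ?_
          refine eq_enn hN (hw1 x) (by norm_num) hqi (by have := h.lo_le x; linarith) h.C_pos
            (norm_nonneg x) ?_
          rw [abs_sub_comm]; exact h.infty x
      _ = E * (∫⁻ x, (w x) ^ (q x)) + Kc n (n+1:ℝ) := by
          rw [lintegral_add_right _ herr, lintegral_const_mul' _ _ hEt.ne]; rfl
      _ ≤ _ := by gcongr
  have st2 := HLM_strong hn (by linarith : 1 < qinf) w hw
  calc ∫⁻ x, (HLM w x) ^ (q x)
      ≤ ∫⁻ x, (E * (HLM w x) ^ qinf + ENNReal.ofReal ((1 + ‖x‖) ^ (-(n+1:ℝ)))) := by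
        refine lintegral_mono fun x => ?_
        exact eq_enn hN (hH1 x) (by norm_num) (h.lo_le x) (by linarith) h.C_pos
            (norm_nonneg x) (h.infty x)
    _ = E * (∫⁻ x, (HLM w x) ^ qinf) + Kc n (n+1:ℝ) := by
        rw [lintegral_add_right _ herr, lintegral_const_mul' _ _ hEt.ne]; rfl
    _ ≤ _ := by
        gcongr
        exact st2.trans (by gcongr)

theorem H_main (hn : 1 ≤ n) {q : En n → ℝ} {hi C qinf : ℝ} (h : LH n q 2 hi C qinf) :
    ∃ K : ℝ≥0∞, K < ⊤ ∧ ∀ (w : En n → ℝ≥0∞) (_ : Measurable w)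
    (_ : ∫⁻ x, (w x) ^ (q x) ≤ 1), ∫⁻ x, (HLM w x) ^ (q x) ≤ K := by
  obtain ⟨K1, hK1, H1⟩ := H_inf hn h
  set S := ((2:ℝ≥0∞) ^ (2:ℝ) * 2 ^ (2:ℝ) * ENNReal.ofReal (5 ^ n) * gc (2 - 1)) with hS
  have hSt : S < ⊤ := by
    have h2 : (2:ℝ≥0∞) ^ (2:ℝ) < ⊤ := ENNReal.rpow_lt_top_of_nonneg (by norm_num) (by norm_num)
    exact ENNReal.mul_lt_top (ENNReal.mul_lt_top (ENNReal.mul_lt_top h2 h2) (by simp))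
      (gc_lt_top (by norm_num))
  have hhi : 2 ≤ hi := (h.lo_le 0).trans (h.le_hi 0)
  refine ⟨2 ^ hi * (Kloc n C * S + K1), ?_, ?_⟩
  · refine ENNReal.mul_lt_top (ENNReal.rpow_lt_top_of_nonneg (by linarith) (by norm_num))
      (ENNReal.add_lt_top.mpr ⟨ENNReal.mul_lt_top (Kloc_lt_top C h.C_pos) hSt, hK1⟩)
  intro w hw hI
  have hqp : ∀ x, 0 < q x := fun x => by have := h.lo_le x; linarith
  have hms : MeasurableSet {x | 1 ≤ w x} := measurableSet_le measurable_const hw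
  set w1 : En n → ℝ≥0∞ := {x | 1 ≤ w x}.indicator w with hw1
  set w2 : En n → ℝ≥0∞ := {x | 1 ≤ w x}ᶜ.indicator w with hw2
  have mw1 : Measurable w1 := hw.indicator hms
  have mw2 : Measurable w2 := hw.indicator hms.compl
  have hsum : w = fun x => w1 x + w2 x := by
    funext x
    exact (congrFun (indicator_self_add_compl {x | 1 ≤ w x} w) x).symm
  have l1 : ∀ x, w1 x ≤ w x := fun x => indicator_le_self _ _ x
  have l2 : ∀ x, w2 x ≤ w x := fun x => indicator_le_self _ _ x
  have I1 : ∫⁻ x, (w1 x) ^ (q x) ≤ 1 := le_trans (lintegral_mono fun x =>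
    ENNReal.rpow_le_rpow (l1 x) (hqp x).le) hI
  have I2 : ∫⁻ x, (w2 x) ^ (q x) ≤ 1 := le_trans (lintegral_mono fun x =>
    ENNReal.rpow_le_rpow (l2 x) (hqp x).le) hI
  have e1 : ∀ x, w1 x = 0 ∨ 1 ≤ w1 x := by
    intro x
    by_cases hx : x ∈ {x | 1 ≤ w x}
    · right; rw [hw1, indicator_of_mem hx]; exact hx
    · left; rw [hw1, indicator_of_notMem hx]
  have e2 : ∀ x, w2 x ≤ 1 := by
    intro x
    by_cases hx : 1 ≤ w x
    · rw [hw2, indicator_of_notMem (by simpa using hx)]; exact zero_le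
    · exact (l2 x).trans (not_le.mp hx).le
  have b2 := H1 w2 mw2 e2 I2
  have b1 : ∫⁻ x, (HLM w1 x) ^ (q x) ≤ Kloc n C * S := by
    calc ∫⁻ x, (HLM w1 x) ^ (q x)
        ≤ ∫⁻ x, Kloc n C * (HLM (fun y => w1 y ^ (q y / 2)) x) ^ (2:ℝ) :=
          lintegral_mono fun x => H_local h w1 mw1 e1 I1 x
      _ = Kloc n C * ∫⁻ x, (HLM (fun y => w1 y ^ (q y / 2)) x) ^ (2:ℝ) :=
          lintegral_const_mul' _ _ (Kloc_lt_top C h.C_pos).ne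
      _ ≤ Kloc n C * (S * ∫⁻ x, (w1 x ^ (q x / 2)) ^ (2:ℝ)) := by
          gcongr
          exact HLM_strong hn (by norm_num) _ (mw1.pow (h.meas.div_const 2))
      _ ≤ Kloc n C * (S * 1) := by
          gcongr
          refine le_trans (le_of_eq ?_) I1
          congr 1; funext x
          rw [← ENNReal.rpow_mul, div_mul_cancel₀ _ (by norm_num)]
      _ = _ := by rw [mul_one]
  calc ∫⁻ x, (HLM w x) ^ (q x)
      ≤ ∫⁻ x, 2 ^ hi * ((HLM w1 x) ^ (q x) + (HLM w2 x) ^ (q x)) := by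
        refine lintegral_mono fun x => ?_
        have hle : HLM w x ≤ HLM w1 x + HLM w2 x := by
          conv_lhs => rw [hsum]
          exact HLM_add_le mw1 x
        have h2m : HLM w x ≤ 2 * max (HLM w1 x) (HLM w2 x) := by
          rw [two_mul]; exact hle.trans (add_le_add (le_max_left _ _) (le_max_right _ _))
        calc (HLM w x) ^ (q x) ≤ (2 * max (HLM w1 x) (HLM w2 x)) ^ (q x) :=
              ENNReal.rpow_le_rpow h2m (hqp x).le
          _ = 2 ^ (q x) * (max (HLM w1 x) (HLM w2 x)) ^ (q x) :=
              ENNReal.mul_rpow_of_nonneg _ _ (hqp x).le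
          _ ≤ _ := by
              gcongr ?_ * ?_
              · exact ENNReal.rpow_le_rpow_of_exponent_le (by norm_num) (h.le_hi x)
              · rcases max_cases (HLM w1 x) (HLM w2 x) with ⟨hm, _⟩ | ⟨hm, _⟩ <;> rw [hm]
                · exact le_self_add
                · exact le_add_self
    _ = 2 ^ hi * ((∫⁻ x, (HLM w1 x) ^ (q x)) + ∫⁻ x, (HLM w2 x) ^ (q x)) := by
        rw [lintegral_const_mul' _ _ (ENNReal.rpow_ne_top_of_nonneg (by linarith) (by norm_num)),
          lintegral_add_left ((measurable_HLM w1).pow h.meas)]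
    _ ≤ _ := by gcongr

end Part5

section Part6

variable {n : ℕ}

lemma plus_pt {C0 a b A1 : ℝ} (hC0 : 0 < C0) (hb : 0 < b) (hba : b < a) (hA1 : 1 ≤ A1) :
    ∃ K1 K2 : ℝ, 0 < K1 ∧ 0 < K2 ∧ ∀ d R A β y q px : ℝ, 0 < d → 0 < R → 0 < A → A ≤ A1 →
      β * R ^ a = A → 1 ≤ β → 0 ≤ y → px ≤ 1 → (y = 0 → px = q) →
      |px - q| ≤ C0 / Real.log (Real.exp 1 + 1 / y) →
      min ((R / (d + y)) ^ a) 1 * β ^ px ≤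
        K1 * A * (1 + y) ^ (-a) + K2 * β ^ q * (1 + y / R) ^ (-b) := by
  have ha : 0 < a := hb.trans hba
  set X1 := max 1 (C0 * a / (a - b)) with hX1
  have hX1p : 1 ≤ X1 := le_max_left _ _
  have hX1c : C0 * a / X1 ≤ a - b := by
    have : C0 * a / (a - b) ≤ X1 := le_max_right _ _
    rw [div_le_iff₀ (by linarith)] at this
    rw [div_le_iff₀ (by linarith)]; linarith
  set ρ0 := Real.exp (-X1)
  have hρ0 : 0 < ρ0 := Real.exp_pos _
  have hρ1 : ρ0 ≤ 1 := by rw [Real.exp_le_one_iff]; linarith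
  set K := Real.exp (C0 * Real.log A1 + C0 * a)
  refine ⟨(1 + 1 / ρ0) ^ a, K * 2 ^ b, by positivity, by positivity, ?_⟩
  intro d R A β y q px hd hR hA hAA hβ hβ1 hy hpx h0 hlog
  have hβ0 : 0 < β := by linarith
  rcases le_or_gt ρ0 y with hyρ | hyρ
  · have hyp : 0 < y := hρ0.trans_le hyρ
    have h1 : min ((R / (d + y)) ^ a) 1 * β ^ px ≤ (1 + 1 / ρ0) ^ a * A * (1 + y) ^ (-a) := by
      have e1 : β ^ px ≤ β := by
        calc β ^ px ≤ β ^ (1:ℝ) := Real.rpow_le_rpow_of_exponent_le hβ1 hpx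
          _ = β := Real.rpow_one _
      calc min ((R / (d + y)) ^ a) 1 * β ^ px ≤ (R / (d + y)) ^ a * β := by
            gcongr; exact min_le_left _ _
        _ = A * (d + y) ^ (-a) := by
            rw [Real.div_rpow hR.le (by positivity), Real.rpow_neg (by positivity), ← hβ]
            field_simp
        _ ≤ A * (((1 + 1 / ρ0)⁻¹ * (1 + y)) ^ (-a)) := by
            gcongr A * ?_
            apply Real.rpow_le_rpow_of_nonpos (by positivity) _ (by linarith)
            rw [inv_mul_le_iff₀ (by positivity)]
            have : 1 ≤ 1 / ρ0 * y := by rw [one_div, inv_mul_eq_div, le_div_iff₀ hρ0]; linarith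
            nlinarith [mul_pos (by positivity : 0 < 1 + 1 / ρ0) hd]
        _ = _ := by
            rw [Real.mul_rpow (by positivity) (by positivity), Real.inv_rpow (by positivity),
              Real.rpow_neg (by positivity), inv_inv]; ring
    have : 0 ≤ K * 2 ^ b * β ^ q * (1 + y / R) ^ (-b) := by positivity
    linarith
  · -- y small
    have hpow : β ^ (px - q) ≤ K * max 1 ((y / R) ^ (a - b)) := by
      rcases hy.eq_or_lt with hy0 | hy0
      · rw [h0 hy0.symm, sub_self, Real.rpow_zero]
        have : 1 ≤ K := by
          rw [Real.one_le_exp_iff]; have := Real.log_nonneg hA1; positivity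
        nlinarith [le_max_left 1 ((y / R) ^ (a - b))]
      · set x' := -Real.log y with hx'
        have hx'X : X1 ≤ x' := by
          have := Real.log_le_log hy0 hyρ.le
          rw [Real.log_exp] at this; linarith
        have hx'0 : 0 < x' := by linarith
        have hlx : x' ≤ Real.log (Real.exp 1 + 1 / y) := by
          rw [hx', ← Real.log_inv, ← one_div]
          exact Real.log_le_log (by positivity) (by have := Real.exp_pos 1; linarith)
        have hdiff : px - q ≤ C0 / x' := by
          refine (le_abs_self _).trans (hlog.trans ?_)
          gcongr
        have hlβ : Real.log β ≤ Real.log A1 - a * Real.log R := by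
          have : Real.log A = Real.log β + a * Real.log R := by
            rw [← hβ, Real.log_mul hβ0.ne' (by positivity), Real.log_rpow hR]
          have := Real.log_le_log hA hAA
          linarith
        have hlβ0 : 0 ≤ Real.log β := Real.log_nonneg hβ1
        have hlA : 0 ≤ Real.log A1 := Real.log_nonneg hA1
        have st : Real.log β * (px - q) ≤ C0 * Real.log A1 + C0 * a +
            (if R ≤ y then (a - b) * (Real.log y - Real.log R) else 0) := by
          have h1 : Real.log β * (px - q) ≤ (Real.log A1 - a * Real.log R) * (C0 / x') := by
            calc _ ≤ Real.log β * (C0 / x') := by gcongr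
              _ ≤ _ := by gcongr
          have h2 : Real.log A1 * (C0 / x') ≤ C0 * Real.log A1 := by
            have : C0 / x' ≤ C0 := div_le_self hC0.le (by linarith)
            nlinarith
          have h3 : -a * Real.log R * (C0 / x') =
              C0 * a + (C0 * a / x') * (Real.log y - Real.log R) := by
            have : C0 * a = C0 * a / x' * x' := by field_simp
            conv_rhs => lhs; rw [this]
            rw [hx']; ring
          have h4 : (C0 * a / x') * (Real.log y - Real.log R) ≤
              (if R ≤ y then (a - b) * (Real.log y - Real.log R) else 0) := by
            split_ifs with hRy
            · have : 0 ≤ Real.log y - Real.log R := by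
                have := Real.log_le_log hR hRy; linarith
              gcongr
              refine le_trans ?_ hX1c
              gcongr
            · have : Real.log y - Real.log R ≤ 0 := by
                have := Real.log_le_log hy0 (not_le.mp hRy).le; linarith
              have h5 : 0 < C0 * a / x' := by positivity
              nlinarith
          nlinarith
        rw [Real.rpow_def_of_pos hβ0]
        split_ifs at st with hRy
        · calc Real.exp (Real.log β * (px - q)) ≤ Real.exp (C0 * Real.log A1 + C0 * a +
                (a - b) * (Real.log y - Real.log R)) := Real.exp_le_exp.mpr st
            _ = K * (y / R) ^ (a - b) := by
                rw [Real.exp_add, Real.rpow_def_of_pos (by positivity),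
                  Real.log_div hy0.ne' hR.ne', mul_comm (a - b)]
            _ ≤ _ := by gcongr; exact le_max_right _ _
        · calc Real.exp (Real.log β * (px - q)) ≤ Real.exp (C0 * Real.log A1 + C0 * a) :=
                Real.exp_le_exp.mpr (by linarith)
            _ = K * 1 := (mul_one _).symm
            _ ≤ _ := by gcongr; exact le_max_left _ _
    have hprod : min ((R / (d + y)) ^ a) 1 * max 1 ((y / R) ^ (a - b)) ≤
        2 ^ b * (1 + y / R) ^ (-b) := by
      rcases le_or_gt y R with hyR | hyR
      · have e1 : max 1 ((y / R) ^ (a - b)) = 1 := by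
          apply max_eq_left
          apply Real.rpow_le_one (by positivity) _ (by linarith)
          rw [div_le_one hR]; exact hyR
        rw [e1, mul_one]
        refine (min_le_right _ _).trans ?_
        rw [Real.rpow_neg (by positivity), ← div_eq_mul_inv, ← Real.div_rpow (by norm_num) (by positivity)]
        apply Real.one_le_rpow _ hb.le
        rw [le_div_iff₀ (by positivity)]
        have : y / R ≤ 1 := by rw [div_le_one hR]; exact hyR
        linarith
      · have hy0 : 0 < y := hR.trans hyR
        have h1 : 1 ≤ y / R := by rw [le_div_iff₀ hR]; linarith
        have e1 : max 1 ((y / R) ^ (a - b)) = (y / R) ^ (a - b) := by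
          apply max_eq_right
          exact Real.one_le_rpow h1 (by linarith)
        rw [e1]
        calc min ((R / (d + y)) ^ a) 1 * (y / R) ^ (a - b)
            ≤ (R / y) ^ a * (y / R) ^ (a - b) := by
              gcongr
              refine (min_le_left _ _).trans ?_
              gcongr
              linarith
          _ = (y / R) ^ (-b) := by
              rw [← inv_div y R, Real.inv_rpow (by positivity), ← Real.rpow_neg (by positivity),
                ← Real.rpow_add (by positivity)]; congr 1; ring
          _ ≤ ((1 + y / R) / 2) ^ (-b) := by
              apply Real.rpow_le_rpow_of_nonpos (by positivity) (by linarith) (by linarith)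
          _ = _ := by
              rw [Real.div_rpow (by positivity) (by norm_num), Real.rpow_neg (by norm_num : (0:ℝ) ≤ 2),
                div_inv_eq_mul, mul_comm]
    have : min ((R / (d + y)) ^ a) 1 * β ^ px ≤ K * 2 ^ b * β ^ q * (1 + y / R) ^ (-b) := by
      calc min ((R / (d + y)) ^ a) 1 * β ^ px
          = min ((R / (d + y)) ^ a) 1 * (β ^ (px - q) * β ^ q) := by
            rw [← Real.rpow_add hβ0, sub_add_cancel]
        _ ≤ min ((R / (d + y)) ^ a) 1 * ((K * max 1 ((y / R) ^ (a - b))) * β ^ q) := by gcongr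
        _ = (min ((R / (d + y)) ^ a) 1 * max 1 ((y / R) ^ (a - b))) * (K * β ^ q) := by ring
        _ ≤ (2 ^ b * (1 + y / R) ^ (-b)) * (K * β ^ q) := by gcongr
        _ = _ := by ring
    have : 0 ≤ (1 + 1 / ρ0) ^ a * A * (1 + y) ^ (-a) := by positivity
    linarith

end Part6

section Part7

variable {n : ℕ}

lemma lintegral_bump (a : ℝ) {R : ℝ} (hR : 0 < R) (u : En n) :
    ∫⁻ x : En n, ENNReal.ofReal ((1 + ‖x - u‖ / R) ^ (-a)) = ENNReal.ofReal (R ^ n) * Kc n a := by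
  rw [← lintegral_pk_sub_right a R hR u, ← lintegral_const_mul' _ _ (by simp)]
  congr 1; funext x
  rw [pk, ← ENNReal.ofReal_mul (by positivity)]
  congr 1; field_simp

lemma ratio_eq {a d y : ℝ} (hd : 0 < d) (hy : 0 ≤ y) :
    (d / (d + y)) ^ a = (1 + y / d) ^ (-a) := by
  rw [Real.rpow_neg (by positivity), ← Real.inv_rpow (by positivity)]
  congr 1; field_simp

lemma bub_minus {a p0 e τ d : ℝ} (ha : (n:ℝ) < a) (hp0 : (n:ℝ) = a * p0) (he : p0 ≤ e) (he1 : e ≤ 1)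
    (hτ : 0 < τ) (hd : 0 < d) (u : En n) :
    ∫⁻ x : En n, ENNReal.ofReal (min (τ * (d / (d + ‖x - u‖)) ^ a) 1) ≤
      (ENNReal.ofReal (2 ^ a) * Kc n a) * ENNReal.ofReal (τ ^ e * d ^ n) := by
  have ha0 : 0 < a := lt_of_le_of_lt (Nat.cast_nonneg n) ha
  have h2 : 1 ≤ (2:ℝ) ^ a := Real.one_le_rpow (by norm_num) ha0.le
  rcases le_total τ 1 with h1 | h1
  · have hτe : τ ≤ τ ^ e := by
      calc τ = τ ^ (1:ℝ) := (Real.rpow_one _).symm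
        _ ≤ _ := Real.rpow_le_rpow_of_exponent_ge hτ h1 he1
    calc _ ≤ ∫⁻ x : En n, ENNReal.ofReal τ * ENNReal.ofReal ((1 + ‖x - u‖ / d) ^ (-a)) := by
          refine lintegral_mono fun x => ?_
          rw [← ENNReal.ofReal_mul hτ.le, ← ratio_eq hd (norm_nonneg _)]
          exact ENNReal.ofReal_le_ofReal (min_le_left _ _)
      _ = Kc n a * ENNReal.ofReal (τ * d ^ n) := by
          rw [lintegral_const_mul' _ _ (by simp), lintegral_bump a hd, ENNReal.ofReal_mul hτ.le]; ring
      _ ≤ (ENNReal.ofReal (2 ^ a) * Kc n a) * ENNReal.ofReal (τ ^ e * d ^ n) := by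
          gcongr
          calc Kc n a = 1 * Kc n a := (one_mul _).symm
            _ ≤ _ := by gcongr; simpa using h2
  · set R := d * τ ^ (1 / a) with hR
    have hRp : 0 < R := by positivity
    have hRn : R ^ n ≤ τ ^ e * d ^ n := by
      rw [hR, mul_pow, ← Real.rpow_natCast (τ ^ (1/a)), ← Real.rpow_mul hτ.le]
      have : τ ^ (1 / a * (n:ℝ)) ≤ τ ^ e := by
        apply Real.rpow_le_rpow_of_exponent_le h1
        rw [hp0]; field_simp; exact he
      rw [mul_comm]; gcongr
    have hRa : R ^ a = τ * d ^ a := by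
      rw [hR, Real.mul_rpow hd.le (by positivity), ← Real.rpow_mul hτ.le, one_div_mul_cancel ha0.ne',
        Real.rpow_one, mul_comm]
    calc _ ≤ ∫⁻ x : En n, ENNReal.ofReal (2 ^ a) * ENNReal.ofReal ((1 + ‖x - u‖ / R) ^ (-a)) := by
          refine lintegral_mono fun x => ?_
          rw [← ENNReal.ofReal_mul (by positivity)]
          apply ENNReal.ofReal_le_ofReal
          have hy := norm_nonneg (x - u)
          set y := ‖x - u‖
          have e2 : 2 ^ a * (1 + y / R) ^ (-a) = ((2 * R) / (R + y)) ^ a := by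
            rw [← ratio_eq hRp hy, ← Real.mul_rpow (by norm_num) (by positivity)]; congr 1; ring
          rw [e2]
          rcases le_total y R with hyR | hyR
          · refine (min_le_right _ _).trans (Real.one_le_rpow ?_ ha0.le)
            rw [le_div_iff₀ (by positivity)]; linarith
          · refine (min_le_left _ _).trans ?_
            have hy0 : 0 < y := hRp.trans_le hyR
            rw [Real.div_rpow hd.le (by positivity), ← mul_div_assoc, ← hRa,
              ← Real.div_rpow hRp.le (by positivity)]
            apply Real.rpow_le_rpow (by positivity) _ ha0.le
            rw [div_le_div_iff₀ (by positivity) (by positivity)]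
            nlinarith
      _ = (ENNReal.ofReal (2 ^ a) * Kc n a) * ENNReal.ofReal (R ^ n) := by
          rw [lintegral_const_mul' _ _ (by simp), lintegral_bump a hRp]; ring
      _ ≤ _ := by gcongr

lemma bub_plus {p : En n → ℝ} {p0 C0 pinf a A1 : ℝ} (h : LH n p p0 1 C0 pinf)
    (ha : (n:ℝ) < a) (hp0 : (n:ℝ) = a * p0) (hA1 : 1 ≤ A1) (hn : 1 ≤ n) :
    ∃ K : ℝ≥0∞, K < ⊤ ∧ ∀ (u : En n) (d l β : ℝ), 0 < d → 1 ≤ l → 0 < β → l * d ^ a ≤ A1 →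
      ∫⁻ x : En n, ENNReal.ofReal (min (l * (d / (d + ‖x - u‖)) ^ a / β) 1 * β ^ (p x)) ≤
        K * ENNReal.ofReal (l ^ (p u) * d ^ n) := by
  have ha0 : 0 < a := lt_of_le_of_lt (Nat.cast_nonneg n) ha
  have hn0 : (0:ℝ) < n := by exact_mod_cast hn
  set b := ((n:ℝ) + a) / 2 with hb
  have hnb : (n:ℝ) < b := by rw [hb]; linarith
  have hba : b < a := by rw [hb]; linarith
  obtain ⟨K1, K2, hK1, hK2, hpt⟩ := plus_pt (a := a) (b := b) h.C_pos (by linarith) hba hA1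
  have hKa : Kc n a < ⊤ := Kc_lt_top ha
  have hKb : Kc n b < ⊤ := Kc_lt_top hnb
  set Km := ENNReal.ofReal (K1 * (A1 * A1)) * Kc n a + ENNReal.ofReal K2 * Kc n b with hKm
  have hKmt : Km < ⊤ := ENNReal.add_lt_top.mpr ⟨ENNReal.mul_lt_top (by simp) hKa,
    ENNReal.mul_lt_top (by simp) hKb⟩
  -- middle range
  have mid : ∀ (u : En n) (d l β : ℝ), 0 < d → 1 ≤ l → 1 ≤ β → β ≤ l → l * d ^ a ≤ A1 →
      ∫⁻ x : En n, ENNReal.ofReal (min (l * (d / (d + ‖x - u‖)) ^ a / β) 1 * β ^ (p x)) ≤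
        Km * ENNReal.ofReal (l ^ (p u) * d ^ n) := by
    intro u d l β hd hl hβ hβl hA
    have hl0 : 0 < l := by linarith
    have hβ0 : 0 < β := by linarith
    have hq1 := h.le_hi u
    have hq0 := h.lo_le u
    set q := p u
    have hlb : 1 ≤ l / β := by rw [le_div_iff₀ hβ0]; linarith
    set R := d * (l / β) ^ (1 / a) with hR
    have hRp : 0 < R := by positivity
    have hRa : R ^ a = (l / β) * d ^ a := by
      rw [hR, Real.mul_rpow hd.le (by positivity), ← Real.rpow_mul (by positivity),
        one_div_mul_cancel ha0.ne', Real.rpow_one, mul_comm]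
    have hβR : β * R ^ a = l * d ^ a := by rw [hRa]; field_simp
    have hbq : β ^ q * R ^ n ≤ l ^ q * d ^ n := by
      have e1 : R ^ n = (l / β) ^ p0 * d ^ n := by
        rw [hR, mul_pow, ← Real.rpow_natCast ((l / β) ^ (1/a)), ← Real.rpow_mul (by positivity),
          hp0, mul_comm]
        congr 2; field_simp
      calc β ^ q * R ^ n = β ^ q * (l / β) ^ p0 * d ^ n := by rw [e1]; ring
        _ ≤ β ^ q * (l / β) ^ q * d ^ n := by
          gcongr
        _ = _ := by rw [← Real.mul_rpow hβ0.le (by positivity)]; congr 2; field_simp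
    have hda : d ^ a ≤ A1 := by
      have : 0 < d ^ a := by positivity
      nlinarith
    have hAq : l * d ^ a ≤ (A1 * A1) * (l ^ q * d ^ n) := by
      have e1 : l * d ^ a = ((l * d ^ a) ^ (1 - q) * (d ^ a) ^ (q - p0)) * (l ^ q * d ^ n) := by
        rw [Real.mul_rpow hl0.le (by positivity), ← Real.rpow_mul hd.le, ← Real.rpow_mul hd.le,
          ← Real.rpow_natCast d n]
        rw [show l ^ (1 - q) * d ^ (a * (1 - q)) * d ^ (a * (q - p0)) * (l ^ q * d ^ (n:ℝ)) =
          (l ^ (1 - q) * l ^ q) * (d ^ (a * (1 - q)) * d ^ (a * (q - p0)) * d ^ (n:ℝ)) by ring,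
          ← Real.rpow_add hl0, ← Real.rpow_add hd, ← Real.rpow_add hd, hp0]
        rw [show (1:ℝ) - q + q = 1 by ring, Real.rpow_one,
          show a * (1 - q) + a * (q - p0) + a * p0 = a by ring]
      have f1 : (l * d ^ a) ^ (1 - q) ≤ A1 := by
        calc _ ≤ A1 ^ (1 - q) := by gcongr
          _ ≤ A1 ^ (1:ℝ) := Real.rpow_le_rpow_of_exponent_le hA1 (by have := h.lo_pos; linarith)
          _ = A1 := Real.rpow_one _
      have f2 : (d ^ a) ^ (q - p0) ≤ A1 := by
        calc _ ≤ A1 ^ (q - p0) := by gcongr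
          _ ≤ A1 ^ (1:ℝ) := Real.rpow_le_rpow_of_exponent_le hA1 (by have := h.lo_pos; linarith)
          _ = A1 := Real.rpow_one _
      calc l * d ^ a = _ := e1
        _ ≤ _ := by gcongr
    calc _ ≤ ∫⁻ x : En n, (ENNReal.ofReal (K1 * (l * d ^ a)) * ENNReal.ofReal ((1 + ‖x - u‖ / 1) ^ (-a))
          + ENNReal.ofReal (K2 * β ^ q) * ENNReal.ofReal ((1 + ‖x - u‖ / R) ^ (-b))) := by
          refine lintegral_mono fun x => ?_
          rw [← ENNReal.ofReal_mul (by positivity), ← ENNReal.ofReal_mul (by positivity),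
            ← ENNReal.ofReal_add (by positivity) (by positivity)]
          apply ENNReal.ofReal_le_ofReal
          have hlog : |p x - q| ≤ C0 / Real.log (Real.exp 1 + 1 / ‖x - u‖) := by
            rcases eq_or_ne x u with rfl | hne
            · simp only [q, sub_self, abs_zero]
              have := h.C_pos
              have := one_le_log_e_add (by positivity : 0 ≤ 1 / ‖(0 : En n)‖)
              positivity
            · exact h.loc x u hne
          have := hpt d R (l * d ^ a) β ‖x - u‖ q (p x) hd hRp (by positivity) hA hβR hβ
            (norm_nonneg _) (h.le_hi x) (by
              intro h0; rw [norm_sub_eq_zero_iff] at h0; rw [h0]) hlog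
          have e : l * (d / (d + ‖x - u‖)) ^ a / β = (R / (d + ‖x - u‖)) ^ a := by
            rw [Real.div_rpow hd.le (by positivity), Real.div_rpow hRp.le (by positivity), hRa]
            ring
          rw [e, div_one]
          exact this
      _ = ENNReal.ofReal (K1 * (l * d ^ a)) * (ENNReal.ofReal (1 ^ n) * Kc n a) +
          ENNReal.ofReal (K2 * β ^ q) * (ENNReal.ofReal (R ^ n) * Kc n b) := by
          rw [lintegral_add_left (by fun_prop), lintegral_const_mul' _ _ (by simp),
            lintegral_const_mul' _ _ (by simp), lintegral_bump a one_pos, lintegral_bump b hRp]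
      _ = ENNReal.ofReal (K1 * (l * d ^ a)) * Kc n a +
          ENNReal.ofReal (K2 * (β ^ q * R ^ n)) * Kc n b := by
          rw [one_pow, ENNReal.ofReal_one, one_mul, ← mul_assoc (ENNReal.ofReal (K2 * β ^ q)),
            ← ENNReal.ofReal_mul (by positivity), mul_assoc K2]
      _ ≤ ENNReal.ofReal (K1 * ((A1 * A1) * (l ^ q * d ^ n))) * Kc n a +
          ENNReal.ofReal (K2 * (l ^ q * d ^ n)) * Kc n b := by gcongr
      _ = _ := by
          rw [hKm, ← mul_assoc K1, ENNReal.ofReal_mul (by positivity), ENNReal.ofReal_mul hK2.le]; ring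
  refine ⟨max Km (ENNReal.ofReal (2 ^ a) * Kc n a), max_lt hKmt (ENNReal.mul_lt_top (by simp) hKa), ?_⟩
  intro u d l β hd hl hβ hA
  have hl0 : 0 < l := by linarith
  rcases lt_or_ge β 1 with hβ1 | hβ1
  · calc _ ≤ ∫⁻ x : En n, ENNReal.ofReal (β ^ p0) *
          ENNReal.ofReal (min ((l / β) * (d / (d + ‖x - u‖)) ^ a) 1) := by
          refine lintegral_mono fun x => ?_
          rw [← ENNReal.ofReal_mul (by positivity), mul_comm (β ^ p0), div_mul_eq_mul_div]
          apply ENNReal.ofReal_le_ofReal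
          gcongr ?_ * ?_
          exact Real.rpow_le_rpow_of_exponent_ge hβ hβ1.le (h.lo_le x)
      _ ≤ ENNReal.ofReal (β ^ p0) * ((ENNReal.ofReal (2 ^ a) * Kc n a) *
            ENNReal.ofReal ((l / β) ^ p0 * d ^ n)) := by
          rw [lintegral_const_mul' _ _ (by simp)]
          gcongr
          exact bub_minus ha hp0 le_rfl ((h.lo_le u).trans (h.le_hi u)) (by positivity) hd u
      _ = (ENNReal.ofReal (2 ^ a) * Kc n a) * ENNReal.ofReal (l ^ p0 * d ^ n) := by
          rw [mul_left_comm, ← ENNReal.ofReal_mul (by positivity), ← mul_assoc,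
            ← Real.mul_rpow hβ.le (by positivity), mul_div_cancel₀ _ hβ.ne']
      _ ≤ _ := by
          gcongr
          · exact le_max_right _ _
          · exact h.lo_le u
  · rcases le_total β l with hβl | hβl
    · refine (mid u d l β hd hl hβ1 hβl hA).trans ?_
      gcongr
      exact le_max_left _ _
    · refine le_trans ?_ ((mid u d l l hd hl hl le_rfl hA).trans ?_)
      · refine lintegral_mono fun x => ?_
        apply ENNReal.ofReal_le_ofReal
        have hX1 : (d / (d + ‖x - u‖)) ^ a ≤ 1 := by
          apply Real.rpow_le_one (by positivity) _ ha0.le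
          rw [div_le_one (by positivity)]; have := norm_nonneg (x - u); linarith
        have hX0 : 0 ≤ (d / (d + ‖x - u‖)) ^ a := by positivity
        set X := (d / (d + ‖x - u‖)) ^ a
        rw [mul_div_cancel_left₀ X hl0.ne', min_eq_left hX1]
        calc min (l * X / β) 1 * β ^ p x ≤ (l * X / β) * β ^ p x := by
              gcongr; exact min_le_left _ _
          _ = l * X * β ^ (p x - 1) := by rw [Real.rpow_sub_one hβ.ne']; ring
          _ ≤ l * X * l ^ (p x - 1) := by
              gcongr l * X * ?_
              exact Real.rpow_le_rpow_of_nonpos hl0 hβl (by have := h.le_hi x; linarith)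
          _ = X * l ^ p x := by rw [Real.rpow_sub_one hl0.ne']; field_simp
      · gcongr
        exact le_max_left _ _

end Part7

section Part8

variable {n : ℕ}

def Om (G : En n → ℝ≥0∞) (j : ℤ) : Set (En n) := {x | lv j < G x}
def dj (G : En n → ℝ≥0∞) (j : ℤ) (u : En n) : ℝ := Metric.infDist u (Om G j)ᶜ
def Vs (G : En n → ℝ≥0∞) (s : ℝ) (u : En n) : ℝ≥0∞ :=
  ∑' j : ℤ, if s ≤ dj G j u then lv (j + 1) else 0
def lr (j : ℤ) : ℝ := (lv j).toReal
lemma lv_eq (j : ℤ) : lv j = ENNReal.ofReal (lr j) := (ENNReal.ofReal_toReal (lv_ne_top j)).symm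
lemma lr_pos (j : ℤ) : 0 < lr j := ENNReal.toReal_pos (lv_ne_zero j) (lv_ne_top j)

def Tk (a : ℝ) (G : En n → ℝ≥0∞) (β : ℝ) (j : ℤ) (x u : En n) : ℝ≥0∞ :=
  (Om G j).indicator (fun u =>
    ENNReal.ofReal (min (lr j * (dj G j u / (dj G j u + ‖x - u‖)) ^ a / β) 1) *
      ENNReal.ofReal ((dj G j u ^ n)⁻¹)) u

def SSp (a : ℝ) (G : En n → ℝ≥0∞) (β : ℝ) (x : En n) : ℝ≥0∞ :=
  ∑' j : ℕ, ∫⁻ u, Tk a G β (j : ℤ) x u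
def SSm (a : ℝ) (G : En n → ℝ≥0∞) (β : ℝ) (x : En n) : ℝ≥0∞ :=
  ∑' j : ℕ, ∫⁻ u, Tk a G β (-((j : ℤ) + 1)) x u

lemma SS_add (a : ℝ) (G : En n → ℝ≥0∞) (β : ℝ) (x : En n) :
    ∑' j : ℤ, ∫⁻ u, Tk a G β j x u = SSp a G β x + SSm a G β x := by
  exact (HasSum.of_nat_of_neg_add_one (f := fun j : ℤ => ∫⁻ u, Tk a G β j x u)
    ENNReal.summable.hasSum ENNReal.summable.hasSum).tsum_eq

lemma continuous_dj (G : En n → ℝ≥0∞) (j : ℤ) : Continuous (dj G j) :=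
  Metric.continuous_infDist_pt _

lemma Tk_meas (a : ℝ) (G : En n → ℝ≥0∞) (β : ℝ) (j : ℤ) (ho : IsOpen (Om G j)) :
    Measurable (fun z : En n × En n => Tk a G β j z.1 z.2) := by
  have hd := (continuous_dj G j).measurable
  have : (fun z : En n × En n => Tk a G β j z.1 z.2) = (Prod.snd ⁻¹' (Om G j)).indicator
    (fun z : En n × En n => ENNReal.ofReal (min (lr j * (dj G j z.2 / (dj G j z.2 + ‖z.1 - z.2‖)) ^ a / β) 1) *
      ENNReal.ofReal ((dj G j z.2 ^ n)⁻¹)) := by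
    funext z
    by_cases hz : z.2 ∈ Om G j
    · rw [Tk, indicator_of_mem hz, indicator_of_mem (by exact hz)]
    · rw [Tk, indicator_of_notMem hz, indicator_of_notMem (by exact hz)]
  rw [this]
  apply Measurable.indicator _ (measurable_snd ho.measurableSet)
  have h2 : Measurable (fun z : En n × En n => dj G j z.2) := hd.comp measurable_snd
  fun_prop

lemma dj_pos {G : En n → ℝ≥0∞} {j : ℤ} (ho : IsOpen (Om G j)) (hc : (Om G j)ᶜ.Nonempty) {u : En n} :
    0 < dj G j u ↔ u ∈ Om G j := by
  rw [dj, ← ho.isClosed_compl.notMem_iff_infDist_pos hc, mem_compl_iff, not_not]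

lemma ball_dj {G : En n → ℝ≥0∞} {j : ℤ} {u y : En n} (h : dist y u < dj G j u) : y ∈ Om G j := by
  by_contra hy
  have := Metric.infDist_le_dist_of_mem (x := u) (mem_compl hy)
  rw [dist_comm] at this
  exact absurd h (not_lt.mpr this)

lemma le_Vs {G : En n → ℝ≥0∞} (hc : ∀ j, (Om G j)ᶜ.Nonempty) {s : ℝ} (u : En n) (γ : ℝ≥0∞)
    (h : ∀ y, dist y u < s → γ ≤ G y) : γ ≤ Vs G s u := by
  have := geo_lower one_pos γ
  simp only [ENNReal.rpow_one] at this
  refine this.trans ?_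
  rw [← ENNReal.tsum_mul_left, Vs]
  apply ENNReal.tsum_le_tsum
  intro j
  by_cases hj : lv j < γ
  · have : s ≤ dj G j u := by
      rw [dj, Metric.le_infDist (hc j)]
      intro y hy
      by_contra hlt
      rw [not_le, dist_comm] at hlt
      exact hy (lt_of_lt_of_le hj (h y hlt))
    rw [if_pos hj, if_pos this, lv_succ]
  · rw [if_neg hj, mul_zero]; exact zero_le

lemma Vs_meas (G : En n → ℝ≥0∞) (s : ℝ) : Measurable (Vs G s) := by
  unfold Vs
  refine Measurable.tsum fun j => ?_
  exact Measurable.ite (measurableSet_le measurable_const (continuous_dj G j).measurable)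
    measurable_const measurable_const

/-- off-diagonal estimate -/
lemma pk_split {a : ℝ} (ha : (n:ℝ) < a) {G : En n → ℝ≥0∞} {j : ℤ}
    {s : ℝ} (hs : 0 < s) (x u : En n) (hsd : s ≤ dj G j u) (hx : x ∉ Om G j) :
    pk a s (x - u) ≤ ENNReal.ofReal (2 ^ a) *
      (ENNReal.ofReal ((dj G j u / (dj G j u + ‖x - u‖)) ^ a) * ENNReal.ofReal ((dj G j u ^ n)⁻¹)) := by
  have ha0 : 0 < a := lt_of_le_of_lt (Nat.cast_nonneg n) ha
  set d := dj G j u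
  have hd : 0 < d := hs.trans_le hsd
  have hxd : d ≤ ‖x - u‖ := by
    by_contra hlt
    exact hx (ball_dj (by rw [dist_eq_norm]; exact not_le.mp hlt))
  set y := ‖x - u‖ with hy
  have hy0 : 0 < y := hd.trans_le hxd
  rw [pk, ← ENNReal.ofReal_mul (by positivity), ← ENNReal.ofReal_mul (by positivity)]
  apply ENNReal.ofReal_le_ofReal
  rw [← hy, ← ratio_eq hs hy0.le, Real.div_rpow hs.le (by positivity), Real.div_rpow hd.le (by positivity)]
  have e1 : ∀ t : ℝ, 0 < t → (t ^ n)⁻¹ * t ^ a = t ^ (a - n) := by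
    intro t ht
    rw [Real.rpow_sub ht, Real.rpow_natCast]; ring
  calc (s ^ n)⁻¹ * (s ^ a / (s + y) ^ a) = s ^ (a - n) / (s + y) ^ a := by rw [← e1 s hs]; ring
    _ ≤ d ^ (a - n) / (((d + y) / 2) ^ a) := by
        gcongr
        · linarith
    _ = _ := by
        rw [Real.div_rpow (by positivity) (by norm_num), ← e1 d hd]; field_simp

def Kl (n : ℕ) (a : ℝ) : ℝ≥0∞ := 2 * Kc n a * (gc 1 * 2) + 2 * ENNReal.ofReal (2 ^ a)
def cl (n : ℕ) (a : ℝ) : ℝ≥0∞ :=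
  min 1 (ENNReal.ofReal ((4 ^ a)⁻¹ * (3 ^ n)⁻¹) * volume (Metric.ball (0 : En n) 1))

lemma cl_pos (a : ℝ) : 0 < cl n a := by
  unfold cl
  apply lt_min one_pos
  apply ENNReal.mul_pos
  · rw [ne_eq, ENNReal.ofReal_eq_zero, not_le]; positivity
  · exact vol_ball_pos _ one_pos

lemma Kl_lt_top {a : ℝ} (ha : (n:ℝ) < a) : Kl n a < ⊤ := by
  unfold Kl
  have h1 := Kc_lt_top ha
  have h2 := gc_lt_top one_pos
  refine ENNReal.add_lt_top.mpr ⟨ENNReal.mul_lt_top (ENNReal.mul_lt_top (by simp) h1)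
    (ENNReal.mul_lt_top h2 (by simp)), ENNReal.mul_lt_top (by simp) (by simp)⟩

lemma level_caseA {a : ℝ} (ha : (n:ℝ) < a) {G : En n → ℝ≥0∞} (ho : ∀ j, IsOpen (Om G j))
    (hc : ∀ j, (Om G j)ᶜ.Nonempty) {β : ℝ} (hβ : 0 < β) (x : En n) (j : ℤ) (u : En n)
    (hu : u ∈ Om G j) (hg : β < lr j * (dj G j u / (dj G j u + ‖x - u‖)) ^ a) :
    cl n a ≤ ∫⁻ u, Tk a G β j x u := by
  have ha0 : 0 < a := lt_of_le_of_lt (Nat.cast_nonneg n) ha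
  have hd : 0 < dj G j u := (dj_pos (ho j) (hc j)).mpr hu
  set d := dj G j u
  have hl := lr_pos j
  have key : ∀ u' ∈ Metric.ball u (d / 2), ENNReal.ofReal ((4 ^ a)⁻¹ * ((3 * (d / 2)) ^ n)⁻¹) ≤ Tk a G β j x u' := by
    intro u' hu'
    rw [Metric.mem_ball] at hu'
    have huTwo : u' ∈ Om G j := ball_dj (by linarith : dist u' u < dj G j u)
    have hd1 : d ≤ dj G j u' + dist u u' := Metric.infDist_le_infDist_add_dist
    have hd2 : dj G j u' ≤ d + dist u' u := Metric.infDist_le_infDist_add_dist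
    rw [dist_comm] at hd1
    rw [Tk, indicator_of_mem huTwo]
    set d' := dj G j u'
    have hd' : 0 < d' := by linarith
    rw [← ENNReal.ofReal_mul (by positivity)]
    apply ENNReal.ofReal_le_ofReal
    have hxu : ‖x - u'‖ ≤ ‖x - u‖ + d / 2 := by
      have := dist_triangle x u u'
      rw [dist_comm u u', dist_eq_norm, dist_eq_norm x u] at this; linarith
    have hr : (4:ℝ)⁻¹ * (d / (d + ‖x - u‖)) ≤ d' / (d' + ‖x - u'‖) := by
      have h1 := norm_nonneg (x - u)
      have h2 := norm_nonneg (x - u')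
      rw [← mul_div_assoc, div_le_div_iff₀ (by positivity) (by positivity)]
      nlinarith
    gcongr
    · apply le_min
      · rw [le_div_iff₀ hβ]
        calc ((4:ℝ) ^ a)⁻¹ * β ≤ ((4:ℝ) ^ a)⁻¹ * (lr j * (d / (d + ‖x - u‖)) ^ a) := by gcongr
          _ = lr j * ((4:ℝ)⁻¹ * (d / (d + ‖x - u‖))) ^ a := by
              rw [Real.mul_rpow (by positivity) (by positivity), Real.inv_rpow (by norm_num)]; ring
          _ ≤ _ := by gcongr
      · apply inv_le_one_of_one_le₀
        exact Real.one_le_rpow (by norm_num) ha0.le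
    · linarith
  calc cl n a ≤ ENNReal.ofReal ((4 ^ a)⁻¹ * (3 ^ n)⁻¹) * volume (Metric.ball (0 : En n) 1) := min_le_right _ _
    _ = ENNReal.ofReal ((4 ^ a)⁻¹ * ((3 * (d / 2)) ^ n)⁻¹) * volume (Metric.ball u (d / 2)) := by
        rw [vol_ball u (by positivity), ← mul_assoc, ← ENNReal.ofReal_mul (by positivity)]
        congr 2; rw [mul_pow]; field_simp
    _ = ∫⁻ u' in Metric.ball u (d / 2), ENNReal.ofReal ((4 ^ a)⁻¹ * ((3 * (d / 2)) ^ n)⁻¹) := by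
        rw [setLIntegral_const]
    _ ≤ ∫⁻ u' in Metric.ball u (d / 2), Tk a G β j x u' := setLIntegral_mono' measurableSet_ball key
    _ ≤ _ := setLIntegral_le_lintegral _ _

lemma level_main {a : ℝ} (ha : (n:ℝ) < a) {G : En n → ℝ≥0∞} (ho : ∀ j, IsOpen (Om G j))
    (hc : ∀ j, (Om G j)ᶜ.Nonempty) {β : ℝ} (hβ : 0 < β) (x : En n) {s : ℝ} (hs : 0 < s)
    (hT : Kl n a * ENNReal.ofReal β < ∫⁻ u, pk a s (x - u) * Vs G s u) :
    cl n a ≤ SSp a G β x + SSm a G β x := by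
  rw [← SS_add]
  by_cases hA : ∃ j, ∃ u ∈ Om G j, β < lr j * (dj G j u / (dj G j u + ‖x - u‖)) ^ a
  · obtain ⟨j, u, hu, hg⟩ := hA
    exact (level_caseA ha ho hc hβ x j u hu hg).trans (ENNReal.le_tsum j)
  push Not at hA
  refine (min_le_left _ _).trans ?_
  by_contra hS
  rw [not_le] at hS
  refine absurd hT (not_lt.mpr ?_)
  have hpm : Measurable fun u => pk a s (x - u) := (pk_meas a s).comp (measurable_const.sub measurable_id)
  have term : ∀ j : ℤ, ∫⁻ u, pk a s (x - u) * (if s ≤ dj G j u then lv (j + 1) else 0) ≤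
      2 * Kc n a * (if lv j < ENNReal.ofReal β * 2 then lv j ^ (1:ℝ) else 0) +
        2 * ENNReal.ofReal (2 ^ a) * ENNReal.ofReal β * ∫⁻ u, Tk a G β j x u := by
    intro j
    have hlast : ∀ u, u ∈ Om G j → lv (j+1) * (ENNReal.ofReal ((dj G j u / (dj G j u + ‖x - u‖)) ^ a) *
        ENNReal.ofReal ((dj G j u ^ n)⁻¹)) = 2 * ENNReal.ofReal β * Tk a G β j x u := by
      intro u hu
      have hd : 0 < dj G j u := (dj_pos (ho j) (hc j)).mpr hu
      have := hA j u hu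
      rw [Tk, indicator_of_mem hu, min_eq_left (by rw [div_le_one hβ]; exact this), lv_succ, lv_eq]
      have e : lr j * (dj G j u / (dj G j u + ‖x - u‖)) ^ a =
        β * (lr j * (dj G j u / (dj G j u + ‖x - u‖)) ^ a / β) := by field_simp
      have e2 : ENNReal.ofReal (lr j) * ENNReal.ofReal ((dj G j u / (dj G j u + ‖x - u‖)) ^ a) =
        ENNReal.ofReal β * ENNReal.ofReal (lr j * (dj G j u / (dj G j u + ‖x - u‖)) ^ a / β) := by
        rw [← ENNReal.ofReal_mul (lr_pos j).le, ← ENNReal.ofReal_mul hβ.le, ← e]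
      rw [mul_assoc 2, ← mul_assoc (ENNReal.ofReal (lr j)), e2]; ring
    by_cases hx : x ∈ Om G j
    · have hlj : lv j < ENNReal.ofReal β * 2 := by
        have h1 := hA j x hx
        have hd : 0 < dj G j x := (dj_pos (ho j) (hc j)).mpr hx
        rw [sub_self, norm_zero, add_zero, div_self hd.ne', Real.one_rpow, mul_one] at h1
        rw [lv_eq, ← ENNReal.ofReal_ofNat, ← ENNReal.ofReal_mul hβ.le]
        exact (ENNReal.ofReal_lt_ofReal_iff (by positivity)).mpr (by linarith)
      rw [if_pos hlj, ENNReal.rpow_one]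
      refine le_trans ?_ le_self_add
      calc _ ≤ ∫⁻ u, pk a s (x - u) * lv (j+1) := by
            refine lintegral_mono fun u => ?_
            dsimp only
            gcongr
            split_ifs <;> simp
        _ = _ := by
            rw [lintegral_mul_const _ hpm, lintegral_pk_sub_left a s hs, lv_succ]; ring
    · refine le_trans ?_ le_add_self
      rw [← lintegral_const_mul' _ _ (by finiteness)]
      refine lintegral_mono fun u => ?_
      dsimp only
      split_ifs with hsd
      · have hu : u ∈ Om G j := (dj_pos (ho j) (hc j)).mp (hs.trans_le hsd)
        calc pk a s (x - u) * lv (j+1) ≤ (ENNReal.ofReal (2 ^ a) *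
              (ENNReal.ofReal ((dj G j u / (dj G j u + ‖x - u‖)) ^ a) * ENNReal.ofReal ((dj G j u ^ n)⁻¹))) *
              lv (j+1) := by gcongr; exact pk_split ha hs x u hsd hx
          _ = ENNReal.ofReal (2 ^ a) * (lv (j+1) * (ENNReal.ofReal ((dj G j u / (dj G j u + ‖x - u‖)) ^ a) *
                ENNReal.ofReal ((dj G j u ^ n)⁻¹))) := by ring
          _ = _ := by rw [hlast u hu]; ring
          _ ≤ _ := le_rfl
      · rw [mul_zero]; exact zero_le
  calc ∫⁻ u, pk a s (x - u) * Vs G s u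
      = ∫⁻ u, ∑' j : ℤ, pk a s (x - u) * (if s ≤ dj G j u then lv (j + 1) else 0) := by
        congr 1; funext u; rw [Vs, ENNReal.tsum_mul_left]
    _ = ∑' j : ℤ, ∫⁻ u, pk a s (x - u) * (if s ≤ dj G j u then lv (j + 1) else 0) := by
        rw [lintegral_tsum]
        intro j
        exact (hpm.mul (Measurable.ite (measurableSet_le measurable_const
          (continuous_dj G j).measurable) measurable_const measurable_const)).aemeasurable
    _ ≤ ∑' j : ℤ, (2 * Kc n a * (if lv j < ENNReal.ofReal β * 2 then lv j ^ (1:ℝ) else 0) +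
        2 * ENNReal.ofReal (2 ^ a) * ENNReal.ofReal β * ∫⁻ u, Tk a G β j x u) :=
        ENNReal.tsum_le_tsum term
    _ = 2 * Kc n a * ∑' j : ℤ, (if lv j < ENNReal.ofReal β * 2 then lv j ^ (1:ℝ) else 0) +
        2 * ENNReal.ofReal (2 ^ a) * ENNReal.ofReal β * ∑' j : ℤ, ∫⁻ u, Tk a G β j x u := by
        rw [ENNReal.tsum_add, ENNReal.tsum_mul_left, ENNReal.tsum_mul_left]
    _ ≤ 2 * Kc n a * (gc 1 * (ENNReal.ofReal β * 2) ^ (1:ℝ)) +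
        2 * ENNReal.ofReal (2 ^ a) * ENNReal.ofReal β * 1 := by
        gcongr
        exact geo_upper one_pos _
    _ = Kl n a * ENNReal.ofReal β := by
        rw [ENNReal.rpow_one, Kl]; ring

end Part8

section Part9

variable {n : ℕ}

lemma sum_swap (T : ℕ → En n → En n → ℝ≥0∞)
    (hm : ∀ k, Measurable (fun z : En n × En n => T k z.1 z.2))
    (wt : En n → ℝ≥0∞) (hwt : Measurable wt) :
    ∫⁻ x, (∑' k : ℕ, ∫⁻ u, T k x u) * wt x = ∑' k : ℕ, ∫⁻ u, ∫⁻ x, T k x u * wt x := by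
  have hmx : ∀ k x, Measurable (fun u => T k x u) := by
    intro k x
    have h1 : Measurable (fun u : En n => (x, u)) := by fun_prop
    exact Measurable.comp (g := fun z : En n × En n => T k z.1 z.2) (hm k) h1
  have hmw : ∀ k, Measurable (fun z : En n × En n => T k z.1 z.2 * wt z.1) := by
    intro k
    exact (hm k).mul (hwt.comp measurable_fst)
  calc ∫⁻ x, (∑' k : ℕ, ∫⁻ u, T k x u) * wt x
      = ∑' k : ℕ, ∫⁻ x, ∫⁻ u, T k x u * wt x := by
        rw [← lintegral_tsum]
        · congr 1; funext x
          rw [← ENNReal.tsum_mul_right]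
          congr 1; funext k
          rw [lintegral_mul_const _ (hmx k x)]
        · intro k
          exact (Measurable.lintegral_prod_right (hmw k)).aemeasurable
    _ = ∑' k : ℕ, ∫⁻ u, ∫⁻ x, T k x u * wt x := by
        congr 1; funext k
        exact lintegral_lintegral_swap (hmw k).aemeasurable

lemma sum_general {a : ℝ} {G : En n → ℝ≥0∞} (ho : ∀ j, IsOpen (Om G j))
    (hc : ∀ j, (Om G j)ᶜ.Nonempty) {β : ℝ} (ι : ℕ → ℤ) (hι : Function.Injective ι)
    (wt : En n → ℝ≥0∞) (hwt : Measurable wt) (e : En n → ℝ) (he : Measurable e) {e0 : ℝ}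
    (he0 : 0 < e0) (hee : ∀ x, e0 ≤ e x) (H : En n → ℝ≥0∞) (K : ℝ≥0∞) (hK : K < ⊤)
    (hH : ∀ k u, lv (ι k) < G u → lv (ι k) < H u)
    (hb : ∀ k, ∀ u ∈ Om G (ι k), ∫⁻ x, ENNReal.ofReal (min (lr (ι k) *
      (dj G (ι k) u / (dj G (ι k) u + ‖x - u‖)) ^ a / β) 1) * wt x ≤
        K * (lv (ι k)) ^ (e u) * ENNReal.ofReal (dj G (ι k) u ^ n)) :
    ∫⁻ x, (∑' k : ℕ, ∫⁻ u, Tk a G β (ι k) x u) * wt x ≤ K * gc e0 * ∫⁻ u, (H u) ^ (e u) := by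
  have hm : ∀ k, Measurable (fun z : En n × En n => Tk a G β (ι k) z.1 z.2) :=
    fun k => Tk_meas a G β (ι k) (ho _)
  have hgt : gc e0 < ⊤ := gc_lt_top he0
  calc ∫⁻ x, (∑' k : ℕ, ∫⁻ u, Tk a G β (ι k) x u) * wt x
      = ∑' k : ℕ, ∫⁻ u, ∫⁻ x, Tk a G β (ι k) x u * wt x :=
        sum_swap (fun k => Tk a G β (ι k)) hm wt hwt
    _ ≤ ∑' k : ℕ, ∫⁻ u, K * (if lv (ι k) < H u then (lv (ι k)) ^ (e u) else 0) := by
        apply ENNReal.tsum_le_tsum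
        intro k
        refine lintegral_mono fun u => ?_
        by_cases hu : u ∈ Om G (ι k)
        · rw [if_pos (hH k u hu)]
          have hd : 0 < dj G (ι k) u := (dj_pos (ho _) (hc _)).mpr hu
          calc ∫⁻ x, Tk a G β (ι k) x u * wt x
              = ∫⁻ x, ENNReal.ofReal ((dj G (ι k) u ^ n)⁻¹) * (ENNReal.ofReal (min (lr (ι k) *
                (dj G (ι k) u / (dj G (ι k) u + ‖x - u‖)) ^ a / β) 1) * wt x) := by
                congr 1; funext x
                rw [Tk, indicator_of_mem hu]; ring
            _ ≤ ENNReal.ofReal ((dj G (ι k) u ^ n)⁻¹) *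
                  (K * (lv (ι k)) ^ (e u) * ENNReal.ofReal (dj G (ι k) u ^ n)) := by
                rw [lintegral_const_mul' _ _ (by simp)]
                gcongr
                exact hb k u hu
            _ = (ENNReal.ofReal ((dj G (ι k) u ^ n)⁻¹) * ENNReal.ofReal (dj G (ι k) u ^ n)) *
                (K * (lv (ι k)) ^ (e u)) := by ring
            _ = _ := by
                rw [← ENNReal.ofReal_mul (by positivity), inv_mul_cancel₀ (by positivity)]; simp
        · have : ∀ x, Tk a G β (ι k) x u = 0 := fun x => by rw [Tk, indicator_of_notMem hu]
          simp [this]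
    _ ≤ ∑' k : ℕ, K * ∫⁻ u, (if lv (ι k) < H u then (lv (ι k)) ^ (e u) else 0) := by
        apply ENNReal.tsum_le_tsum
        intro k
        rw [lintegral_const_mul' _ _ hK.ne]
    _ = K * ∑' k : ℕ, ∫⁻ u, (if lv (ι k) < H u then (lv (ι k)) ^ (e u) else 0) := by
        rw [ENNReal.tsum_mul_left]
    _ ≤ K * ∫⁻ u, ∑' k : ℕ, (if lv (ι k) < H u then (lv (ι k)) ^ (e u) else 0) := by
        gcongr
        refine ENNReal.tsum_le_of_sum_range_le ?_
        intro N
        refine le_trans ?_ (lintegral_mono fun u => ENNReal.sum_le_tsum (Finset.range N))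
        generalize Finset.range N = F
        induction F using Finset.induction_on with
        | empty => simp
        | insert i F hi ih =>
          rw [Finset.sum_insert hi]
          simp_rw [Finset.sum_insert hi]
          exact (add_le_add_right ih _).trans (le_lintegral_add _ _)
    _ ≤ K * ∫⁻ u, gc e0 * (H u) ^ (e u) := by
        gcongr with u
        calc _ ≤ ∑' j : ℤ, (if lv j < H u then (lv j) ^ (e u) else 0) :=
              ENNReal.tsum_comp_le_tsum_of_injective hι (fun j => if lv j < H u then (lv j) ^ (e u) else 0)
          _ ≤ gc (e u) * (H u) ^ (e u) := geo_upper (he0.trans_le (hee u)) _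
          _ ≤ _ := by gcongr; exact gc_anti (hee u)
    _ = _ := by rw [lintegral_const_mul' _ _ hgt.ne, mul_assoc]

lemma compl_nonempty (hn : 1 ≤ n) {p : En n → ℝ} {p0 C0 pinf : ℝ} (h : LH n p p0 1 C0 pinf)
    {G : En n → ℝ≥0∞} (hI : ∫⁻ x, (G x) ^ (p x) < ⊤) (j : ℤ) : (Om G j)ᶜ.Nonempty := by
  rw [nonempty_compl]
  intro huniv
  have : Nonempty (Fin n) := ⟨⟨0, hn⟩⟩
  have hlow : ∀ x, min 1 (lv j) ≤ (G x) ^ (p x) := by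
    intro x
    have hx : x ∈ Om G j := huniv ▸ mem_univ x
    have hp1 := h.le_hi x
    have hp0 : 0 < p x := h.lo_pos.trans_le (h.lo_le x)
    calc min 1 (lv j) ≤ (min 1 (lv j)) ^ (p x) := by
          conv_lhs => rw [← ENNReal.rpow_one (min 1 (lv j))]
          exact ENNReal.rpow_le_rpow_of_exponent_ge (min_le_left _ _) hp1
      _ ≤ _ := by
          gcongr
          exact (min_le_right _ _).trans (le_of_lt hx)
  have : ∫⁻ x : En n, min 1 (lv j) ≤ ∫⁻ x, (G x) ^ (p x) := lintegral_mono hlow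
  rw [lintegral_const, measure_univ_of_isAddLeftInvariant, ENNReal.mul_top] at this
  · exact absurd hI (not_lt.mpr this)
  · exact (lt_min one_pos (pos_iff_ne_zero.mpr (lv_ne_zero j))).ne'

lemma cheb {S wt : En n → ℝ≥0∞} {c : ℝ≥0∞} (hc : c ≠ 0) (hct : c ≠ ⊤)
    (hm : MeasurableSet {x | c ≤ S x}) :
    ∫⁻ x in {x | c ≤ S x}, wt x ≤ c⁻¹ * ∫⁻ x, S x * wt x := by
  rw [← lintegral_const_mul' _ _ (ENNReal.inv_ne_top.mpr hc)]
  refine le_trans (setLIntegral_mono' hm fun x hx => ?_) (setLIntegral_le_lintegral _ _)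
  calc wt x = c⁻¹ * c * wt x := by rw [ENNReal.inv_mul_cancel hc hct, one_mul]
    _ ≤ c⁻¹ * S x * wt x := by gcongr; exact hx
    _ = _ := by ring

lemma SS_meas {a : ℝ} {G : En n → ℝ≥0∞} (ho : ∀ j, IsOpen (Om G j)) (β : ℝ) :
    Measurable (SSp a G β) ∧ Measurable (SSm a G β) := by
  constructor
  · exact Measurable.tsum fun k => Measurable.lintegral_prod_right (Tk_meas a G β _ (ho _))
  · exact Measurable.tsum fun k => Measurable.lintegral_prod_right (Tk_meas a G β _ (ho _))

end Part9

section Part10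

variable {n : ℕ}

lemma lv_nat_ge (k : ℕ) : 1 ≤ lr (k : ℤ) := by
  have h := lv_mono (Int.natCast_nonneg k)
  rw [lv_zero] at h
  have := ENNReal.toReal_mono (lv_ne_top _) h
  simpa [lr] using this

lemma lv_neg_lt (k : ℕ) : lv (-((k:ℤ) + 1)) < 1 := by
  have h : lv (-((k:ℤ) + 1)) ≤ lv (-1) := lv_mono (by omega)
  refine h.trans_lt ?_
  have := lv_succ (-1)
  rw [show (-1:ℤ) + 1 = 0 by norm_num, lv_zero] at this
  by_contra hge
  rw [not_lt] at hge
  have h2 : (2:ℝ≥0∞) * 1 ≤ 1 := by rw [this]; rw [← this]; calc (2:ℝ≥0∞) * 1 ≤ 2 * lv (-1) := by gcongr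
                                    _ = 1 := this.symm
  norm_num at h2

lemma A_bound {p : En n → ℝ} {p0 C0 pinf a : ℝ} (h : LH n p p0 1 C0 pinf)
    (ha : (n:ℝ) < a) (hp0 : (n:ℝ) = a * p0) (CG : ℝ≥0∞) (hCG : CG < ⊤) :
    ∃ A1 : ℝ, 1 ≤ A1 ∧ ∀ (G : En n → ℝ≥0∞), ∫⁻ x, (G x) ^ (p x) ≤ CG → ∀ (k : ℕ) (u : En n),
      0 < dj G k u → lr k * (dj G k u) ^ a ≤ A1 := by
  have ha0 : 0 < a := lt_of_le_of_lt (Nat.cast_nonneg n) ha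
  set ω := volume (Metric.ball (0 : En n) 1)
  set C1 : ℝ := (CG / ω).toReal
  refine ⟨max 1 (C1 ^ (1 / p0)), le_max_left _ _, ?_⟩
  intro G hI k u hd
  refine le_trans ?_ (le_max_right _ _)
  set d := dj G k u
  have hl := lv_nat_ge k
  have hl0 : 0 < lr k := lr_pos k
  have hlv : 1 ≤ lv k := by rw [lv_eq]; simpa using hl
  have h1 : ENNReal.ofReal (lr k ^ p0) * (ENNReal.ofReal (d ^ n) * ω) ≤ CG := by
    rw [← vol_ball u hd, ← setLIntegral_const]
    refine le_trans ?_ hI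
    refine le_trans (setLIntegral_mono' measurableSet_ball fun y hy => ?_) (setLIntegral_le_lintegral _ _)
    have hy' : y ∈ Om G k := ball_dj hy
    have hp := h.lo_le y
    have := h.lo_pos
    calc ENNReal.ofReal (lr k ^ p0) = (lv k) ^ p0 := by
          rw [lv_eq, ENNReal.ofReal_rpow_of_pos hl0]
      _ ≤ (lv k) ^ (p y) := ENNReal.rpow_le_rpow_of_exponent_le hlv hp
      _ ≤ _ := ENNReal.rpow_le_rpow (le_of_lt hy') (by linarith)
  have h2 : lr k ^ p0 * d ^ n ≤ C1 := by
    have h3 : ENNReal.ofReal (lr k ^ p0 * d ^ n) ≤ CG / ω := by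
      rw [ENNReal.le_div_iff_mul_le (Or.inl (vol_ball_pos _ one_pos)) (Or.inl (vol_ball_top _ _)),
        ENNReal.ofReal_mul (by positivity), mul_assoc]
      exact h1
    have ht : CG / ω ≠ ⊤ := ENNReal.div_ne_top hCG.ne (vol_ball_pos _ one_pos)
    exact (ENNReal.ofReal_le_iff_le_toReal ht).mp h3
  have hp0p := h.lo_pos
  calc lr k * d ^ a = (lr k ^ p0 * d ^ n) ^ (1 / p0) := by
        rw [Real.mul_rpow (by positivity) (by positivity), ← Real.rpow_natCast d n,
          ← Real.rpow_mul hl0.le, ← Real.rpow_mul hd.le, hp0, mul_one_div_cancel hp0p.ne',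
          Real.rpow_one]
        congr 2; field_simp
    _ ≤ _ := by gcongr

theorem weak_main (hn : 1 ≤ n) {p : En n → ℝ} {p0 C0 pinf a : ℝ} (h : LH n p p0 1 C0 pinf)
    (ha : (n:ℝ) < a) (hp0 : (n:ℝ) = a * p0) (CG : ℝ≥0∞) (hCG : CG < ⊤) :
    ∃ K : ℝ≥0∞, K < ⊤ ∧ ∀ (G : En n → ℝ≥0∞), (∀ j, IsOpen (Om G j)) →
      ∫⁻ x, (G x) ^ (p x) ≤ CG → ∀ β : ℝ, 0 < β → ∃ E : Set (En n), MeasurableSet E ∧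
      (∀ x s, 0 < s → Kl n a * ENNReal.ofReal β < ∫⁻ u, pk a s (x - u) * Vs G s u → x ∈ E) ∧
      ∫⁻ x in E, (ENNReal.ofReal β) ^ (p x) ≤ K := by
  obtain ⟨A1, hA1, hA⟩ := A_bound h ha hp0 CG hCG
  obtain ⟨Kb, hKb, hbub⟩ := bub_plus h ha hp0 hA1 hn
  have hp0p := h.lo_pos
  have hpi0 : p0 ≤ pinf := h.lo_inf
  have hN : (0:ℝ) < n + 1 := by positivity
  have hKc : Kc n (n+1:ℝ) < ⊤ := Kc_lt_top (by linarith)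
  set Eq := ENNReal.ofReal (Real.exp (C0 * ((n+1:ℝ) / p0))) with hEq
  have hEqt : Eq < ⊤ := by simp [Eq]
  set c := cl n a / 2 with hcdef
  have hc0 : c ≠ 0 := by
    rw [hcdef]; exact (ENNReal.div_pos (cl_pos a).ne' (by norm_num)).ne'
  have hct : c ≠ ⊤ := by
    have : cl n a ≤ 1 := min_le_left _ _
    rw [hcdef]
    exact ENNReal.div_ne_top (ne_top_of_le_ne_top (by simp) this) (by norm_num)
  have hci : c⁻¹ < ⊤ := ENNReal.inv_lt_top.mpr (pos_iff_ne_zero.mpr hc0)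
  have hgt : gc p0 < ⊤ := gc_lt_top hp0p
  set Km := ENNReal.ofReal (2 ^ a) * Kc n a with hKm
  have hKmt : Km < ⊤ := ENNReal.mul_lt_top (by simp) (Kc_lt_top ha)
  set Q1 := c⁻¹ * (Kb * gc p0 * CG) with hQ1
  set Im := Eq * CG + Kc n (n+1:ℝ) + CG with hIm
  set Q2 := c⁻¹ * (Km * gc p0 * Im) with hQ2
  have hQ1t : Q1 < ⊤ := ENNReal.mul_lt_top hci (ENNReal.mul_lt_top (ENNReal.mul_lt_top hKb hgt) hCG)
  have hImt : Im < ⊤ := ENNReal.add_lt_top.mpr ⟨ENNReal.add_lt_top.mpr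
    ⟨ENNReal.mul_lt_top hEqt hCG, hKc⟩, hCG⟩
  have hQ2t : Q2 < ⊤ := ENNReal.mul_lt_top hci (ENNReal.mul_lt_top (ENNReal.mul_lt_top hKmt hgt) hImt)
  refine ⟨Q1 + (Eq * Q2 + Kc n (n+1:ℝ) + Q2), ENNReal.add_lt_top.mpr ⟨hQ1t, ENNReal.add_lt_top.mpr
    ⟨ENNReal.add_lt_top.mpr ⟨ENNReal.mul_lt_top hEqt hQ2t, hKc⟩, hQ2t⟩⟩, ?_⟩
  intro G ho hI β hβ
  have hcn : ∀ j, (Om G j)ᶜ.Nonempty := compl_nonempty hn h (hI.trans_lt hCG)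
  obtain ⟨hmp, hmm⟩ := SS_meas (a := a) ho β
  have hmEp : MeasurableSet {x | c ≤ SSp a G β x} := measurableSet_le measurable_const hmp
  have hmEm : MeasurableSet {x | c ≤ SSm a G β x} := measurableSet_le measurable_const hmm
  have hwp : Measurable fun x => ENNReal.ofReal β ^ (p x) := measurable_const.pow h.meas
  refine ⟨{x | c ≤ SSp a G β x} ∪ {x | c ≤ SSm a G β x}, hmEp.union hmEm, ?_, ?_⟩
  · intro x s hs hT
    have := level_main ha ho hcn hβ x hs hT
    by_contra hx
    simp only [mem_union, mem_ofPred_eq, not_or, not_le] at hx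
    have h2 := ENNReal.add_lt_add hx.1 hx.2
    rw [hcdef, ENNReal.add_halves] at h2
    exact absurd this (not_le.mpr h2)
  refine (lintegral_union_le _ _ _).trans (add_le_add ?_ ?_)
  · -- plus part
    refine (cheb hc0 hct hmEp).trans ?_
    rw [hQ1]
    gcongr
    refine (sum_general ho hcn (fun k : ℕ => (k:ℤ)) (fun i j hij => by simpa using hij)
      _ hwp p h.meas hp0p h.lo_le G Kb hKb (fun k u hu => hu) ?_).trans (by gcongr)
    intro k u hu
    have hd : 0 < dj G k u := (dj_pos (ho _) (hcn _)).mpr hu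
    have hb := hbub u (dj G k u) (lr k) β hd (lv_nat_ge k) hβ (hA G hI k u hd)
    have e1 : ∀ x : En n, ENNReal.ofReal (min (lr k * (dj G k u / (dj G k u + ‖x - u‖)) ^ a / β) 1) *
        ENNReal.ofReal β ^ (p x) = ENNReal.ofReal (min (lr k * (dj G k u / (dj G k u + ‖x - u‖)) ^ a / β) 1 *
        β ^ (p x)) := by
      intro x
      have := lr_pos k
      rw [ENNReal.ofReal_rpow_of_pos hβ, ← ENNReal.ofReal_mul (by positivity)]
    simp_rw [e1]
    refine hb.trans (le_of_eq ?_)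
    rw [lv_eq, ENNReal.ofReal_rpow_of_pos (lr_pos k), ENNReal.ofReal_mul
      (by have := lr_pos k; positivity), mul_assoc]
  · -- minus part
    have minus : ∀ e : ℝ, p0 ≤ e → e ≤ 1 → ∫⁻ x, (min (G x) 1) ^ e ≤ Im →
        ∫⁻ x in {x | c ≤ SSm a G β x}, (ENNReal.ofReal β) ^ e ≤ Q2 := by
      intro e he0 he1 hIe
      refine (cheb hc0 hct hmEm).trans ?_
      rw [hQ2]
      gcongr
      refine (sum_general ho hcn (fun k : ℕ => -((k:ℤ)+1)) (fun i j hij => by simpa using hij)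
        (fun _ => ENNReal.ofReal β ^ e) measurable_const (fun _ => e) measurable_const hp0p
        (fun _ => he0) (fun x => min (G x) 1) Km hKmt
        (fun k u hu => lt_min hu (lv_neg_lt k)) ?_).trans (by gcongr)
      intro k u hu
      have hd : 0 < dj G (-((k:ℤ)+1)) u := (dj_pos (ho _) (hcn _)).mpr hu
      set j := -((k:ℤ)+1)
      have hl := lr_pos j
      have hb := bub_minus (n := n) ha hp0 he0 he1 (by positivity : 0 < lr j / β) hd u
      rw [lintegral_mul_const' _ _ (ENNReal.rpow_ne_top_of_nonneg (by linarith) (by simp))]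
      calc _ ≤ (Km * ENNReal.ofReal ((lr j / β) ^ e * dj G j u ^ n)) * ENNReal.ofReal β ^ e := by
            gcongr
            refine le_trans (le_of_eq ?_) hb
            congr 1; funext x; rw [div_mul_eq_mul_div]
        _ = _ := by
            rw [lv_eq, ENNReal.ofReal_rpow_of_pos hβ, ENNReal.ofReal_rpow_of_pos hl, mul_assoc Km, mul_assoc Km,
              ← ENNReal.ofReal_mul (by positivity), ← ENNReal.ofReal_mul (by positivity),
              Real.div_rpow hl.le hβ.le]
            congr 2; field_simp
    have hpx : ∀ x, 0 < p x := fun x => hp0p.trans_le (h.lo_le x)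
    rcases le_or_gt 1 β with hβ1 | hβ1
    · have hI1 : ∫⁻ x, (min (G x) 1) ^ (1:ℝ) ≤ Im := by
        refine le_trans ?_ (le_add_self : CG ≤ Im)
        refine le_trans (lintegral_mono fun x => ?_) hI
        calc (min (G x) 1) ^ (1:ℝ) ≤ (min (G x) 1) ^ (p x) :=
              ENNReal.rpow_le_rpow_of_exponent_ge (min_le_right _ _) (h.le_hi x)
          _ ≤ _ := by gcongr; exacts [(hpx x).le, min_le_left _ _]
      refine le_trans (le_trans ?_ (minus 1 (hpi0.trans h.inf_hi) le_rfl hI1)) le_add_self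
      refine lintegral_mono fun x => ?_
      exact ENNReal.rpow_le_rpow_of_exponent_le (by simpa using hβ1) (h.le_hi x)
    · have hIi : ∫⁻ x, (min (G x) 1) ^ pinf ≤ Im := by
        refine le_trans ?_ (le_self_add : Eq * CG + Kc n (n+1:ℝ) ≤ Im)
        calc ∫⁻ x, (min (G x) 1) ^ pinf ≤ ∫⁻ x, (Eq * (G x) ^ (p x) +
              ENNReal.ofReal ((1 + ‖x‖) ^ (-(n+1:ℝ)))) := by
              refine lintegral_mono fun x => ?_
              refine (eq_enn hN (min_le_right _ _) hp0p hpi0 (hpx x) h.C_pos (norm_nonneg x)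
                (by rw [abs_sub_comm]; exact h.infty x)).trans ?_
              gcongr
              exacts [(hpx x).le, min_le_left _ _]
          _ = Eq * (∫⁻ x, (G x) ^ (p x)) + Kc n (n+1:ℝ) := by
              rw [lintegral_add_right _ (by fun_prop), lintegral_const_mul' _ _ hEqt.ne]; rfl
          _ ≤ _ := by gcongr
      have hm := minus pinf hpi0 h.inf_hi hIi
      refine le_trans ?_ (le_self_add : Eq * Q2 + Kc n (n+1:ℝ) ≤ _)
      calc _ ≤ ∫⁻ x in {x | c ≤ SSm a G β x}, (Eq * (ENNReal.ofReal β) ^ pinf +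
              ENNReal.ofReal ((1 + ‖x‖) ^ (-(n+1:ℝ)))) := by
              refine lintegral_mono fun x => ?_
              exact eq_enn hN (by simpa using hβ1.le) hp0p (h.lo_le x) (by linarith) h.C_pos (norm_nonneg x)
                (h.infty x)
        _ ≤ Eq * (∫⁻ x in {x | c ≤ SSm a G β x}, (ENNReal.ofReal β) ^ pinf) + Kc n (n+1:ℝ) := by
              rw [lintegral_add_right _ (by fun_prop), lintegral_const_mul' _ _ hEqt.ne]
              gcongr
              exact setLIntegral_le_lintegral _ _
        _ ≤ _ := by gcongr

end Part10

section Part11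

/-- The holomorphic integrand used for the contour shift. -/
def jf (ν R : ℝ) (z : ℂ) : ℂ := (1 - z ^ 2) ^ (ν : ℂ) * Complex.exp (2 * π * R * Complex.I * z)

lemma jf_contAt {ν R : ℝ} (hν : 0 < ν) {z : ℂ} (hz : 0 ≤ (1 - z ^ 2).re) :
    ContinuousAt (jf ν R) z := by
  unfold jf
  refine ContinuousAt.mul ?_ (by fun_prop)
  exact ContinuousAt.comp (f := fun z : ℂ => 1 - z ^ 2) (g := fun w : ℂ => w ^ (ν:ℂ))
    (Complex.continuousAt_cpow_const_of_re_pos (Or.inl hz) (by simpa using hν)) (by fun_prop)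

lemma jf_norm (ν R : ℝ) (z : ℂ) :
    ‖jf ν R z‖ = ‖1 - z ^ 2‖ ^ ν * Real.exp (-(2 * π * R * z.im)) := by
  unfold jf
  rw [norm_mul, Complex.norm_cpow_real, Complex.norm_exp]
  congr 2
  simp

lemma one_sub_sq_re (x y : ℝ) : (1 - ((x:ℂ) + y * Complex.I) ^ 2).re = 1 - x ^ 2 + y ^ 2 := by
  simp [sq]; ring

lemma exp_le_rpow {s : ℝ} (hs : 0 ≤ s) : ∃ C : ℝ, 0 < C ∧ ∀ R : ℝ, 1 ≤ R →
    Real.exp (-(2 * π * R)) ≤ C * R ^ (-s) := by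
  refine ⟨(Nat.factorial ⌈s⌉₊ : ℝ), by positivity, fun R hR => ?_⟩
  have h1 : R ^ s ≤ R ^ (⌈s⌉₊) := by
    rw [← Real.rpow_natCast]
    exact Real.rpow_le_rpow_of_exponent_le hR (Nat.le_ceil s)
  have h2 := Real.pow_div_factorial_le_exp R (by linarith) ⌈s⌉₊
  have h3 : Real.exp R ≤ Real.exp (2 * π * R) := by
    apply Real.exp_le_exp.mpr
    nlinarith [Real.pi_gt_three]
  rw [div_le_iff₀ (by positivity)] at h2
  rw [Real.exp_neg, Real.rpow_neg (by linarith), ← div_eq_mul_inv, inv_eq_one_div,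
    div_le_div_iff₀ (by positivity) (by positivity)]
  have : 0 < (Nat.factorial ⌈s⌉₊ : ℝ) := by positivity
  nlinarith

lemma jf_vert {ν R : ℝ} (hν : 0 < ν) (hR : 1 ≤ R) {σ : ℝ} (hσ : σ ^ 2 = 1) :
    ‖∫ y in (0:ℝ)..1, jf ν R ((σ:ℂ) + y * Complex.I)‖ ≤
      3 ^ ν * ((1 / (2 * π)) ^ (ν + 1) * Real.Gamma (ν + 1)) * R ^ (-(ν + 1)) := by
  have hR0 : 0 < R := by linarith
  have hIntg : IntegrableOn (fun y : ℝ => 3 ^ ν * (y ^ (ν + 1 - 1) * Real.exp (-(2 * π * R * y)))) (Ioi 0) := by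
    refine Integrable.const_mul ?_ _
    have := integrableOn_rpow_mul_exp_neg_mul_rpow (p := 1) (s := ν) (b := 2 * π * R) (by linarith) one_pos
      (by positivity)
    simpa [IntegrableOn] using this
  have hval : ∫ y in Ioi (0:ℝ), 3 ^ ν * (y ^ (ν + 1 - 1) * Real.exp (-(2 * π * R * y))) =
      3 ^ ν * ((1 / (2 * π)) ^ (ν + 1) * Real.Gamma (ν + 1)) * R ^ (-(ν + 1)) := by
    rw [integral_const_mul, Real.integral_rpow_mul_exp_neg_mul_Ioi (by linarith) (by positivity),
      one_div, mul_inv, Real.mul_rpow (by positivity) (by positivity), Real.inv_rpow hR0.le,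
      Real.rpow_neg hR0.le]
    rw [one_div]
    ring
  rw [← hval, intervalIntegral.integral_of_le zero_le_one]
  calc _ ≤ ∫ y in Ioc (0:ℝ) 1, 3 ^ ν * (y ^ (ν + 1 - 1) * Real.exp (-(2 * π * R * y))) := by
        refine norm_integral_le_of_norm_le (hIntg.mono_set Ioc_subset_Ioi_self) ?_
        refine (ae_restrict_iff' measurableSet_Ioc).mpr (Filter.Eventually.of_forall fun y hy => ?_)
        rw [jf_norm]
        have e : (1 - ((σ:ℂ) + y * Complex.I) ^ 2) = (y:ℂ) * (y - 2 * σ * Complex.I) := by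
          have : (σ:ℂ) ^ 2 = 1 := by exact_mod_cast hσ
          linear_combination (-1) * this - (y:ℂ)^2 * Complex.I_sq
        have h1 : ‖(1 - ((σ:ℂ) + y * Complex.I) ^ 2)‖ ≤ 3 * y := by
          rw [e, norm_mul, Complex.norm_real, Real.norm_eq_abs, abs_of_pos hy.1, mul_comm]
          gcongr
          · exact hy.1.le
          refine (norm_sub_le _ _).trans ?_
          have : |σ| = 1 := by
            have h := sq_abs σ
            rw [hσ] at h
            nlinarith [abs_nonneg σ]
          simp only [Complex.norm_real, norm_mul, Complex.norm_I, Real.norm_eq_abs, abs_of_pos hy.1, this]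
          norm_num
          linarith [hy.2]
        have h2 : ((σ:ℂ) + y * Complex.I).im = y := by simp
        rw [h2, ← mul_assoc]
        gcongr
        rw [add_sub_cancel_right, ← Real.mul_rpow (by norm_num) hy.1.le]
        exact Real.rpow_le_rpow (norm_nonneg _) h1 hν.le
    _ ≤ _ := by
        refine setIntegral_mono_set hIntg ?_ (Filter.Eventually.of_forall Ioc_subset_Ioi_self)
        refine (ae_restrict_iff' measurableSet_Ioi).mpr (Filter.Eventually.of_forall fun y hy => ?_)
        have : (0:ℝ) < y := hy
        simp only [Pi.zero_apply]; positivity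

lemma jf_main {ν : ℝ} (hν : 0 < ν) : ∃ C : ℝ, 0 < C ∧ ∀ R : ℝ, 1 ≤ R →
    ‖∫ s in (-1:ℝ)..1, (((1 - s ^ 2) ^ ν : ℝ) : ℂ) * Complex.exp (2 * π * R * Complex.I * s)‖ ≤
      C * R ^ (-(ν + 1)) := by
  obtain ⟨C1, hC1, h1⟩ := exp_le_rpow (s := ν + 1) (by linarith)
  set C2 := 3 ^ ν * ((1 / (2 * π)) ^ (ν + 1) * Real.Gamma (ν + 1)) with hC2
  have hC2p : 0 < C2 := by
    have := Real.Gamma_pos_of_pos (by linarith : 0 < ν + 1)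
    positivity
  refine ⟨5 ^ ν * 2 * C1 + 2 * C2, by positivity, fun R hR => ?_⟩
  have key := Complex.integral_boundary_rect_eq_zero_of_continuousOn_of_differentiableOn (jf ν R)
    (-1) (1 + Complex.I) ?_ ?_
  · simp only [Complex.neg_re, Complex.one_re, Complex.add_re, Complex.I_re, add_zero, Complex.neg_im,
      Complex.one_im, neg_zero, Complex.add_im, Complex.I_im, zero_add, Complex.ofReal_zero, zero_mul,
      Complex.ofReal_one, one_mul] at key
    have e : ∫ s in (-1:ℝ)..1, (((1 - s ^ 2) ^ ν : ℝ) : ℂ) * Complex.exp (2 * π * R * Complex.I * s) =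
        ∫ s in (-1:ℝ)..1, jf ν R s := by
      refine intervalIntegral.integral_congr fun s hs => ?_
      rw [uIcc_of_le (by norm_num)] at hs
      simp only [jf]
      rw [Complex.ofReal_cpow (by nlinarith [hs.1, hs.2])]
      push_cast; rfl
    have hb : ‖∫ s in (-1:ℝ)..1, jf ν R (s + Complex.I)‖ ≤ 5 ^ ν * (C1 * R ^ (-(ν + 1))) * |1 - (-1)| := by
      refine intervalIntegral.norm_integral_le_of_norm_le_const fun s hs => ?_
      rw [uIoc_of_le (by norm_num)] at hs
      rw [jf_norm]
      have : ((s:ℂ) + Complex.I).im = 1 := by simp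
      rw [this, mul_one]
      gcongr ?_ * ?_
      · refine Real.rpow_le_rpow (norm_nonneg _) ?_ hν.le
        refine (norm_sub_le _ _).trans ?_
        rw [norm_pow, norm_one]
        have h3 : ‖(s:ℂ) + Complex.I‖ ≤ 2 := by
          refine (norm_add_le _ _).trans ?_
          rw [Complex.norm_real, Complex.norm_I, Real.norm_eq_abs]
          have := abs_le.mpr ⟨hs.1.le, hs.2⟩
          linarith
        nlinarith [norm_nonneg ((s:ℂ) + Complex.I)]
      · exact h1 R hR
    have hv1 := jf_vert (R := R) hν hR (σ := 1) (by norm_num)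
    have hv2 := jf_vert (R := R) hν hR (σ := -1) (by norm_num)
    rw [e]
    push_cast at hv1 hv2 key
    have e2 : ∫ s in (-1:ℝ)..1, jf ν R s = (∫ s in (-1:ℝ)..1, jf ν R (s + Complex.I))
        - Complex.I • (∫ y in (0:ℝ)..1, jf ν R (1 + y * Complex.I))
        + Complex.I • (∫ y in (0:ℝ)..1, jf ν R (-1 + y * Complex.I)) := by
      linear_combination (exp := 1) key
    rw [e2]
    refine (norm_add_le _ _).trans ?_
    refine (add_le_add_left (norm_sub_le _ _) _).trans ?_
    rw [norm_smul, norm_smul, Complex.norm_I, one_mul, one_mul]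
    have : |(1:ℝ) - (-1)| = 2 := by norm_num
    rw [this] at hb
    nlinarith
  · intro z hz
    refine (jf_contAt hν ?_).continuousWithinAt
    rw [Complex.mem_reProdIm] at hz
    simp only [Complex.neg_re, Complex.one_re, Complex.add_re, Complex.I_re, add_zero] at hz
    rw [uIcc_of_le (by norm_num)] at hz
    have := one_sub_sq_re z.re z.im
    rw [Complex.re_add_im] at this
    rw [this]
    nlinarith [hz.1.1, hz.1.2, sq_nonneg z.im]
  · intro z hz
    rw [Complex.mem_reProdIm] at hz
    simp only [Complex.neg_re, Complex.one_re, Complex.add_re, Complex.I_re, add_zero] at hz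
    have h1 : -1 < z.re := by simpa using hz.1.1
    have h2 : z.re < 1 := by simpa using hz.1.2
    have := one_sub_sq_re z.re z.im
    rw [Complex.re_add_im] at this
    refine DifferentiableAt.differentiableWithinAt ?_
    unfold jf
    refine DifferentiableAt.mul ?_ (by fun_prop)
    refine DifferentiableAt.cpow (by fun_prop) (by fun_prop) ?_
    left
    rw [this]
    nlinarith [sq_nonneg z.im]

end Part11

section Part12

open scoped FourierTransform

variable {n : ℕ}

/-- The Bochner–Riesz multiplier. -/
def bw (n : ℕ) (δ : ℝ) (ξ : En n) : ℝ := (max (1 - ‖ξ‖ ^ 2) 0) ^ δ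

lemma bw_cont {δ : ℝ} (hδ : 0 < δ) : Continuous (bw n δ) := by
  unfold bw
  exact Continuous.rpow_const (by fun_prop) fun x => Or.inr hδ.le

lemma bw_zero {δ : ℝ} (hδ : 0 < δ) {ξ : En n} (h : 1 ≤ ‖ξ‖) : bw n δ ξ = 0 := by
  unfold bw
  rw [max_eq_right (by nlinarith), Real.zero_rpow hδ.ne']

lemma bw_nonneg (δ : ℝ) (ξ : En n) : 0 ≤ bw n δ ξ := by unfold bw; positivity

lemma bw_le_one {δ : ℝ} (hδ : 0 < δ) (ξ : En n) : bw n δ ξ ≤ 1 := by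
  unfold bw
  refine Real.rpow_le_one (by positivity) ?_ hδ.le
  exact max_le (by nlinarith [norm_nonneg ξ]) zero_le_one

lemma bw_supp {δ : ℝ} (hδ : 0 < δ) : HasCompactSupport (bw n δ) :=
  HasCompactSupport.intro (isCompact_closedBall 0 1) fun x hx => bw_zero hδ (by
    simp at hx; exact hx.le)

lemma bw_int {δ : ℝ} (hδ : 0 < δ) : Integrable (fun ξ => (bw n δ ξ : ℂ)) :=
  ((bw_cont hδ).integrable_of_hasCompactSupport (bw_supp hδ)).ofReal

lemma brKernel_eq (δ : ℝ) (x : En n) : brKernel n δ x = 𝓕 (fun ξ => (bw n δ ξ : ℂ)) x := by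
  rw [Real.fourier_eq']
  unfold brKernel bw
  congr 1; funext ξ
  rw [smul_eq_mul, mul_comm]
  congr 2
  rw [PiLp.inner_apply]
  simp only [RCLike.inner_apply, conj_trivial]
  push_cast
  ring

lemma brKernel_cont {δ : ℝ} (hδ : 0 < δ) : Continuous (brKernel n δ) := by
  have : brKernel n δ = 𝓕 (fun ξ => (bw n δ ξ : ℂ)) := funext (brKernel_eq δ)
  rw [this]
  exact VectorFourier.fourierIntegral_continuous Real.continuous_fourierChar continuous_inner (bw_int hδ)

lemma brKernel_rad (δ : ℝ) {x y : En n} (h : ‖x‖ = ‖y‖) : brKernel n δ x = brKernel n δ y := by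
  have hy := Submodule.reflection_sub h
  rw [brKernel_eq, brKernel_eq]
  have := Real.fourier_comp_linearIsometry ((ℝ ∙ (x - y))ᗮ.reflection) (fun ξ => (bw n δ ξ : ℂ)) x
  rw [hy] at this
  rw [← this]
  have e : ((fun ξ => (bw n δ ξ : ℂ)) ∘ ((ℝ ∙ (x - y))ᗮ.reflection)) = fun ξ => (bw n δ ξ : ℂ) := by
    funext ξ
    simp [bw]
  rw [e]

/-- The integral over the orthogonal slices. -/
def wt (k : ℕ) (δ A : ℝ) : ℝ := ∫ y : Fin k → ℝ, (max (A - ∑ i, y i ^ 2) 0) ^ δ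

lemma wt_zero (k : ℕ) {δ A : ℝ} (hδ : 0 < δ) (hA : A ≤ 0) : wt k δ A = 0 := by
  unfold wt
  have : ∀ y : Fin k → ℝ, (max (A - ∑ i, y i ^ 2) 0) ^ δ = 0 := by
    intro y
    have : 0 ≤ ∑ i, y i ^ 2 := Finset.sum_nonneg fun i _ => sq_nonneg _
    rw [max_eq_right (by linarith), Real.zero_rpow hδ.ne']
  simp [this]

lemma wt_scale (k : ℕ) {δ A : ℝ} (hA : 0 < A) : wt k δ A = A ^ (δ + k / 2) * wt k δ 1 := by
  unfold wt
  have h := Measure.integral_comp_smul (volume : Measure (Fin k → ℝ))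
    (fun y : Fin k → ℝ => (max (A - ∑ i, y i ^ 2) 0) ^ δ) (√A)
  have e : ∀ y : Fin k → ℝ, (max (A - ∑ i, (√A • y) i ^ 2) 0) ^ δ =
      A ^ δ * (max (1 - ∑ i, y i ^ 2) 0) ^ δ := by
    intro y
    rw [← Real.mul_rpow hA.le (by positivity), mul_max_of_nonneg _ _ hA.le]
    congr 2
    · simp only [Pi.smul_apply, smul_eq_mul, mul_pow, Real.sq_sqrt hA.le, ← Finset.mul_sum]
      ring
    · ring
  simp only [e] at h
  rw [integral_const_mul, Module.finrank_fin_fun, smul_eq_mul, abs_of_pos (by positivity)] at h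
  have hk : (√A) ^ k = A ^ ((k:ℝ) / 2) := by
    rw [Real.sqrt_eq_rpow, ← Real.rpow_natCast, ← Real.rpow_mul hA.le]
    congr 1; ring
  rw [hk] at h
  have hp : 0 < A ^ ((k:ℝ)/2) := by positivity
  rw [Real.rpow_add hA]
  field_simp at h
  linarith

lemma slice (k : ℕ) (g : ℝ × (Fin k → ℝ) → ℂ) :
    ∫ ξ : En (k+1), g (ξ 0, fun i => ξ i.succ) = ∫ z : ℝ × (Fin k → ℝ), g z := by
  have h1 := (volume_preserving_piFinSuccAbove (fun _ : Fin (k+1) => ℝ) 0).integral_comp' g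
  have h2 := (EuclideanSpace.volume_preserving_symm_measurableEquiv_toLp (Fin (k+1))).integral_comp'
    (fun y : Fin (k+1) → ℝ => g (MeasurableEquiv.piFinSuccAbove (fun _ : Fin (k+1) => ℝ) 0 y))
  rw [← h1, ← h2]
  rfl

lemma slice_int (k : ℕ) {δ : ℝ} (hδ : 0 < δ) (R : ℝ) :
    Integrable (fun z : ℝ × (Fin k → ℝ) => (((max (1 - z.1 ^ 2 - ∑ i, z.2 i ^ 2) 0) ^ δ : ℝ) : ℂ) *
      Complex.exp (2 * π * R * Complex.I * z.1)) (volume.prod volume) := by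
  refine Continuous.integrable_of_hasCompactSupport ?_ ?_
  · refine Continuous.mul (Complex.continuous_ofReal.comp ?_) (by fun_prop)
    exact Continuous.rpow_const (by fun_prop) fun x => Or.inr hδ.le
  · refine HasCompactSupport.intro (isCompact_closedBall 0 1) fun z hz => ?_
    have : max (1 - z.1 ^ 2 - ∑ i, z.2 i ^ 2) 0 = 0 := by
      refine max_eq_right ?_
      by_contra hc
      push Not at hc
      apply hz
      have hs : 0 ≤ ∑ i, z.2 i ^ 2 := Finset.sum_nonneg fun i _ => sq_nonneg _
      rw [mem_closedBall_zero_iff, Prod.norm_def]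
      refine max_le ?_ ?_
      · rw [Real.norm_eq_abs]
        exact abs_le_one_iff_mul_self_le_one.mpr (by nlinarith)
      · rw [pi_norm_le_iff_of_nonneg zero_le_one]
        intro i
        have := Finset.single_le_sum (f := fun i => z.2 i ^ 2) (fun i _ => sq_nonneg _) (Finset.mem_univ i)
        rw [Real.norm_eq_abs]
        exact abs_le_one_iff_mul_self_le_one.mpr (by nlinarith [sq_nonneg z.1])
    rw [this, Real.zero_rpow hδ.ne']
    simp

lemma brKernel_slice (k : ℕ) {δ : ℝ} (hδ : 0 < δ) (R : ℝ) :
    brKernel (k+1) δ (EuclideanSpace.single 0 (-R)) = (wt k δ 1 : ℂ) *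
      ∫ s in (-1:ℝ)..1, (((1 - s ^ 2) ^ (δ + k / 2) : ℝ) : ℂ) * Complex.exp (2 * π * R * Complex.I * s) := by
  have e1 : brKernel (k+1) δ (EuclideanSpace.single 0 (-R)) = ∫ ξ : En (k+1),
      (fun z : ℝ × (Fin k → ℝ) => (((max (1 - z.1 ^ 2 - ∑ i, z.2 i ^ 2) 0) ^ δ : ℝ) : ℂ) *
      Complex.exp (2 * π * R * Complex.I * z.1)) (ξ 0, fun i => ξ i.succ) := by
    unfold brKernel
    congr 1; funext ξ
    dsimp only
    rw [EuclideanSpace.norm_sq_eq]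
    simp only [Real.norm_eq_abs, sq_abs, Fin.sum_univ_succ, sub_sub]
    congr 2
    simp [Fin.succ_ne_zero]
    ring
  refine e1.trans ((slice k (fun z : ℝ × (Fin k → ℝ) => (((max (1 - z.1 ^ 2 - ∑ i, z.2 i ^ 2) 0) ^ δ : ℝ) : ℂ) *
      Complex.exp (2 * π * R * Complex.I * z.1))).trans ?_)
  rw [Measure.volume_eq_prod, integral_prod _ (slice_int k hδ R)]
  have e2 : ∀ s : ℝ, (∫ y : Fin k → ℝ, (((max (1 - s ^ 2 - ∑ i, y i ^ 2) 0) ^ δ : ℝ) : ℂ) *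
      Complex.exp (2 * π * R * Complex.I * s)) = (wt k δ (1 - s ^ 2) : ℂ) *
        Complex.exp (2 * π * R * Complex.I * s) := by
    intro s
    rw [integral_mul_const, integral_complex_ofReal]
    rfl
  simp only [e2]
  rw [intervalIntegral.integral_of_le (by norm_num), ← integral_const_mul, ← integral_indicator measurableSet_Ioc]
  congr 1; funext s
  by_cases hs : 0 < 1 - s ^ 2
  · rw [indicator_of_mem, wt_scale k hs]
    · push_cast; ring
    · constructor <;> nlinarith
  · rw [wt_zero k hδ (by linarith)]
    by_cases h1 : s ∈ Ioc (-1:ℝ) 1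
    · have : 1 - s ^ 2 = 0 := by
        push Not at hs
        have : s = 1 := by nlinarith [h1.1, h1.2]
        rw [this]; ring
      rw [indicator_of_mem h1, this, Real.zero_rpow (by positivity)]
      simp
    · rw [indicator_of_notMem h1]; simp

lemma brKernel_decay (hn : 1 ≤ n) {δ : ℝ} (hδ : 0 < δ) : ∃ C : ℝ, 0 < C ∧ ∀ x : En n,
    ‖brKernel n δ x‖ ≤ C * (1 + ‖x‖) ^ (-(((n:ℝ) + 1) / 2 + δ)) := by
  obtain ⟨k, rfl⟩ : ∃ k, n = k + 1 := ⟨n - 1, by omega⟩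
  obtain ⟨C, hC, h⟩ := jf_main (ν := δ + k / 2) (by positivity)
  set a : ℝ := (((k+1:ℕ):ℝ) + 1) / 2 + δ with ha
  have ha' : δ + (k:ℝ) / 2 + 1 = a := by rw [ha]; push_cast; ring
  have hapos : 0 < a := by rw [← ha']; positivity
  set I0 : ℝ := ∫ ξ : En (k+1), ‖(bw (k+1) δ ξ : ℂ)‖
  have hI0 : 0 ≤ I0 := integral_nonneg fun _ => norm_nonneg _
  refine ⟨2 ^ a * (|wt k δ 1| * C + I0 + 1), by positivity, fun x => ?_⟩
  have hx := norm_nonneg x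
  rcases le_or_gt 1 ‖x‖ with h1 | h1
  · rw [brKernel_rad δ (y := EuclideanSpace.single 0 (-‖x‖)) (by simp), brKernel_slice k hδ]
    rw [norm_mul, Complex.norm_real, Real.norm_eq_abs]
    have h2 := h ‖x‖ h1
    rw [ha'] at h2
    have h3 : ‖x‖ ^ (-a) ≤ 2 ^ a * (1 + ‖x‖) ^ (-a) := by
      rw [Real.rpow_neg hx, Real.rpow_neg (by positivity), ← div_eq_mul_inv, inv_eq_one_div,
        div_le_div_iff₀ (by positivity) (by positivity), one_mul, ← Real.mul_rpow (by norm_num) hx]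
      exact Real.rpow_le_rpow (by positivity) (by linarith) hapos.le
    calc _ ≤ |wt k δ 1| * (C * (2 ^ a * (1 + ‖x‖) ^ (-a))) := by
          gcongr
          exact h2.trans (by gcongr)
      _ = 2 ^ a * (|wt k δ 1| * C) * (1 + ‖x‖) ^ (-a) := by ring
      _ ≤ _ := by gcongr; linarith
  · have h2 : ‖brKernel (k+1) δ x‖ ≤ I0 := by
      rw [brKernel_eq]
      exact VectorFourier.norm_fourierIntegral_le_integral_norm _ _ _ _ _
    have h3 : 1 ≤ 2 ^ a * (1 + ‖x‖) ^ (-a) := by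
      rw [Real.rpow_neg (by positivity), ← div_eq_mul_inv, le_div_iff₀ (by positivity), one_mul]
      exact Real.rpow_le_rpow (by positivity) (by linarith) hapos.le
    calc _ ≤ I0 * 1 := by rw [mul_one]; exact h2
      _ ≤ (|wt k δ 1| * C + I0 + 1) * (2 ^ a * (1 + ‖x‖) ^ (-a)) := by
          gcongr
          have : 0 ≤ |wt k δ 1| * C := by positivity
          linarith
      _ = _ := by ring

end Part12

section Part13

open scoped FourierTransform

variable {n : ℕ}

/-- Convolution with the dilated kernel `K_s`. -/
def cv (K : En n → ℂ) (s : ℝ) (h : En n → ℂ) (x : En n) : ℂ :=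
  ∫ y, (s ^ n)⁻¹ • K (s⁻¹ • (x - y)) * h y

lemma fourier_cont {K : En n → ℂ} (hK : Integrable K) : Continuous (𝓕 K) :=
  VectorFourier.fourierIntegral_continuous Real.continuous_fourierChar continuous_inner hK

lemma fourierInv_cont {K : En n → ℂ} (hK : Integrable K) : Continuous (𝓕⁻ K) := by
  rw [Real.fourierInv_eq_fourier_comp_neg]
  exact fourier_cont hK.comp_neg

lemma fourier_bdd (K : En n → ℂ) (ξ : En n) : ‖𝓕 K ξ‖ ≤ ∫ x, ‖K x‖ :=
  VectorFourier.norm_fourierIntegral_le_integral_norm _ _ _ _ _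

lemma fourier_flip {f g : En n → ℂ} (hf : Integrable f) (hg : Integrable g) :
    ∫ ξ, 𝓕 f ξ * g ξ = ∫ x, f x * 𝓕 g x := by
  have := VectorFourier.integral_fourierIntegral_smul_eq_flip (L := innerₗ (En n)) (μ := volume) (ν := volume)
    Real.continuous_fourierChar continuous_inner hf hg
  rw [flip_innerₗ] at this
  exact this

lemma dil_int {K : En n → ℂ} (hK : Integrable K) {s : ℝ} (hs : 0 < s) :
    Integrable (fun y => (s ^ n)⁻¹ • K (s⁻¹ • y)) :=
  (hK.comp_smul (inv_ne_zero hs.ne')).smul ((s ^ n)⁻¹)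

lemma fourier_dil (K : En n → ℂ) {s : ℝ} (hs : 0 < s) (ξ : En n) :
    𝓕 (fun y => (s ^ n)⁻¹ • K (s⁻¹ • y)) ξ = 𝓕 K (s • ξ) := by
  rw [Real.fourier_eq', Real.fourier_eq']
  have := Measure.integral_comp_smul (volume : Measure (En n))
    (fun v => Complex.exp (((-2 * π * inner ℝ v (s • ξ) : ℝ) : ℂ) * Complex.I) • K v) s⁻¹
  simp only [finrank_euclideanSpace, Fintype.card_fin] at this
  rw [abs_of_pos (by positivity)] at this
  have h2 : (((s⁻¹) ^ n)⁻¹ : ℝ) = s ^ n := by simp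
  rw [h2] at this
  rw [← one_smul ℝ (∫ v, Complex.exp (((-2 * π * inner ℝ v (s • ξ) : ℝ) : ℂ) * Complex.I) • K v),
    ← inv_mul_cancel₀ (pow_pos hs n).ne', mul_smul, ← this, ← integral_smul]
  congr 1; funext y
  have : inner ℝ (s⁻¹ • y) (s • ξ) = inner ℝ y ξ := by
    rw [real_inner_smul_left, real_inner_smul_right]; field_simp
  rw [this, smul_comm]

lemma cv_inv {K g : En n → ℂ} (hK : Integrable K) (hg : Integrable g) {s : ℝ} (hs : 0 < s) :
    cv K s (𝓕⁻ g) = 𝓕⁻ (fun ξ => 𝓕 K (s • ξ) * g ξ) := by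
  funext x
  unfold cv
  set D : En n → ℂ := fun y => (s ^ n)⁻¹ • K (s⁻¹ • y) with hD
  have hDi : Integrable D := dil_int hK hs
  have h1 := fourier_flip (hDi.comp_sub_left x) hg.comp_neg
  rw [Real.fourierInv_eq_fourier_comp_neg]
  refine h1.symm.trans ?_
  rw [← integral_neg_eq_self, Real.fourierInv_eq']
  congr 1; funext ξ
  have e : 𝓕 (fun y => D (x - y)) (-ξ) = Complex.exp (((2 * π * inner ℝ ξ x : ℝ) : ℂ) * Complex.I) *
      𝓕 K (s • ξ) := by
    rw [← fourier_dil K hs, ← hD, Real.fourier_eq', Real.fourier_eq', ← integral_const_mul,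
      ← integral_sub_left_eq_self _ volume x]
    congr 1; funext y
    rw [sub_sub_cancel, smul_eq_mul, smul_eq_mul, ← mul_assoc, ← Complex.exp_add]
    congr 2
    rw [inner_neg_right, inner_sub_left, real_inner_comm ξ x]
    push_cast; ring
  rw [e]
  simp only [neg_neg, smul_eq_mul]
  rw [mul_assoc]

lemma mult_int {K g : En n → ℂ} (hK : Integrable K) (hg : Integrable g) (s : ℝ) :
    Integrable (fun ξ => 𝓕 K (s • ξ) * g ξ) := by
  refine hg.bdd_mul (c := ∫ x, ‖K x‖) ?_ (Filter.Eventually.of_forall fun ξ => fourier_bdd K _)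
  exact ((fourier_cont hK).comp (continuous_const_smul s)).aestronglyMeasurable

/-- Polynomial decay. -/
def Dec (a : ℝ) (K : En n → ℂ) (C : ℝ≥0) : Prop := ∀ x, ‖K x‖ ≤ C * (1 + ‖x‖) ^ (-a)

lemma Dec.int {a : ℝ} (ha : (n:ℝ) < a) {K : En n → ℂ} {C : ℝ≥0} (h : Dec a K C) (hc : Continuous K) :
    Integrable K :=
  Integrable.mono' ((integrable_one_add_norm (by simpa using ha)).const_mul (C:ℝ)) hc.aestronglyMeasurable
    (Filter.Eventually.of_forall h)

lemma schwartz_dec (K : SchwartzMap (En n) ℂ) {a : ℝ} (ha : 0 < a) : ∃ C, Dec a (⇑K) C := by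
  obtain ⟨C, hC⟩ : ∃ C : ℝ, ∀ x, (1 + ‖x‖) ^ (⌈a⌉₊) * ‖K x‖ ≤ C := by
    have := fun x => SchwartzMap.one_add_le_sup_seminorm_apply (𝕜 := ℝ) (m := (⌈a⌉₊, 0)) (k := ⌈a⌉₊) (n := 0)
      le_rfl le_rfl K x
    simp only [norm_iteratedFDeriv_zero] at this
    exact ⟨_, this⟩
  have hC0 : 0 ≤ C := le_trans (by positivity) (hC 0)
  refine ⟨C.toNNReal, fun x => ?_⟩
  rw [Real.coe_toNNReal C hC0, Real.rpow_neg (by positivity), ← div_eq_mul_inv, le_div_iff₀ (by positivity), mul_comm]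
  refine le_trans ?_ (hC x)
  gcongr
  rw [← Real.rpow_natCast]
  exact Real.rpow_le_rpow_of_exponent_le (by linarith [norm_nonneg x]) (Nat.le_ceil a)

lemma cv_bound {a : ℝ} {K : En n → ℂ} {C : ℝ≥0} (h : Dec a K C) {s : ℝ} (hs : 0 < s) (f : En n → ℂ) (x : En n) :
    ‖cv K s f x‖ₑ ≤ C * ∫⁻ y, pk a s (x - y) * ‖f y‖ₑ := by
  unfold cv
  refine (enorm_integral_le_lintegral_enorm _).trans ?_
  rw [← lintegral_const_mul' _ _ ENNReal.coe_ne_top]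
  refine lintegral_mono fun y => ?_
  dsimp only
  rw [enorm_mul, ← mul_assoc]
  gcongr
  rw [pk_eq a s hs, ← ofReal_norm, norm_smul, Real.norm_of_nonneg (by positivity),
    ENNReal.ofReal_mul (by positivity), mul_left_comm]
  gcongr
  rw [← ENNReal.ofReal_coe_nnreal, ← ENNReal.ofReal_mul (by positivity)]
  exact ENNReal.ofReal_le_ofReal (h _)

lemma lin_swap {A B W : En n → ℝ≥0∞} (hA : Measurable A) (hB : Measurable B) (hW : Measurable W) {c : ℝ≥0∞}
    {D : En n → ℝ≥0∞} (x : En n) (hD : ∀ v, ∫⁻ u, A (x - u) * B (u - v) ≤ c * D (x - v)) (hc : c ≠ ⊤) :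
    ∫⁻ u, A (x - u) * ∫⁻ v, B (u - v) * W v ≤ c * ∫⁻ v, D (x - v) * W v := by
  calc _ = ∫⁻ u, ∫⁻ v, A (x - u) * (B (u - v) * W v) := by
        congr 1; funext u; rw [lintegral_const_mul _ (by fun_prop)]
    _ = ∫⁻ v, ∫⁻ u, A (x - u) * (B (u - v) * W v) := by
        refine lintegral_lintegral_swap (Measurable.aemeasurable ?_)
        fun_prop
    _ = ∫⁻ v, (∫⁻ u, A (x - u) * B (u - v)) * W v := by
        congr 1; funext v; rw [← lintegral_mul_const _ (by fun_prop)]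
        congr 1; funext u; rw [mul_assoc]
    _ ≤ ∫⁻ v, (c * D (x - v)) * W v := by
        gcongr with v; exact hD v
    _ = _ := by rw [← lintegral_const_mul' _ _ hc]; congr 1; funext v; rw [mul_assoc]

/-- convolution constant -/
def Cc (n : ℕ) (a : ℝ) : ℝ≥0∞ := ENNReal.ofReal (4 ^ a) * (2 * Kc n a)

lemma Cc_ne {a : ℝ} (ha : (n:ℝ) < a) : Cc n a ≠ ⊤ := by
  unfold Cc
  exact ENNReal.mul_ne_top ENNReal.ofReal_ne_top (ENNReal.mul_ne_top (by simp) (Kc_lt_top ha).ne)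

lemma pk_swap {a s t : ℝ} (ha : (n:ℝ) < a) (hs : 0 < s) (hst : s ≤ t) {W : En n → ℝ≥0∞} (hW : Measurable W)
    (x : En n) : ∫⁻ u, pk a s (x - u) * ∫⁻ v, pk a t (u - v) * W v ≤ Cc n a * ∫⁻ v, pk a t (x - v) * W v :=
  lin_swap (pk_meas a s) (pk_meas a t) hW x (fun v => pk_conv ha hs hst x v) (Cc_ne ha)

lemma pk_swap' {a s t : ℝ} (ha : (n:ℝ) < a) (hs : 0 < s) (hst : s ≤ t) {W : En n → ℝ≥0∞} (hW : Measurable W)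
    (x : En n) : ∫⁻ u, pk a t (x - u) * ∫⁻ v, pk a s (u - v) * W v ≤ Cc n a * ∫⁻ v, pk a t (x - v) * W v :=
  lin_swap (pk_meas a t) (pk_meas a s) hW x (fun v => pk_conv' ha hs hst x v) (Cc_ne ha)

end Part13

section Part14

open scoped FourierTransform

variable {n : ℕ}

lemma div_schwartz {h d : En n → ℂ} (hh : ContDiff ℝ (↑(⊤:ℕ∞)) h) (hd : ContDiff ℝ (↑(⊤:ℕ∞)) d)
    (hc : HasCompactSupport h) (hz : ∀ x, d x ≠ 0 ∨ h =ᶠ[nhds x] 0) :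
    ∃ T : SchwartzMap (En n) ℂ, ∀ ξ, 𝓕 (⇑T) ξ * d ξ = h ξ := by
  have h1 : ContDiff ℝ (↑(⊤:ℕ∞)) (fun x => h x * (d x)⁻¹) := by
    rw [contDiff_iff_contDiffAt]
    intro x
    rcases hz x with h0 | h0
    · exact hh.contDiffAt.mul (hd.contDiffAt.inv h0)
    · refine (contDiffAt_const (c := (0:ℂ))).congr_of_eventuallyEq ?_
      filter_upwards [h0] with y hy
      rw [hy]; simp
  have h2 : HasCompactSupport (fun x => h x * (d x)⁻¹) := hc.mul_right
  refine ⟨𝓕⁻ (h2.toSchwartzMap h1), fun ξ => ?_⟩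
  rw [← SchwartzMap.fourier_coe, FourierTransform.fourier_fourierInv_eq]
  change h ξ * (d ξ)⁻¹ * d ξ = h ξ
  rcases hz ξ with h0 | h0
  · field_simp
  · have := h0.self_of_nhds
    rw [this]; simp

lemma kernels (Φ : SchwartzMap (En n) ℂ) (hΦ : (∫ x, Φ x) ≠ 0) (m : ℕ) :
    ∃ (c : ℝ) (χ : En n → ℝ) (T0 T1 K1 : SchwartzMap (En n) ℂ), 0 < c ∧ Continuous χ ∧
      (∀ ξ, |χ ξ| ≤ 1) ∧ (∀ ξ, ‖ξ‖ ≤ c → χ ξ = 1) ∧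
      (∀ ξ, 𝓕 (⇑T0) ξ * 𝓕 (⇑Φ) ξ = χ ξ) ∧
      (∀ ξ, 𝓕 (⇑T1) ξ * (𝓕 (⇑Φ) ξ * (((‖ξ‖ ^ 2) ^ m : ℝ) : ℂ)) = (χ ξ - χ ((2:ℝ) • ξ) : ℂ)) ∧
      (∀ ξ, 𝓕 (⇑K1) ξ = (((‖ξ‖ ^ 2) ^ m : ℝ) : ℂ) * 𝓕 (⇑Φ) ξ) := by
  have hcont : Continuous (𝓕 (⇑Φ)) := fourier_cont Φ.integrable
  have h0 : 𝓕 (⇑Φ) 0 ≠ 0 := by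
    rw [Real.fourier_eq']; simpa using hΦ
  obtain ⟨r, hr, hball⟩ := Metric.eventually_nhds_iff.mp (hcont.continuousAt.eventually_ne h0)
  simp only [dist_zero_right] at hball
  let b : ContDiffBump (0 : En n) := ⟨r/4, r/2, by positivity, by linarith⟩
  have hb1 : ∀ ξ : En n, ‖ξ‖ ≤ r/4 → b ξ = 1 := fun ξ h => b.one_of_mem_closedBall (by simpa using h)
  have hb0 : ∀ ξ : En n, r/2 ≤ ‖ξ‖ → b ξ = 0 := fun ξ h => b.zero_of_le_dist (by simpa using h)
  have hbs : ContDiff ℝ (↑(⊤:ℕ∞)) (fun ξ => (b ξ : ℂ)) := Complex.ofRealCLM.contDiff.comp b.contDiff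
  have hΦs : ContDiff ℝ (↑(⊤:ℕ∞)) (𝓕 (⇑Φ)) := by
    rw [← SchwartzMap.fourier_coe]; exact (𝓕 Φ).smooth ⊤
  have hN : ContDiff ℝ (↑(⊤:ℕ∞)) (fun ξ : En n => (((‖ξ‖ ^ 2) ^ m : ℝ) : ℂ)) :=
    Complex.ofRealCLM.contDiff.comp ((contDiff_norm_sq ℝ).pow m)
  have hopen : IsOpen {ξ : En n | r/2 < ‖ξ‖} := isOpen_lt continuous_const continuous_norm
  obtain ⟨T0, hT0⟩ := div_schwartz hbs hΦs (b.hasCompactSupport.comp_left (g := fun x : ℝ => (x:ℂ)) (by simp)) (by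
    intro x
    rcases lt_or_ge ‖x‖ r with h | h
    · exact Or.inl (hball h)
    · right
      filter_upwards [hopen.mem_nhds (show r/2 < ‖x‖ by linarith)] with y hy
      have hy' : r/2 < ‖y‖ := hy
      simp [hb0 y hy'.le])
  have hdiff : ContDiff ℝ (↑(⊤:ℕ∞)) (fun ξ => ((b ξ : ℂ) - (b ((2:ℝ) • ξ) : ℂ))) :=
    hbs.sub (hbs.comp (contDiff_const_smul (2:ℝ)))
  have hdc : HasCompactSupport (fun ξ => ((b ξ : ℂ) - (b ((2:ℝ) • ξ) : ℂ))) := by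
    refine HasCompactSupport.intro (isCompact_closedBall 0 (r/2)) fun x hx => ?_
    simp only [mem_closedBall_zero_iff, not_le] at hx
    rw [hb0 x hx.le, hb0 ((2:ℝ) • x) (by rw [norm_smul]; norm_num; linarith)]
    simp
  obtain ⟨T1, hT1⟩ := div_schwartz hdiff (hΦs.mul hN) hdc (by
    intro x
    rcases lt_or_ge ‖x‖ (r/8) with h | h
    · right
      have : IsOpen {ξ : En n | ‖ξ‖ < r/8} := isOpen_lt continuous_norm continuous_const
      filter_upwards [this.mem_nhds h] with y hy
      have hy' : ‖y‖ < r/8 := hy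
      rw [hb1 y (by linarith), hb1 ((2:ℝ) • y) (by rw [norm_smul]; norm_num; linarith)]
      simp
    rcases lt_or_ge ‖x‖ r with h' | h'
    · left
      refine mul_ne_zero (hball h') ?_
      have : 0 < ‖x‖ := by linarith
      exact_mod_cast (by positivity : (0:ℝ) < (‖x‖ ^ 2) ^ m).ne'
    · right
      filter_upwards [hopen.mem_nhds (show r/2 < ‖x‖ by linarith)] with y hy
      have hy' : r/2 < ‖y‖ := hy
      rw [hb0 y hy'.le, hb0 ((2:ℝ) • y) (by rw [norm_smul]; norm_num; linarith)]
      simp)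
  have htg : Function.HasTemperateGrowth (fun ξ : En n => (((‖ξ‖ ^ 2) ^ m : ℝ) : ℂ)) := by fun_prop
  refine ⟨r/4, b, T0, T1, 𝓕⁻ (SchwartzMap.smulLeftCLM ℂ (fun ξ : En n => (((‖ξ‖ ^ 2) ^ m : ℝ) : ℂ)) (𝓕 Φ)),
    by positivity, b.continuous, fun ξ => ?_, hb1, hT0, hT1, fun ξ => ?_⟩
  · rw [abs_of_nonneg b.nonneg]; exact b.le_one
  · rw [← SchwartzMap.fourier_coe, FourierTransform.fourier_fourierInv_eq,
      SchwartzMap.smulLeftCLM_apply_apply htg, SchwartzMap.fourier_coe, smul_eq_mul]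

end Part14

section Part15

open scoped FourierTransform

variable {n : ℕ}

/-- `Φ_t * f` written on the Fourier side, `g = 𝓕 f`. -/
def Fam (Φ g : En n → ℂ) (t : ℝ) : En n → ℂ := 𝓕⁻ (fun ξ => 𝓕 Φ (t • ξ) * g ξ)

lemma Fam_cont {Φ g : En n → ℂ} (hΦ : Integrable Φ) (hg : Integrable g) (t : ℝ) : Continuous (Fam Φ g t) :=
  fourierInv_cont (mult_int hΦ hg t)

lemma exp_smul_int {u : En n → ℂ} (hu : Integrable u) (y : En n) :
    Integrable (fun v => Complex.exp (((2 * π * inner ℝ v y : ℝ) : ℂ) * Complex.I) • u v) := by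
  refine hu.bdd_mul (c := 1) ?_ (Filter.Eventually.of_forall fun ξ => ?_)
  · exact (by fun_prop : Continuous _).aestronglyMeasurable
  · rw [Complex.norm_exp_ofReal_mul_I]

lemma fInv_add {u v : En n → ℂ} (hu : Integrable u) (hv : Integrable v) (c : ℂ) (y : En n) :
    𝓕⁻ (fun ξ => u ξ + c * v ξ) y = 𝓕⁻ u y + c * 𝓕⁻ v y := by
  rw [Real.fourierInv_eq', Real.fourierInv_eq', Real.fourierInv_eq', ← integral_const_mul,
    ← integral_add (exp_smul_int hu y) ((exp_smul_int hv y).const_mul c)]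
  congr 1; funext ξ
  simp only [smul_eq_mul]; ring

lemma rep_id {Φ T0 T1 K1 g : En n → ℂ} (hΦ : Integrable Φ) (hT0 : Integrable T0) (hT1 : Integrable T1)
    (hK1 : Integrable K1) (hg : Integrable g) {χ : En n → ℝ} {m : ℕ}
    (h0 : ∀ ξ, 𝓕 T0 ξ * 𝓕 Φ ξ = χ ξ)
    (h1 : ∀ ξ, 𝓕 T1 ξ * (𝓕 Φ ξ * (((‖ξ‖ ^ 2) ^ m : ℝ) : ℂ)) = (χ ξ - χ ((2:ℝ) • ξ) : ℂ))
    (h2 : ∀ ξ, 𝓕 K1 ξ = (((‖ξ‖ ^ 2) ^ m : ℝ) : ℂ) * 𝓕 Φ ξ) {t : ℝ} (ht : 0 < t) (y : En n) (J : ℕ) :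
    Integrable (fun ξ => 𝓕 Φ (t • ξ) * χ ((t / 2 ^ J) • ξ) * g ξ) ∧
    𝓕⁻ (fun ξ => 𝓕 Φ (t • ξ) * χ ((t / 2 ^ J) • ξ) * g ξ) y = cv Φ t (cv T0 t (Fam Φ g t)) y +
      ∑ j ∈ Finset.range J, ((((4:ℝ) ^ m)⁻¹ ^ (j+1) : ℝ) : ℂ) *
        cv K1 t (cv T1 (t / 2 ^ (j+1)) (Fam Φ g (t / 2 ^ (j+1)))) y := by
  induction J with
  | zero =>
    have e : (fun ξ => 𝓕 Φ (t • ξ) * χ ((t / 2 ^ 0) • ξ) * g ξ) =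
        fun ξ => 𝓕 Φ (t • ξ) * (𝓕 T0 (t • ξ) * (𝓕 Φ (t • ξ) * g ξ)) := by
      funext ξ
      rw [pow_zero, div_one, ← h0]; ring
    rw [e]
    have i1 := mult_int hΦ hg t
    have i2 := mult_int hT0 i1 t
    refine ⟨mult_int hΦ i2 t, ?_⟩
    rw [Fam, cv_inv hT0 i1 ht, cv_inv hΦ i2 ht]
    simp
  | succ J ih =>
    obtain ⟨ih1, ih2⟩ := ih
    have hs : 0 < t / 2 ^ (J+1) := by positivity
    have i1 := mult_int hΦ hg (t / 2 ^ (J+1))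
    have i2 := mult_int hT1 i1 (t / 2 ^ (J+1))
    have i3 := mult_int hK1 i2 t
    have e : (fun ξ => 𝓕 Φ (t • ξ) * χ ((t / 2 ^ (J+1)) • ξ) * g ξ) =
        fun ξ => 𝓕 Φ (t • ξ) * χ ((t / 2 ^ J) • ξ) * g ξ + ((((4:ℝ) ^ m)⁻¹ ^ (J+1) : ℝ) : ℂ) *
          (𝓕 K1 (t • ξ) * (𝓕 T1 ((t / 2 ^ (J+1)) • ξ) * (𝓕 Φ ((t / 2 ^ (J+1)) • ξ) * g ξ))) := by
      funext ξ
      have h3 := h1 ((t / 2 ^ (J+1)) • ξ)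
      have h4 : (2:ℝ) • (t / 2 ^ (J+1)) • ξ = (t / 2 ^ J) • ξ := by
        rw [smul_smul]; congr 1; rw [pow_succ]; field_simp
      rw [h4] at h3
      have h5 : (‖(t / 2 ^ (J+1)) • ξ‖ ^ 2) ^ m = ((4:ℝ) ^ m)⁻¹ ^ (J+1) * (‖t • ξ‖ ^ 2) ^ m := by
        rw [norm_smul, norm_smul, Real.norm_of_nonneg hs.le, Real.norm_of_nonneg ht.le]
        rw [div_mul_eq_mul_div, div_pow, div_pow, div_eq_mul_inv, mul_comm]
        congr 1
        rw [inv_pow, ← pow_mul, ← pow_mul, ← pow_mul]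
        congr 1
        rw [show (4:ℝ) = 2 ^ 2 by norm_num, ← pow_mul]
        congr 1; ring
      rw [h5] at h3
      rw [h2]
      push_cast at h3 ⊢
      linear_combination (-(𝓕 Φ (t • ξ) * g ξ)) * h3
    refine ⟨?_, ?_⟩
    · rw [e]; exact ih1.add (i3.const_mul _)
    · rw [e, fInv_add ih1 i3, ih2, Finset.sum_range_succ, Fam, Fam, cv_inv hT1 i1 hs, cv_inv hK1 i2 ht]
      ring

lemma rep_lim {Φ g : En n → ℂ} (hΦ : Integrable Φ) (hg : Integrable g) {χ : En n → ℝ} (hχc : Continuous χ)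
    {c : ℝ} (hc : 0 < c) (hχ1 : ∀ ξ, |χ ξ| ≤ 1) (hχ : ∀ ξ, ‖ξ‖ ≤ c → χ ξ = 1) {t : ℝ} (ht : 0 < t) (y : En n) :
    Filter.Tendsto (fun J : ℕ => 𝓕⁻ (fun ξ => 𝓕 Φ (t • ξ) * χ ((t / 2 ^ J) • ξ) * g ξ) y) Filter.atTop
      (nhds (Fam Φ g t y)) := by
  unfold Fam
  simp only [Real.fourierInv_eq']
  have i1 := mult_int hΦ hg t
  refine tendsto_integral_of_dominated_convergence (fun ξ => ‖𝓕 Φ (t • ξ) * g ξ‖) ?_ i1.norm ?_ ?_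
  · intro J
    refine AEStronglyMeasurable.smul
      (f := fun v : En n => Complex.exp (((2 * π * inner ℝ v y : ℝ) : ℂ) * Complex.I))
      (g := fun ξ => 𝓕 Φ (t • ξ) * χ ((t / 2 ^ J) • ξ) * g ξ) ?_ ?_
    · exact (by fun_prop : Continuous _).aestronglyMeasurable
    · have : (fun ξ => 𝓕 Φ (t • ξ) * χ ((t / 2 ^ J) • ξ) * g ξ) =
        fun ξ => χ ((t / 2 ^ J) • ξ) * (𝓕 Φ (t • ξ) * g ξ) := by funext ξ; ring
      rw [this]
      refine AEStronglyMeasurable.mul ?_ i1.aestronglyMeasurable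
      exact (by fun_prop : Continuous _).aestronglyMeasurable
  · intro J
    refine Filter.Eventually.of_forall fun ξ => ?_
    rw [norm_smul, Complex.norm_exp_ofReal_mul_I, one_mul, mul_right_comm, norm_mul]
    refine mul_le_of_le_one_right (norm_nonneg _) ?_
    rw [Complex.norm_real]; exact hχ1 _
  · refine Filter.Eventually.of_forall fun ξ => ?_
    refine tendsto_const_nhds.congr' ?_
    have h1 : Filter.Tendsto (fun J : ℕ => (1/2:ℝ) ^ J * (t * ‖ξ‖)) Filter.atTop (nhds (0 * (t * ‖ξ‖))) :=
      (tendsto_pow_atTop_nhds_zero_of_lt_one (by norm_num) (by norm_num)).mul_const _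
    rw [zero_mul] at h1
    filter_upwards [h1.eventually_lt_const hc] with J hJ
    rw [hχ]
    · simp
    · rw [norm_smul, Real.norm_of_nonneg (by positivity)]
      refine le_trans (le_of_eq ?_) hJ.le
      rw [one_div, inv_pow]; field_simp

lemma cv_cv_bound {b : ℝ} (hb : (n:ℝ) < b) {K T F : En n → ℂ} {C D : ℝ≥0} (hK : Dec b K C) (hT : Dec b T D)
    (hF : Continuous F) {s t : ℝ} (hs : 0 < s) (hst : s ≤ t) (y : En n) :
    ‖cv K t (cv T s F) y‖ₑ ≤ (C * D * Cc n b) * ∫⁻ w, pk b t (y - w) * ‖F w‖ₑ := by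
  refine (cv_bound hK (hs.trans_le hst) _ _).trans ?_
  calc _ ≤ C * ∫⁻ w, D * (pk b t (y - w) * ∫⁻ v, pk b s (w - v) * ‖F v‖ₑ) := by
        refine mul_le_mul_right (lintegral_mono fun w => ?_) _
        dsimp only
        rw [mul_left_comm]
        exact mul_le_mul_right (cv_bound hT hs _ _) _
    _ = C * (D * ∫⁻ w, (pk b t (y - w) * ∫⁻ v, pk b s (w - v) * ‖F v‖ₑ)) := by
        rw [lintegral_const_mul' _ _ ENNReal.coe_ne_top]
    _ ≤ C * (D * (Cc n b * ∫⁻ w, pk b t (y - w) * ‖F w‖ₑ)) := by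
        gcongr
        exact pk_swap' hb hs hst hF.enorm.measurable y
    _ = _ := by ring

lemma rep_bound (Φ : SchwartzMap (En n) ℂ) (hΦ : (∫ x, Φ x) ≠ 0) (m : ℕ) {b : ℝ} (hb : (n:ℝ) < b) :
    ∃ C : ℝ≥0∞, C < ⊤ ∧ ∀ g : En n → ℂ, Integrable g → ∀ t : ℝ, 0 < t → ∀ y : En n,
      ‖Fam Φ g t y‖ₑ ≤ C * ∑' j : ℕ, ENNReal.ofReal (((4:ℝ) ^ m)⁻¹ ^ j) *
        ∫⁻ w, pk b t (y - w) * ‖Fam Φ g (t / 2 ^ j) w‖ₑ := by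
  obtain ⟨c, χ, T0, T1, K1, hc, hχc, hχ1, hχ, h0, h1, h2⟩ := kernels Φ hΦ m
  have hb0 : 0 < b := lt_of_le_of_lt (Nat.cast_nonneg n) hb
  obtain ⟨CΦ, dΦ⟩ := schwartz_dec Φ hb0
  obtain ⟨C0, d0⟩ := schwartz_dec T0 hb0
  obtain ⟨C1, d1⟩ := schwartz_dec T1 hb0
  obtain ⟨C2, d2⟩ := schwartz_dec K1 hb0
  refine ⟨CΦ * C0 * Cc n b + C2 * C1 * Cc n b, ?_, fun g hg t ht y => ?_⟩
  · have := Cc_ne hb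
    exact ENNReal.add_lt_top.mpr ⟨ENNReal.mul_lt_top (by finiteness) this.lt_top,
      ENNReal.mul_lt_top (by finiteness) this.lt_top⟩
  set B : ℕ → ℝ≥0∞ := fun j => ENNReal.ofReal (((4:ℝ) ^ m)⁻¹ ^ j) *
        ∫⁻ w, pk b t (y - w) * ‖Fam Φ g (t / 2 ^ j) w‖ₑ with hB
  refine le_of_tendsto (rep_lim Φ.integrable hg hχc hc hχ1 hχ ht y).enorm
    (Filter.Eventually.of_forall fun J => ?_)
  rw [(rep_id Φ.integrable T0.integrable T1.integrable K1.integrable hg h0 h1 h2 ht y J).2]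
  have b0 : ‖cv Φ t (cv T0 t (Fam Φ g t)) y‖ₑ ≤ (CΦ * C0 * Cc n b) * B 0 := by
    have := cv_cv_bound hb dΦ d0 (Fam_cont Φ.integrable hg t) ht le_rfl y
    simpa [hB] using this
  have bj : ∀ j, ‖((((4:ℝ) ^ m)⁻¹ ^ (j+1) : ℝ) : ℂ) *
        cv K1 t (cv T1 (t / 2 ^ (j+1)) (Fam Φ g (t / 2 ^ (j+1)))) y‖ₑ ≤ (C2 * C1 * Cc n b) * B (j+1) := by
    intro j
    have := cv_cv_bound hb d2 d1 (Fam_cont Φ.integrable hg (t / 2 ^ (j+1))) (s := t / 2 ^ (j+1)) (t := t)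
      (by positivity) (div_le_self ht.le (one_le_pow₀ (by norm_num))) y
    rw [enorm_mul, hB]
    dsimp only
    rw [mul_left_comm]
    gcongr
    rw [← ofReal_norm, Complex.norm_real, Real.norm_of_nonneg (by positivity)]
  calc _ ≤ (CΦ * C0 * Cc n b) * B 0 + ∑ j ∈ Finset.range J, (C2 * C1 * Cc n b) * B (j+1) := by
        refine (enorm_add_le _ _).trans (add_le_add b0 ?_)
        refine (enorm_sum_le _ _).trans (Finset.sum_le_sum fun j _ => bj j)
    _ ≤ (CΦ * C0 * Cc n b) * (∑' j, B j) + (C2 * C1 * Cc n b) * (∑' j, B j) := by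
        rw [← Finset.mul_sum]
        gcongr
        · exact ENNReal.le_tsum 0
        · calc _ ≤ ∑' j, B (j+1) := ENNReal.sum_le_tsum _
            _ ≤ _ := ENNReal.tsum_comp_le_tsum_of_injective (add_left_injective 1) B
    _ = _ := by rw [add_mul]

end Part15

section Part16

open scoped FourierTransform

variable {n : ℕ}

lemma pk_pt {t : ℝ} (ht : 0 < t) (x w : En n) :
    pk ((n:ℝ) + 1) t (x - w) ≤ ∑' k : ℕ, ENNReal.ofReal ((t ^ n)⁻¹ * ((2 ^ k) ^ (n + 1))⁻¹) *
      (Metric.ball x (2 ^ (k + 1) * t)).indicator 1 w := by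
  have hX : (1:ℝ) ≤ 1 + ‖x - w‖ / t := by
    have : 0 ≤ ‖x - w‖ / t := by positivity
    linarith
  obtain ⟨k, hk1, hk2⟩ := exists_nat_pow_near hX (one_lt_two)
  refine le_trans ?_ (ENNReal.le_tsum k)
  have hw : w ∈ Metric.ball x (2 ^ (k + 1) * t) := by
    rw [Metric.mem_ball, dist_comm, dist_eq_norm]
    have : ‖x - w‖ / t < 2 ^ (k + 1) := by linarith
    rwa [div_lt_iff₀ ht] at this
  rw [indicator_of_mem hw, Pi.one_apply, mul_one, pk]
  apply ENNReal.ofReal_le_ofReal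
  have e : (1 + ‖x - w‖ / t) ^ (-((n:ℝ) + 1)) = ((1 + ‖x - w‖ / t) ^ (n + 1))⁻¹ := by
    rw [Real.rpow_neg (by linarith), ← Real.rpow_natCast]
    push_cast
    rfl
  rw [e]
  gcongr

lemma sum_half : ∑' k : ℕ, ENNReal.ofReal ((2 ^ k : ℝ)⁻¹) = 2 := by
  have : ∀ k : ℕ, ENNReal.ofReal ((2 ^ k : ℝ)⁻¹) = (2⁻¹ : ℝ≥0∞) ^ k := by
    intro k
    rw [ENNReal.ofReal_inv_of_pos (by positivity), ENNReal.ofReal_pow (by norm_num), ENNReal.inv_pow]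
    simp
  simp_rw [this]
  rw [ENNReal.tsum_geometric, ENNReal.one_sub_inv_two, inv_inv]

/-- constant in the domination by the maximal function -/
def CH (n : ℕ) : ℝ≥0∞ := ENNReal.ofReal (2 ^ n) * volume (Metric.ball (0 : En n) 1) * 2

lemma CH_ne : CH n ≠ ⊤ := by
  unfold CH
  exact ENNReal.mul_ne_top (ENNReal.mul_ne_top (by simp) (vol_ball_top _ _)) (by simp)

lemma pk_HLM {t : ℝ} (ht : 0 < t) {W : En n → ℝ≥0∞} (hW : Measurable W) (x : En n) :
    ∫⁻ w, pk ((n:ℝ) + 1) t (x - w) * W w ≤ CH n * HLM W x := by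
  calc ∫⁻ w, pk ((n:ℝ) + 1) t (x - w) * W w
      ≤ ∫⁻ w, ∑' k : ℕ, ENNReal.ofReal ((t ^ n)⁻¹ * ((2 ^ k) ^ (n + 1))⁻¹) *
      (Metric.ball x (2 ^ (k + 1) * t)).indicator W w := by
        refine lintegral_mono fun w => ?_
        dsimp only
        refine (mul_le_mul_left (pk_pt ht x w) _).trans ?_
        rw [← ENNReal.tsum_mul_right]
        refine ENNReal.tsum_le_tsum fun k => ?_
        rw [mul_assoc]
        gcongr
        by_cases h : w ∈ Metric.ball x (2 ^ (k + 1) * t) <;> simp [h]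
    _ = ∑' k : ℕ, ENNReal.ofReal ((t ^ n)⁻¹ * ((2 ^ k) ^ (n + 1))⁻¹) *
      ∫⁻ w in (Metric.ball x (2 ^ (k + 1) * t)), W w := by
        rw [lintegral_tsum]
        · congr 1; funext k
          rw [lintegral_const_mul _ (hW.indicator Metric.isOpen_ball.measurableSet),
            lintegral_indicator Metric.isOpen_ball.measurableSet]
        · intro k
          exact ((hW.indicator Metric.isOpen_ball.measurableSet).const_mul _).aemeasurable
    _ ≤ ∑' k : ℕ, ENNReal.ofReal ((2 ^ k : ℝ)⁻¹) * (ENNReal.ofReal (2 ^ n) * volume (Metric.ball (0 : En n) 1) * HLM W x) := by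
        refine ENNReal.tsum_le_tsum fun k => ?_
        have hr : 0 < 2 ^ (k + 1) * t := by positivity
        rw [← mul_bavg W x hr, vol_ball x hr]
        have h1 := bavg_le_HLM W (x := x) (c := x) (ρ := 2 ^ (k + 1) * t) (by simpa using hr)
        rw [← mul_assoc, ← mul_assoc, ← ENNReal.ofReal_mul (by positivity), ← mul_assoc, ← mul_assoc,
          ← ENNReal.ofReal_mul (by positivity)]
        refine mul_le_mul' (mul_le_mul' (ENNReal.ofReal_le_ofReal (le_of_eq ?_)) le_rfl) h1
        rw [mul_pow, pow_succ 2 k, mul_pow, pow_succ _ n]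
        field_simp
    _ = CH n * HLM W x := by
        rw [ENNReal.tsum_mul_right, sum_half, CH]; ring

def M0 (Φ g : En n → ℂ) (w : En n) : ℝ≥0∞ := ⨆ (t : ℝ) (_ : 0 < t), ‖Fam Φ g t w‖ₑ

def Mss (Φ g : En n → ℂ) (b : ℝ) (x : En n) : ℝ≥0∞ :=
  ⨆ (t : ℝ) (_ : 0 < t) (y : En n), ‖Fam Φ g t y‖ₑ * ENNReal.ofReal ((1 + ‖x - y‖ / t) ^ (-b))

lemma M0_meas {Φ g : En n → ℂ} (hΦ : Integrable Φ) (hg : Integrable g) : Measurable (M0 Φ g) := by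
  have : LowerSemicontinuous (M0 Φ g) := by
    unfold M0
    exact lowerSemicontinuous_iSup fun t => lowerSemicontinuous_iSup fun _ =>
      ((Fam_cont hΦ hg t).enorm).lowerSemicontinuous
  exact this.measurable

lemma le_M0 {Φ g : En n → ℂ} {t : ℝ} (ht : 0 < t) (w : En n) : ‖Fam Φ g t w‖ₑ ≤ M0 Φ g w := by
  unfold M0
  exact le_iSup_of_le t (le_iSup_of_le ht le_rfl)

lemma le_Mss {Φ g : En n → ℂ} {t : ℝ} (ht : 0 < t) (b : ℝ) (x y : En n) :
    ‖Fam Φ g t y‖ₑ ≤ Mss Φ g b x * ENNReal.ofReal ((1 + ‖x - y‖ / t) ^ b) := by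
  have h : ‖Fam Φ g t y‖ₑ * ENNReal.ofReal ((1 + ‖x - y‖ / t) ^ (-b)) ≤ Mss Φ g b x := by
    unfold Mss
    exact le_iSup_of_le t (le_iSup_of_le ht (le_iSup_of_le y le_rfl))
  refine le_trans (le_of_eq ?_) (mul_le_mul_left h _)
  have : 0 < 1 + ‖x - y‖ / t := by positivity
  rw [mul_assoc, ← ENNReal.ofReal_mul (by positivity), Real.rpow_neg this.le,
    inv_mul_cancel₀ (by positivity), ENNReal.ofReal_one, mul_one]

lemma Fam_bdd {Φ g : En n → ℂ} (hg : Integrable g) (t : ℝ) (y : En n) :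
    ‖Fam Φ g t y‖ ≤ (∫ x, ‖Φ x‖) * ∫ x, ‖g x‖ := by
  unfold Fam
  rw [Real.fourierInv_eq_fourier_neg]
  refine (fourier_bdd _ _).trans ?_
  rw [← integral_const_mul]
  refine integral_mono_of_nonneg (Filter.Eventually.of_forall fun _ => norm_nonneg _) (hg.norm.const_mul _)
    (Filter.Eventually.of_forall fun ξ => ?_)
  dsimp only
  rw [norm_mul]
  gcongr
  exact fourier_bdd _ _

lemma Mss_ne_top {Φ g : En n → ℂ} (hg : Integrable g) {b : ℝ} (hb : 0 < b) (x : En n) : Mss Φ g b x ≠ ⊤ := by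
  have : Mss Φ g b x ≤ ENNReal.ofReal ((∫ x, ‖Φ x‖) * ∫ x, ‖g x‖) := by
    unfold Mss
    refine iSup_le fun t => iSup_le fun ht => iSup_le fun y => ?_
    calc _ ≤ ENNReal.ofReal ((∫ x, ‖Φ x‖) * ∫ x, ‖g x‖) * 1 := by
          gcongr
          · rw [← ofReal_norm]
            exact ENNReal.ofReal_le_ofReal (Fam_bdd hg t y)
          · rw [← ENNReal.ofReal_one]
            apply ENNReal.ofReal_le_ofReal
            apply Real.rpow_le_one_of_one_le_of_nonpos _ (by linarith)
            have : 0 ≤ ‖x - y‖ / t := by positivity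
            linarith
      _ = _ := mul_one _
  exact ne_top_of_le_ne_top ENNReal.ofReal_ne_top this

lemma peetre_real {b r t : ℝ} (hr : 0 < r) (hr1 : r < 1) (hb : b = ((n:ℝ) + 1) / r) (ht : 0 < t) (j : ℕ) (x y w : En n) :
    (1 + ‖x - y‖ / t) ^ (-b) * ((t ^ n)⁻¹ * (1 + ‖y - w‖ / t) ^ (-b)) *
      ((1 + ‖x - w‖ / (t / 2 ^ j)) ^ b) ^ (1 - r) ≤
    (2 ^ j) ^ b * ((t ^ n)⁻¹ * (1 + ‖x - w‖ / t) ^ (-((n:ℝ) + 1))) := by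
  have hb0 : 0 < b := by rw [hb]; positivity
  have hbr : b * r = n + 1 := by rw [hb]; field_simp
  set X := 1 + ‖x - y‖ / t with hX
  set Y := 1 + ‖y - w‖ / t with hY
  set Z := 1 + ‖x - w‖ / t with hZ
  have hX0 : 0 < X := by positivity
  have hY0 : 0 < Y := by positivity
  have hZ0 : 0 < Z := by positivity
  have hXYZ : Z ≤ X * Y := by
    have h1 : ‖x - w‖ / t ≤ ‖x - y‖ / t + ‖y - w‖ / t := by
      rw [← add_div]; gcongr; exact norm_sub_le_norm_sub_add_norm_sub _ _ _
    have h2 : 0 ≤ (‖x - y‖ / t) * (‖y - w‖ / t) := by positivity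
    rw [hX, hY, hZ]; nlinarith
  have h2j : (1:ℝ) ≤ 2 ^ j := one_le_pow₀ (by norm_num)
  have hS : 1 + ‖x - w‖ / (t / 2 ^ j) ≤ 2 ^ j * Z := by
    rw [hZ, mul_add, mul_one, div_div_eq_mul_div, mul_comm ‖x - w‖, mul_div_assoc]
    linarith
  have hS0 : 0 < 1 + ‖x - w‖ / (t / 2 ^ j) := by positivity
  have h1 : X ^ (-b) * Y ^ (-b) ≤ Z ^ (-b) := by
    rw [← Real.mul_rpow hX0.le hY0.le]
    exact Real.rpow_le_rpow_of_nonpos hZ0 hXYZ (by linarith)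
  have h2 : ((1 + ‖x - w‖ / (t / 2 ^ j)) ^ b) ^ (1 - r) ≤ (2 ^ j) ^ b * Z ^ (b * (1 - r)) := by
    rw [← Real.rpow_mul hS0.le]
    have hbb : 0 ≤ b * (1 - r) := mul_nonneg hb0.le (by linarith)
    calc _ ≤ (2 ^ j * Z) ^ (b * (1 - r)) := Real.rpow_le_rpow hS0.le hS hbb
      _ = (2 ^ j) ^ (b * (1 - r)) * Z ^ (b * (1 - r)) := Real.mul_rpow (by positivity) hZ0.le
      _ ≤ _ := by
        gcongr
        nlinarith
  calc _ = (X ^ (-b) * Y ^ (-b)) * (t ^ n)⁻¹ * ((1 + ‖x - w‖ / (t / 2 ^ j)) ^ b) ^ (1 - r) := by ring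
    _ ≤ Z ^ (-b) * (t ^ n)⁻¹ * ((2 ^ j) ^ b * Z ^ (b * (1 - r))) := by gcongr
    _ = (2 ^ j) ^ b * ((t ^ n)⁻¹ * (Z ^ (-b) * Z ^ (b * (1 - r)))) := by ring
    _ = _ := by
      rw [← Real.rpow_add hZ0]
      congr 3
      linarith

lemma peetre_pt {Φ g : En n → ℂ} {b r t : ℝ} (hr : 0 < r) (hr1 : r < 1) (hb : b = ((n:ℝ) + 1) / r) (ht : 0 < t) (j : ℕ) (x y w : En n) :
    ENNReal.ofReal ((1 + ‖x - y‖ / t) ^ (-b)) * (pk b t (y - w) * ‖Fam Φ g (t / 2 ^ j) w‖ₑ) ≤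
      ENNReal.ofReal ((2 ^ j) ^ b) * (Mss Φ g b x) ^ (1 - r) * (pk ((n:ℝ) + 1) t (x - w) * (M0 Φ g w) ^ r) := by
  have hs : 0 < t / 2 ^ j := by positivity
  have hF : ‖Fam Φ g (t / 2 ^ j) w‖ₑ ≤ (M0 Φ g w) ^ r * ((Mss Φ g b x) ^ (1 - r) *
      ENNReal.ofReal (((1 + ‖x - w‖ / (t / 2 ^ j)) ^ b) ^ (1 - r))) := by
    rw [← ENNReal.ofReal_rpow_of_nonneg (by positivity) (by linarith), ← ENNReal.mul_rpow_of_nonneg _ _ (by linarith)]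
    calc ‖Fam Φ g (t / 2 ^ j) w‖ₑ = ‖Fam Φ g (t / 2 ^ j) w‖ₑ ^ (r + (1 - r)) := by simp
      _ = ‖Fam Φ g (t / 2 ^ j) w‖ₑ ^ r * ‖Fam Φ g (t / 2 ^ j) w‖ₑ ^ (1 - r) :=
        ENNReal.rpow_add_of_nonneg _ _ hr.le (by linarith)
      _ ≤ _ := by
        gcongr
        · exact le_M0 hs w
        · exact le_Mss hs b x w
  refine (mul_le_mul_right (mul_le_mul_right hF _) _).trans ?_
  simp only [pk]
  have := ENNReal.ofReal_le_ofReal (peetre_real (n := n) hr hr1 hb ht j x y w)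
  rw [ENNReal.ofReal_mul (by positivity), ENNReal.ofReal_mul (by positivity), ENNReal.ofReal_mul (p := (2 ^ j) ^ b) (by positivity)] at this
  calc _ = _ * (M0 Φ g w ^ r * Mss Φ g b x ^ (1 - r)) := by rw [show ∀ a b c d e : ℝ≥0∞, a * (b * (c * (d * e))) = a * b * e * (c * d) by intros; ring]
    _ ≤ _ := mul_le_mul_left this _
    _ = _ := by ring

theorem peetre (Φ : SchwartzMap (En n) ℂ) (hΦ : (∫ x, Φ x) ≠ 0) {r : ℝ} (hr : 0 < r) (hr1 : r < 1) :
    ∃ C : ℝ≥0∞, C < ⊤ ∧ ∀ g : En n → ℂ, Integrable g → ∀ x : En n,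
      Mss Φ g (((n:ℝ) + 1) / r) x ≤ (C * HLM (fun w => (M0 Φ g w) ^ r) x) ^ (r⁻¹) := by
  obtain ⟨b, hb⟩ : ∃ b, b = ((n:ℝ) + 1) / r := ⟨_, rfl⟩
  have hb0 : 0 < b := by rw [hb]; positivity
  have hbn : (n:ℝ) < b := by
    rw [hb, lt_div_iff₀ hr]; nlinarith [Nat.cast_nonneg (α := ℝ) n]
  obtain ⟨m, hm⟩ := exists_nat_ge (b + 1)
  obtain ⟨C, hC, hrep⟩ := rep_bound Φ hΦ m hbn
  rw [← hb]
  refine ⟨C * (2 * CH n), ENNReal.mul_lt_top hC (ENNReal.mul_lt_top (by simp) CH_ne.lt_top), fun g hg x => ?_⟩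
  have hMm := M0_meas Φ.integrable hg
  have hcoef : ∀ j : ℕ, (((4:ℝ) ^ m)⁻¹ ^ j) * (2 ^ j) ^ b ≤ (2 ^ j)⁻¹ := by
    intro j
    have e1 : ((2:ℝ) ^ j) ^ b = (2 ^ b) ^ j := by
      rw [← Real.rpow_natCast, ← Real.rpow_natCast, ← Real.rpow_mul (by norm_num), ← Real.rpow_mul (by norm_num), mul_comm]
    rw [e1, ← mul_pow, ← inv_pow 2 j]
    apply pow_le_pow_left₀ (by positivity)
    have h4 : (2:ℝ) ^ b * 2 ≤ 4 ^ m := by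
      calc (2:ℝ) ^ b * 2 = 2 ^ (b + 1) := by rw [Real.rpow_add (by norm_num), Real.rpow_one]
        _ ≤ 2 ^ (m:ℝ) := Real.rpow_le_rpow_of_exponent_le (by norm_num) hm
        _ = 2 ^ m := Real.rpow_natCast _ _
        _ ≤ 4 ^ m := by gcongr; norm_num
    rw [inv_mul_le_iff₀ (by positivity)]
    linarith
  set H := HLM (fun w => (M0 Φ g w) ^ r) x with hH
  set S := Mss Φ g b x with hS
  have key : S ≤ C * (2 * CH n) * H * S ^ (1 - r) := by
    conv_lhs => rw [hS]; unfold Mss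
    refine iSup_le fun t => iSup_le fun ht => iSup_le fun y => ?_
    rw [mul_comm]
    refine (mul_le_mul_right (hrep g hg t ht y) _).trans ?_
    rw [mul_left_comm, ← ENNReal.tsum_mul_left]
    have hj : ∀ j : ℕ, ENNReal.ofReal ((1 + ‖x - y‖ / t) ^ (-b)) * (ENNReal.ofReal (((4:ℝ) ^ m)⁻¹ ^ j) *
        ∫⁻ w, pk b t (y - w) * ‖Fam Φ g (t / 2 ^ j) w‖ₑ) ≤ ENNReal.ofReal ((2 ^ j)⁻¹) * (S ^ (1 - r) * (CH n * H)) := by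
      intro j
      rw [mul_left_comm, ← lintegral_const_mul' _ _ ENNReal.ofReal_ne_top]
      calc _ ≤ ENNReal.ofReal (((4:ℝ) ^ m)⁻¹ ^ j) * ∫⁻ w, ENNReal.ofReal ((2 ^ j) ^ b) * S ^ (1 - r) * (pk ((n:ℝ) + 1) t (x - w) * (M0 Φ g w) ^ r) := by
            refine mul_le_mul_right (lintegral_mono fun w => ?_) _
            exact peetre_pt hr hr1 hb ht j x y w
        _ = ENNReal.ofReal (((4:ℝ) ^ m)⁻¹ ^ j) * (ENNReal.ofReal ((2 ^ j) ^ b) * S ^ (1 - r) * ∫⁻ w, (pk ((n:ℝ) + 1) t (x - w) * (M0 Φ g w) ^ r)) := by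
            rw [lintegral_const_mul]
            exact ((pk_meas _ _).comp (measurable_const.sub measurable_id)).mul (hMm.pow_const r)
        _ ≤ ENNReal.ofReal (((4:ℝ) ^ m)⁻¹ ^ j) * (ENNReal.ofReal ((2 ^ j) ^ b) * S ^ (1 - r) * (CH n * H)) := by
            gcongr
            exact pk_HLM ht (hMm.pow_const r) x
        _ = ENNReal.ofReal ((((4:ℝ) ^ m)⁻¹ ^ j) * (2 ^ j) ^ b) * (S ^ (1 - r) * (CH n * H)) := by
            rw [ENNReal.ofReal_mul (by positivity)]; ring
        _ ≤ _ := by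
            gcongr
            exact hcoef j
    calc _ ≤ C * ∑' j : ℕ, ENNReal.ofReal ((2 ^ j)⁻¹) * (S ^ (1 - r) * (CH n * H)) := by
          exact mul_le_mul_right (ENNReal.tsum_le_tsum hj) _
      _ = _ := by rw [ENNReal.tsum_mul_right, sum_half]; ring
  have hSt : S ≠ ⊤ := Mss_ne_top hg hb0 x
  rw [ENNReal.le_rpow_inv_iff hr]
  rcases eq_or_ne S 0 with h0 | h0
  · rw [h0, ENNReal.zero_rpow_of_pos hr]; exact zero_le
  have hP0 : S ^ (1 - r) ≠ 0 := by
    simp [ENNReal.rpow_eq_zero_iff, h0, hSt]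
  have hPt : S ^ (1 - r) ≠ ⊤ := ENNReal.rpow_ne_top_of_nonneg (by linarith) hSt
  have e : S = S ^ r * S ^ (1 - r) := by
    rw [← ENNReal.rpow_add_of_nonneg _ _ hr.le (by linarith)]; simp
  have key2 : S ^ r * S ^ (1 - r) ≤ C * (2 * CH n) * H * S ^ (1 - r) := by rw [← e]; exact key
  exact (ENNReal.mul_le_mul_iff_left hP0 hPt).1 key2

end Part16

section Part17

open scoped FourierTransform

variable {n : ℕ}

lemma Fam_Vs {Φ g : En n → ℂ} {b : ℝ} (hb : 0 < b) {G : En n → ℝ≥0∞} (hc : ∀ j, (Om G j)ᶜ.Nonempty)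
    (hG : ∀ x, Mss Φ g b x ≤ G x) {s t R : ℝ} (ht : 0 < t) (hR : 0 ≤ R) (u z : En n)
    (h : ∀ y, dist y z < s → ‖y - u‖ ≤ R * t) :
    ‖Fam Φ g t u‖ₑ ≤ ENNReal.ofReal ((1 + R) ^ b) * Vs G s z := by
  have hD0 : ENNReal.ofReal ((1 + R) ^ b) ≠ 0 := by
    have : 0 < (1 + R) ^ b := by positivity
    simpa using this
  have := le_Vs hc (s := s) z (‖Fam Φ g t u‖ₑ / ENNReal.ofReal ((1 + R) ^ b)) ?_
  · rw [ENNReal.div_le_iff hD0 ENNReal.ofReal_ne_top] at this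
    rwa [mul_comm] at this
  · intro y hy
    rw [ENNReal.div_le_iff hD0 ENNReal.ofReal_ne_top]
    refine (le_Mss ht b y u).trans ?_
    refine mul_le_mul' (hG y) (ENNReal.ofReal_le_ofReal ?_)
    refine Real.rpow_le_rpow (by positivity) ?_ hb.le
    have : ‖y - u‖ / t ≤ R := by rw [div_le_iff₀ ht]; exact h y hy
    linarith

/-- averaging constant -/
def Cb (n : ℕ) (a b : ℝ) : ℝ≥0∞ :=
  ENNReal.ofReal ((1 + 2) ^ b) * (ENNReal.ofReal (2 ^ (-a)) * volume (Metric.ball (0 : En n) 1))⁻¹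

lemma Cb_ne (a b : ℝ) : Cb n a b ≠ ⊤ := by
  unfold Cb
  refine ENNReal.mul_ne_top ENNReal.ofReal_ne_top (ENNReal.inv_ne_top.2 (mul_ne_zero ?_ (vol_ball_pos _ one_pos)))
  have : (0:ℝ) < 2 ^ (-a) := by positivity
  simpa using this

lemma Fam_avg {Φ g : En n → ℂ} {a b : ℝ} (ha : 0 < a) (hb : 0 < b) {G : En n → ℝ≥0∞} (hc : ∀ j, (Om G j)ᶜ.Nonempty)
    (hG : ∀ x, Mss Φ g b x ≤ G x) {t : ℝ} (ht : 0 < t) (u : En n) :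
    ‖Fam Φ g t u‖ₑ ≤ Cb n a b * ∫⁻ v, pk a t (u - v) * Vs G t v := by
  set F := ‖Fam Φ g t u‖ₑ with hF
  set D := ENNReal.ofReal ((1 + 2) ^ b) with hD
  have h1 : ∀ v ∈ Metric.ball u t, F ≤ D * Vs G t v := by
    intro v hv
    refine Fam_Vs hb hc hG ht (by norm_num) u v fun y hy => ?_
    rw [← dist_eq_norm]
    have := dist_triangle y v u
    rw [Metric.mem_ball] at hv
    linarith
  have h2 : ∀ v ∈ Metric.ball u t, ENNReal.ofReal ((t ^ n)⁻¹ * 2 ^ (-a)) ≤ pk a t (u - v) := by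
    intro v hv
    rw [Metric.mem_ball, dist_comm, dist_eq_norm] at hv
    unfold pk
    apply ENNReal.ofReal_le_ofReal
    refine mul_le_mul_of_nonneg_left ?_ (by positivity)
    refine Real.rpow_le_rpow_of_nonpos (by positivity) ?_ (by linarith)
    have : ‖u - v‖ / t ≤ 1 := by rw [div_le_one ht]; exact hv.le
    linarith
  set W := ENNReal.ofReal (2 ^ (-a)) * volume (Metric.ball (0 : En n) 1) with hW
  have hW0 : W ≠ 0 := by
    refine mul_ne_zero ?_ (vol_ball_pos _ one_pos)
    have : (0:ℝ) < 2 ^ (-a) := by positivity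
    simpa using this
  have hWt : W ≠ ⊤ := ENNReal.mul_ne_top ENNReal.ofReal_ne_top (vol_ball_top _ _)
  have h3 : F * W ≤ D * ∫⁻ v, pk a t (u - v) * Vs G t v := by
    rw [← lintegral_const_mul' _ _ ENNReal.ofReal_ne_top]
    calc F * W = ∫⁻ v in Metric.ball u t, ENNReal.ofReal ((t ^ n)⁻¹ * 2 ^ (-a)) * F := by
          rw [setLIntegral_const, vol_ball u ht, hW]
          have : ENNReal.ofReal ((t ^ n)⁻¹ * 2 ^ (-a)) * ENNReal.ofReal (t ^ n) = ENNReal.ofReal (2 ^ (-a)) := by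
            rw [← ENNReal.ofReal_mul (by positivity)]
            congr 1; field_simp
          rw [← this]; ring
      _ ≤ ∫⁻ v in Metric.ball u t, D * (pk a t (u - v) * Vs G t v) := by
          refine setLIntegral_mono' Metric.isOpen_ball.measurableSet fun v hv => ?_
          refine (mul_le_mul' (h2 v hv) (h1 v hv)).trans (le_of_eq (by ring))
      _ ≤ _ := setLIntegral_le_lintegral _ _
  calc F = F * W * W⁻¹ := by rw [mul_assoc, ENNReal.mul_inv_cancel hW0 hWt, mul_one]
    _ ≤ (D * ∫⁻ v, pk a t (u - v) * Vs G t v) * W⁻¹ := mul_le_mul_left h3 _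
    _ = _ := by rw [Cb, ← hW, ← hD]; ring

theorem key_bound (Φ : SchwartzMap (En n) ℂ) (hΦ : (∫ x, Φ x) ≠ 0) {a b : ℝ} (ha : (n:ℝ) < a) (hb : 0 < b)
    {K : En n → ℂ} {CK : ℝ≥0} (hKd : Dec a K CK) (hKc : Continuous K) (hK0 : ∀ ξ, 1 ≤ ‖ξ‖ → 𝓕 K ξ = 0) :
    ∃ C : ℝ≥0∞, C < ⊤ ∧ ∀ g : En n → ℂ, Integrable g → ∀ G : En n → ℝ≥0∞, (∀ j, (Om G j)ᶜ.Nonempty) →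
      (∀ x, Mss Φ g b x ≤ G x) → ∀ ε, 0 < ε → ∀ t, 0 < t → ∀ x, ∃ s, 0 < s ∧
      ‖cv Φ t (cv K ε (𝓕⁻ g)) x‖ₑ ≤ C * ∫⁻ u, pk a s (x - u) * Vs G s u := by
  have ha0 : 0 < a := lt_of_le_of_lt (Nat.cast_nonneg n) ha
  obtain ⟨c, χ, T0, -, -, hc0, hχc, hχ1, hχ, h0, -, -⟩ := kernels Φ hΦ 0
  obtain ⟨CΦ, dΦ⟩ := schwartz_dec Φ ha0
  obtain ⟨C0, d0⟩ := schwartz_dec T0 ha0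
  have hKi := hKd.int ha hKc
  set κ := ENNReal.ofReal ((c ^ n)⁻¹ * (1 + c) ^ a) with hκ
  set D := ENNReal.ofReal ((1 + c⁻¹) ^ b) with hD
  have hCc := (Cc_ne (n := n) ha).lt_top
  refine ⟨CK * (Cb n a b * Cc n a) + CΦ * (CK * (C0 * (κ * D) * Cc n a) * Cc n a), ?_, ?_⟩
  · have h1 := (Cb_ne (n := n) a b).lt_top
    have hκt : κ < ⊤ := ENNReal.ofReal_lt_top
    have hDt : D < ⊤ := ENNReal.ofReal_lt_top
    refine ENNReal.add_lt_top.2 ⟨ENNReal.mul_lt_top ENNReal.coe_lt_top (ENNReal.mul_lt_top h1 hCc), ?_⟩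
    exact ENNReal.mul_lt_top ENNReal.coe_lt_top (ENNReal.mul_lt_top (ENNReal.mul_lt_top ENNReal.coe_lt_top
      (ENNReal.mul_lt_top (ENNReal.mul_lt_top ENNReal.coe_lt_top (ENNReal.mul_lt_top hκt hDt)) hCc)) hCc)
  intro g hg G hc hG ε hε t ht x
  have hΦi : Integrable (⇑Φ) := Φ.integrable
  have e1 : cv Φ t (cv K ε (𝓕⁻ g)) = 𝓕⁻ (fun ξ => 𝓕 (⇑Φ) (t • ξ) * (𝓕 K (ε • ξ) * g ξ)) := by
    rw [cv_inv hKi hg hε, cv_inv hΦi (mult_int hKi hg ε) ht]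
  rcases le_or_gt ε t with hεt | hεt
  · refine ⟨t, ht, ?_⟩
    have e2 : cv Φ t (cv K ε (𝓕⁻ g)) = cv K ε (Fam Φ g t) := by
      rw [e1, Fam, cv_inv hKi (mult_int hΦi hg t) hε]
      congr 1; funext ξ; ring
    rw [e2]
    calc _ ≤ CK * ∫⁻ y, pk a ε (x - y) * ‖Fam Φ g t y‖ₑ := cv_bound hKd hε _ x
      _ ≤ CK * ∫⁻ y, Cb n a b * (pk a ε (x - y) * ∫⁻ v, pk a t (y - v) * Vs G t v) := by
          refine mul_le_mul_right (lintegral_mono fun y => ?_) _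
          dsimp only
          rw [mul_left_comm]
          exact mul_le_mul_right (Fam_avg ha0 hb hc hG ht y) _
      _ = CK * (Cb n a b * ∫⁻ y, (pk a ε (x - y) * ∫⁻ v, pk a t (y - v) * Vs G t v)) := by
          rw [lintegral_const_mul' _ _ (Cb_ne a b)]
      _ ≤ CK * (Cb n a b * (Cc n a * ∫⁻ v, pk a t (x - v) * Vs G t v)) := by
          gcongr
          exact pk_swap ha hε hεt (Vs_meas G t) x
      _ = (CK * (Cb n a b * Cc n a)) * ∫⁻ v, pk a t (x - v) * Vs G t v := by ring
      _ ≤ _ := by gcongr; exact le_self_add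
  · refine ⟨ε, hε, ?_⟩
    have hcε : 0 < c * ε := by positivity
    have e2 : cv Φ t (cv K ε (𝓕⁻ g)) = cv Φ t (cv K ε (cv T0 (c * ε) (Fam Φ g (c * ε)))) := by
      have i1 := mult_int hΦi hg (c * ε)
      have i2 := mult_int T0.integrable i1 (c * ε)
      rw [e1, Fam, cv_inv T0.integrable i1 hcε, cv_inv hKi i2 hε, cv_inv hΦi (mult_int hKi i2 ε) ht]
      congr 1; funext ξ
      congr 1
      rcases le_or_gt 1 ‖ε • ξ‖ with h | h
      · rw [hK0 _ h, zero_mul, zero_mul]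
      · have h5 : ‖(c * ε) • ξ‖ ≤ c := by
          rw [mul_smul, norm_smul, Real.norm_of_nonneg hc0.le]
          nlinarith
        rw [← mul_assoc (𝓕 (⇑T0) _), h0, hχ _ h5]
        simp
    rw [e2]
    set V := fun y : En n => ∫⁻ v, pk a ε (y - v) * Vs G ε v with hV
    have b1 : ∀ y, ‖cv T0 (c * ε) (Fam Φ g (c * ε)) y‖ₑ ≤ C0 * (κ * D) * V y := by
      intro y
      calc _ ≤ C0 * ∫⁻ v, pk a (c * ε) (y - v) * ‖Fam Φ g (c * ε) v‖ₑ := cv_bound d0 hcε _ y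
        _ ≤ C0 * ∫⁻ v, (κ * D) * (pk a ε (y - v) * Vs G ε v) := by
            refine mul_le_mul_right (lintegral_mono fun v => ?_) _
            refine (mul_le_mul' (pk_scale ha0 hc0 hε (y - v)) (Fam_Vs (R := c⁻¹) hb hc hG hcε (by positivity) v v (s := ε) ?_)).trans
              (le_of_eq (by ring))
            intro z hz
            rw [← dist_eq_norm, inv_mul_cancel_left₀ hc0.ne']
            exact hz.le
        _ = _ := by rw [lintegral_const_mul' _ _ (ENNReal.mul_ne_top ENNReal.ofReal_ne_top ENNReal.ofReal_ne_top)]; ring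
    have hk : C0 * (κ * D) ≠ ⊤ := ENNReal.mul_ne_top ENNReal.coe_ne_top (ENNReal.mul_ne_top ENNReal.ofReal_ne_top ENNReal.ofReal_ne_top)
    have b2 : ∀ y, ‖cv K ε (cv T0 (c * ε) (Fam Φ g (c * ε))) y‖ₑ ≤ CK * (C0 * (κ * D) * Cc n a) * V y := by
      intro y
      calc _ ≤ CK * ∫⁻ v, pk a ε (y - v) * ‖cv T0 (c * ε) (Fam Φ g (c * ε)) v‖ₑ := cv_bound hKd hε _ y
        _ ≤ CK * ∫⁻ v, (C0 * (κ * D)) * (pk a ε (y - v) * V v) := by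
            refine mul_le_mul_right (lintegral_mono fun v => ?_) _
            dsimp only
            rw [mul_left_comm]
            exact mul_le_mul_right (b1 v) _
        _ = CK * ((C0 * (κ * D)) * ∫⁻ v, (pk a ε (y - v) * V v)) := by rw [lintegral_const_mul' _ _ hk]
        _ ≤ CK * ((C0 * (κ * D)) * (Cc n a * V y)) := by
            refine mul_le_mul_right (mul_le_mul_right ?_ _) _
            exact pk_swap ha hε le_rfl (Vs_meas G ε) y
        _ = _ := by ring
    have hk2 : CK * (C0 * (κ * D) * Cc n a) ≠ ⊤ := ENNReal.mul_ne_top ENNReal.coe_ne_top (ENNReal.mul_ne_top hk hCc.ne)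
    calc _ ≤ CΦ * ∫⁻ v, pk a t (x - v) * ‖cv K ε (cv T0 (c * ε) (Fam Φ g (c * ε))) v‖ₑ := cv_bound dΦ ht _ x
      _ ≤ CΦ * ∫⁻ v, (CK * (C0 * (κ * D) * Cc n a)) * (pk a t (x - v) * V v) := by
            refine mul_le_mul_right (lintegral_mono fun v => ?_) _
            dsimp only
            rw [mul_left_comm]
            exact mul_le_mul_right (b2 v) _
      _ = CΦ * ((CK * (C0 * (κ * D) * Cc n a)) * ∫⁻ v, (pk a t (x - v) * V v)) := by rw [lintegral_const_mul' _ _ hk2]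
      _ ≤ CΦ * ((CK * (C0 * (κ * D) * Cc n a)) * (Cc n a * V x)) := by
            refine mul_le_mul_right (mul_le_mul_right ?_ _) _
            exact pk_swap ha ht hεt.le (Vs_meas G ε) x
      _ = (CΦ * (CK * (C0 * (κ * D) * Cc n a) * Cc n a)) * V x := by ring
      _ ≤ _ := by gcongr; exact le_add_self

end Part17

section Part18

open scoped FourierTransform

variable {n : ℕ}

lemma lt_of_log {C η R : ℝ} (hC : 0 < C) (hη : 0 < η) (hR : Real.exp (C / η) ≤ R) :
    C / Real.log (Real.exp 1 + R) < η := by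
  have he := Real.exp_pos (C / η)
  have h1 : C / η < Real.log (Real.exp 1 + R) := by
    rw [Real.lt_log_iff_exp_lt (by linarith [Real.exp_pos 1])]
    have := Real.exp_pos 1
    linarith
  have h2 : 0 < C / η := by positivity
  rw [div_lt_iff₀ (h2.trans h1)]
  rw [div_lt_iff₀ hη] at h1
  linarith

lemma mkLH (hn : 1 ≤ n) {p : En n → ℝ} (hpm : Measurable p) (hp : ∀ x, 0 < p x ∧ p x ≤ 1)
    {C pinf p0 : ℝ} (hC : 0 < C)
    (hloc : ∀ x y : En n, x ≠ y → |p x - p y| ≤ C / Real.log (Real.exp 1 + 1 / ‖x - y‖))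
    (hinf : ∀ x : En n, |p x - pinf| ≤ C / Real.log (Real.exp 1 + ‖x‖))
    (hp0 : 0 < p0) (hlow : p0 ≤ essInf p volume) : LH n p p0 1 C pinf := by
  have hlo : ∀ x, p0 ≤ p x := by
    intro x
    by_contra hx
    push Not at hx
    have hae : ∀ᵐ y ∂(volume : Measure (En n)), p0 ≤ p y := by
      have hb : Filter.IsBoundedUnder (· ≥ ·) (ae (volume : Measure (En n))) p :=
        ⟨0, by simp only [Filter.eventually_map]; exact Filter.Eventually.of_forall fun y => (hp y).1.le⟩
      filter_upwards [ae_essInf_le hb] with y hy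
      exact hlow.trans hy
    have hη : 0 < p0 - p x := by linarith
    set ρ := Real.exp (-(C / (p0 - p x))) with hρ
    have hρ0 : 0 < ρ := Real.exp_pos _
    have hd : Dense {y | p0 ≤ p y} := Measure.dense_of_ae hae
    obtain ⟨y, hy1, hy2⟩ := hd.exists_dist_lt x hρ0
    have hy1' : p0 ≤ p y := hy1
    have hne : x ≠ y := by rintro rfl; linarith
    have hpos : 0 < ‖x - y‖ := norm_pos_iff.2 (sub_ne_zero.2 hne)
    rw [dist_eq_norm] at hy2
    have h1 := hloc x y hne
    have h2 : C / Real.log (Real.exp 1 + 1 / ‖x - y‖) < p0 - p x := by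
      apply lt_of_log hC hη
      rw [le_div_iff₀ hpos]
      calc _ ≤ Real.exp (C / (p0 - p x)) * ρ := by gcongr
        _ = 1 := by rw [hρ, ← Real.exp_add]; simp
    have := (abs_le.1 h1).1
    linarith
  have hfar : ∀ η, 0 < η → ∃ x, |p x - pinf| < η := by
    intro η hη
    refine ⟨EuclideanSpace.single ⟨0, hn⟩ (Real.exp (C / η)), (hinf _).trans_lt (lt_of_log hC hη ?_)⟩
    rw [PiLp.norm_single, Real.norm_of_nonneg (Real.exp_pos _).le]
  refine ⟨hpm, hp0, hlo, fun x => (hp x).2, hC, hloc, hinf, ?_, ?_⟩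
  · by_contra h
    push Not at h
    obtain ⟨x, hx⟩ := hfar (p0 - pinf) (by linarith)
    have := (abs_lt.1 hx).2
    have := hlo x
    linarith
  · by_contra h
    push Not at h
    obtain ⟨x, hx⟩ := hfar (pinf - 1) (by linarith)
    have := (abs_lt.1 hx).1
    have := (hp x).2
    linarith

lemma brKernel_F0 {δ : ℝ} (hδ : 0 < δ) (hi : Integrable (brKernel n δ)) (ξ : En n) (hξ : 1 ≤ ‖ξ‖) :
    𝓕 (brKernel n δ) ξ = 0 := by
  have e : brKernel n δ = 𝓕 (fun ξ : En n => (bw n δ ξ : ℂ)) := by funext x; exact brKernel_eq δ x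
  have hB : Integrable (fun ξ : En n => (bw n δ ξ : ℂ)) := bw_int hδ
  have hc : Continuous (fun ξ : En n => (bw n δ ξ : ℂ)) := Complex.continuous_ofReal.comp (bw_cont hδ)
  rw [e] at hi ⊢
  have h := hc.fourierInv_fourier_eq hB hi
  have h2 := congrFun h (-ξ)
  rw [Real.fourierInv_eq_fourier_neg, neg_neg] at h2
  rw [h2, bw_zero hδ (by rwa [norm_neg])]
  simp

lemma brMeans_eq (δ ε : ℝ) (f : En n → ℂ) : brMeans n δ ε f = cv (brKernel n δ) ε f := by
  funext x
  unfold brMeans cv brKernelDil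
  congr 1; funext y
  rw [mul_comm]

lemma radMax_eq (Φ h : En n → ℂ) (x : En n) :
    radMax n Φ h x = ⨆ (t : ℝ) (_ : 0 < t), ‖cv Φ t h x‖ₑ := rfl

lemma radMax_M0 {Φ g : En n → ℂ} (hΦ : Integrable Φ) (hg : Integrable g) : radMax n Φ (𝓕⁻ g) = M0 Φ g := by
  funext x
  rw [radMax_eq]
  unfold M0
  refine iSup_congr fun t => iSup_congr fun ht => ?_
  rw [cv_inv hΦ hg ht]
  rfl

lemma cv_smul (K h : En n → ℂ) (s : ℝ) (c : ℂ) : cv K s (fun y => c * h y) = fun x => c * cv K s h x := by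
  funext x
  unfold cv
  rw [← integral_const_mul]
  congr 1; funext y; ring

lemma radMax_smul (Φ h : En n → ℂ) (c : ℂ) (x : En n) :
    radMax n Φ (fun y => c * h y) x = ‖c‖ₑ * radMax n Φ h x := by
  rw [radMax_eq, radMax_eq]
  simp only [cv_smul, enorm_mul, ENNReal.mul_iSup]

theorem core (hn : 1 ≤ n) {δ : ℝ} (hδ : ((n : ℝ) - 1) / 2 < δ) {p : En n → ℝ} {C0 pinf : ℝ}
    (hL : LH n p (2 * (n : ℝ) / ((n : ℝ) + 1 + 2 * δ)) 1 C0 pinf)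
    (Φ : SchwartzMap (En n) ℂ) (hΦ : (∫ x, Φ x) ≠ 0) :
    ∃ K C1 : ℝ≥0∞, K < ⊤ ∧ C1 < ⊤ ∧ ∀ f : SchwartzMap (En n) ℂ, ∫⁻ x, (radMax n Φ f x) ^ (p x) ≤ 1 →
      ∀ ε, 0 < ε → ∀ β : ℝ, 0 < β → ∃ E : Set (En n), MeasurableSet E ∧
        (∀ x, C1 * ENNReal.ofReal β < radMax n Φ (brMeans n δ ε f) x → x ∈ E) ∧
        ∫⁻ x in E, (ENNReal.ofReal β) ^ (p x) ≤ K := by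
  have hn1 : (1:ℝ) ≤ n := by exact_mod_cast hn
  have hδ0 : 0 < δ := by linarith
  obtain ⟨a, haeq⟩ : ∃ a : ℝ, a = ((n:ℝ) + 1) / 2 + δ := ⟨_, rfl⟩
  have ha : (n:ℝ) < a := by rw [haeq]; linarith
  have ha0 : 0 < a := by linarith
  obtain ⟨p0, hp0⟩ : ∃ p0 : ℝ, p0 = 2 * (n : ℝ) / ((n : ℝ) + 1 + 2 * δ) := ⟨_, rfl⟩
  rw [← hp0] at hL
  have hp0a : (n:ℝ) = a * p0 := by rw [haeq, hp0]; field_simp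
  have hp0p : 0 < p0 := hL.lo_pos
  have hp01 : p0 < 1 := by nlinarith
  set r := p0 / 2 with hr
  have hr0 : 0 < r := by positivity
  have hr1 : r < 1 := by rw [hr]; linarith
  obtain ⟨Cp, hCp, hpee⟩ := peetre Φ hΦ hr0 hr1
  have hb : 0 < ((n:ℝ) + 1) / r := by positivity
  obtain ⟨CK, hCK, hdec⟩ := brKernel_decay (n := n) hn hδ0
  have hKd : Dec a (brKernel n δ) CK.toNNReal := by
    intro x
    rw [Real.coe_toNNReal _ hCK.le, haeq]
    exact hdec x
  have hKc := brKernel_cont (n := n) hδ0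
  have hKi := hKd.int ha hKc
  obtain ⟨Ck, hCk, hkey⟩ := key_bound Φ hΦ ha hb hKd hKc (brKernel_F0 hδ0 hKi)
  have hLr := hL.div hr0
  have h2 : p0 / r = 2 := by rw [hr]; field_simp
  rw [h2] at hLr
  obtain ⟨KH, hKH, hH⟩ := H_main hn hLr
  have hA1 : (1:ℝ≥0∞) ≤ 1 + Cp := le_self_add
  have hAt : 1 + Cp ≠ ⊤ := ENNReal.add_ne_top.2 ⟨by simp, hCp.ne⟩
  have hA0 : 1 + Cp ≠ 0 := (lt_of_lt_of_le one_pos hA1).ne'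
  have hCG : (1 + Cp) ^ (1 / r) * KH < ⊤ :=
    ENNReal.mul_lt_top (ENNReal.rpow_lt_top_of_nonneg (by positivity) hAt) hKH
  obtain ⟨K, hK, hweak⟩ := weak_main hn hL ha hp0a _ hCG
  refine ⟨K, Ck * Kl n a, hK, ENNReal.mul_lt_top hCk (Kl_lt_top ha), ?_⟩
  intro f hf ε hε β hβ
  obtain ⟨g, hgdef⟩ : ∃ g : En n → ℂ, g = 𝓕 (⇑f) := ⟨_, rfl⟩
  have hgi : Integrable g := by
    rw [hgdef, ← SchwartzMap.fourier_coe]; exact (𝓕 f).integrable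
  have hfg : (⇑f) = 𝓕⁻ g := by
    rw [hgdef]
    exact (f.continuous.fourierInv_fourier_eq f.integrable (hgdef ▸ hgi)).symm
  rw [hfg, radMax_M0 Φ.integrable hgi] at hf
  have hMm := M0_meas (n := n) Φ.integrable hgi
  set w : En n → ℝ≥0∞ := fun x => (M0 Φ g x) ^ r with hw
  have hwm : Measurable w := hMm.pow_const r
  have hw1 : ∫⁻ x, (w x) ^ (p x / r) ≤ 1 := by
    refine le_trans (le_of_eq ?_) hf
    congr 1; funext x
    rw [hw]; dsimp only
    rw [← ENNReal.rpow_mul, mul_div_cancel₀ _ hr0.ne']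
  have hHw := hH w hwm hw1
  obtain ⟨G, hG⟩ : ∃ G : En n → ℝ≥0∞, G = fun x => ((1 + Cp) * HLM w x) ^ (r⁻¹) := ⟨_, rfl⟩
  have hGo : ∀ j, IsOpen (Om G j) := by
    intro j
    have : Om G j = {x | (lv j) ^ r / (1 + Cp) < HLM w x} := by
      ext x
      unfold Om
      simp only [mem_ofPred_eq, hG]
      rw [ENNReal.lt_rpow_inv_iff hr0, ENNReal.div_lt_iff (Or.inl hA0) (Or.inl hAt), mul_comm]
    rw [this]
    exact isOpen_HLM w _
  have hGI : ∫⁻ x, (G x) ^ (p x) ≤ (1 + Cp) ^ (1 / r) * KH := by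
    calc _ ≤ ∫⁻ x, (1 + Cp) ^ (1 / r) * (HLM w x) ^ (p x / r) := by
          refine lintegral_mono fun x => ?_
          dsimp only
          rw [hG]; dsimp only
          have hpx : 0 < p x := hp0p.trans_le (hL.lo_le x)
          rw [← ENNReal.rpow_mul, inv_mul_eq_div, ENNReal.mul_rpow_of_nonneg _ _ (by positivity)]
          refine mul_le_mul_left ?_ _
          apply ENNReal.rpow_le_rpow_of_exponent_le hA1
          have := hL.le_hi x
          gcongr
      _ = (1 + Cp) ^ (1 / r) * ∫⁻ x, (HLM w x) ^ (p x / r) :=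
          lintegral_const_mul' _ _ (ENNReal.rpow_ne_top_of_nonneg (by positivity) hAt)
      _ ≤ _ := by gcongr
  have hcn := compl_nonempty hn hL (hGI.trans_lt hCG)
  have hGM : ∀ x, Mss Φ g (((n:ℝ) + 1) / r) x ≤ G x := by
    intro x
    refine (hpee g hgi x).trans ?_
    rw [hG]
    dsimp only
    gcongr
    exact le_add_self
  obtain ⟨E, hE, hE1, hE2⟩ := hweak G hGo hGI β hβ
  refine ⟨E, hE, fun x hx => ?_, hE2⟩
  rw [radMax_eq] at hx
  simp only [lt_iSup_iff] at hx
  obtain ⟨t, ht, hx⟩ := hx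
  rw [brMeans_eq, hfg] at hx
  obtain ⟨s, hs, hle⟩ := hkey g hgi G hcn hGM ε hε t ht x
  refine hE1 x s hs ?_
  have h3 := hx.trans_le hle
  rw [mul_assoc] at h3
  by_contra hcon
  push Not at hcon
  exact absurd (mul_le_mul_right hcon Ck) (not_le.2 h3)

theorem final {n : ℕ} (hn : 1 ≤ n) (δ : ℝ)
    (hδ : ((n : ℝ) - 1) / 2 < δ)
    (p : En n → ℝ) (hpmeas : Measurable p)
    (hp : ∀ x, 0 < p x ∧ p x ≤ 1)
    (hlogH : GlobalLogHolder n p)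
    (hlow : 2 * (n : ℝ) / ((n : ℝ) + 1 + 2 * δ) ≤ essInf p volume)
    (Φ : SchwartzMap (En n) ℂ) (hΦ : (∫ x, Φ x) ≠ 0) :
    ∃ C : ℝ≥0, 0 < C ∧ ∀ (f : SchwartzMap (En n) ℂ) (ε : ℝ), 0 < ε →
      vlWQ n p (radMax n (⇑Φ) (brMeans n δ ε (⇑f))) ≤
        (C : ℝ≥0∞) * vlQ n p (radMax n (⇑Φ) (⇑f)) := by
  have hn1 : (1:ℝ) ≤ n := by exact_mod_cast hn
  have hδ0 : 0 < δ := by linarith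
  obtain ⟨C0, pinf, hC0, hloc, hinf⟩ := hlogH
  have hL := mkLH hn hpmeas hp hC0 hloc hinf (by positivity) hlow
  obtain ⟨K, C1, hK, hC1, hcore⟩ := core hn hδ hL Φ hΦ
  obtain ⟨p0, hp0⟩ : ∃ p0 : ℝ, p0 = 2 * (n : ℝ) / ((n : ℝ) + 1 + 2 * δ) := ⟨_, rfl⟩
  rw [← hp0] at hL
  have hp0p := hL.lo_pos
  set c1 : ℝ := C1.toReal + 1 with hc1
  have hc10 : 0 < c1 := by positivity
  have hC1c : C1 ≤ ENNReal.ofReal c1 := by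
    rw [← ENNReal.ofReal_toReal hC1.ne]
    exact ENNReal.ofReal_le_ofReal (by linarith)
  set D : ℝ := (K.toReal + 1) ^ (p0⁻¹) with hD
  have hK1 : 1 ≤ K.toReal + 1 := by linarith [ENNReal.toReal_nonneg (a := K)]
  have hD1 : 1 ≤ D := Real.one_le_rpow hK1 (by positivity)
  have hD0 : 0 < D := by linarith
  have hDp : D ^ p0 = K.toReal + 1 := by
    rw [hD, ← Real.rpow_mul (by linarith), inv_mul_cancel₀ hp0p.ne', Real.rpow_one]
  have hDK : K ≤ ENNReal.ofReal (D ^ p0) := by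
    rw [hDp, ← ENNReal.ofReal_toReal hK.ne]
    exact ENNReal.ofReal_le_ofReal (by simp)
  refine ⟨(D * c1).toNNReal, by rw [Real.toNNReal_pos]; positivity, fun f ε hε => ?_⟩
  have hCe : (((D * c1).toNNReal : ℝ≥0) : ℝ≥0∞) = ENNReal.ofReal (D * c1) := rfl
  rw [hCe]
  have hDc0 : ENNReal.ofReal (D * c1) ≠ 0 := by
    have : 0 < D * c1 := by positivity
    simpa using this
  rw [mul_comm, ← ENNReal.div_le_iff hDc0 ENNReal.ofReal_ne_top]
  conv_rhs => unfold vlQ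
  refine le_sInf ?_
  rintro lam ⟨hlam0, hlamt, hIntg⟩
  rw [ENNReal.div_le_iff hDc0 ENNReal.ofReal_ne_top]
  obtain ⟨L, hLe⟩ : ∃ L, L = lam.toReal := ⟨_, rfl⟩
  have hL0 : 0 < L := by rw [hLe]; exact ENNReal.toReal_pos hlam0.ne' hlamt.ne
  have hlam : lam = ENNReal.ofReal L := by rw [hLe, ENNReal.ofReal_toReal hlamt.ne]
  set c : ℂ := ((L⁻¹ : ℝ) : ℂ) with hc
  have hce : ‖c‖ₑ = lam⁻¹ := by
    rw [hc, ← ofReal_norm, Complex.norm_real, Real.norm_of_nonneg (by positivity), hlam,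
      ENNReal.ofReal_inv_of_pos hL0]
  have hcf : (⇑(c • f)) = fun y => c * f y := by funext y; simp
  have hIntg' : ∫⁻ x, (radMax n Φ (⇑(c • f)) x) ^ (p x) ≤ 1 := by
    refine le_trans (le_of_eq ?_) hIntg
    congr 1; funext x
    rw [hcf, radMax_smul, hce, mul_comm, ← div_eq_mul_inv]
  unfold vlWQ
  refine iSup_le fun β => iSup_le fun hβ => ?_
  have hβ0 : (0:ℝ) < β := hβ
  obtain ⟨β', hβ'⟩ : ∃ β' : ℝ, β' = β / (L * c1) := ⟨_, rfl⟩
  have hβ'0 : 0 < β' := by rw [hβ']; positivity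
  obtain ⟨E, hE, hE1, hE2⟩ := hcore (c • f) hIntg' ε hε β' hβ'0
  have hAE : ∀ x, (β : ℝ≥0∞) < radMax n Φ (brMeans n δ ε f) x → x ∈ E := by
    intro x hx
    apply hE1
    rw [hcf, brMeans_eq, cv_smul, radMax_smul, hce, ← brMeans_eq]
    have h1 : C1 * ENNReal.ofReal β' ≤ lam⁻¹ * β := by
      calc _ ≤ ENNReal.ofReal c1 * ENNReal.ofReal β' := by gcongr
        _ = ENNReal.ofReal (L⁻¹) * ENNReal.ofReal β := by
          rw [← ENNReal.ofReal_mul hc10.le, ← ENNReal.ofReal_mul (by positivity), hβ']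
          congr 1; field_simp
        _ = _ := by rw [ENNReal.ofReal_inv_of_pos hL0, hlam, ENNReal.ofReal_coe_nnreal]
    refine h1.trans_lt ?_
    exact ENNReal.mul_lt_mul_right (ENNReal.inv_ne_zero.2 hlamt.ne) (ENNReal.inv_ne_top.2 hlam0.ne') hx
  have hmain : vlQ n p ({x | (β : ℝ≥0∞) < radMax n Φ (brMeans n δ ε f) x}.indicator 1) ≤ ENNReal.ofReal (D / β') := by
    unfold vlQ
    refine sInf_le ⟨?_, ENNReal.ofReal_lt_top, ?_⟩
    · have : 0 < D / β' := by positivity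
      simpa using this
    calc _ ≤ ∫⁻ x, ENNReal.ofReal ((D ^ p0)⁻¹) * E.indicator (fun x => (ENNReal.ofReal β') ^ (p x)) x := by
          refine lintegral_mono fun x => ?_
          dsimp only
          by_cases hx : x ∈ {x | (β : ℝ≥0∞) < radMax n Φ (brMeans n δ ε f) x}
          · rw [indicator_of_mem hx, indicator_of_mem (hAE x hx), Pi.one_apply, one_div,
              ← ENNReal.ofReal_inv_of_pos (by positivity), inv_div,
              ENNReal.ofReal_rpow_of_pos (by positivity), ENNReal.ofReal_rpow_of_pos hβ'0,
              ← ENNReal.ofReal_mul (by positivity)]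
            apply ENNReal.ofReal_le_ofReal
            rw [Real.div_rpow hβ'0.le hD0.le, div_eq_inv_mul]
            gcongr
            exact hL.lo_le x
          · rw [indicator_of_notMem hx, ENNReal.zero_div, ENNReal.zero_rpow_of_pos (hp x).1]
            exact zero_le
      _ = ENNReal.ofReal ((D ^ p0)⁻¹) * ∫⁻ x in E, (ENNReal.ofReal β') ^ (p x) := by
          rw [lintegral_const_mul' _ _ ENNReal.ofReal_ne_top, lintegral_indicator hE]
      _ ≤ ENNReal.ofReal ((D ^ p0)⁻¹) * ENNReal.ofReal (D ^ p0) := by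
          gcongr
          exact hE2.trans hDK
      _ = 1 := by
          rw [← ENNReal.ofReal_mul (by positivity), inv_mul_cancel₀ (by positivity), ENNReal.ofReal_one]
  refine (mul_le_mul_right hmain _).trans (le_of_eq ?_)
  rw [hlam, ← ENNReal.ofReal_coe_nnreal, ← ENNReal.ofReal_mul (by positivity), ← ENNReal.ofReal_mul (by positivity), hβ']
  congr 1
  field_simp

end Part18

theorem bochnerRiesz_variableHardy_to_weakVariableHardy {n : ℕ} (hn : 1 ≤ n) (δ : ℝ)
    (hδ : ((n : ℝ) - 1) / 2 < δ)
    (p : En n → ℝ) (hpmeas : Measurable p)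
    (hp : ∀ x, 0 < p x ∧ p x ≤ 1)
    (hlogH : GlobalLogHolder n p)
    (hlow : 2 * (n : ℝ) / ((n : ℝ) + 1 + 2 * δ) ≤ essInf p volume)
    (Φ : SchwartzMap (En n) ℂ) (hΦ : (∫ x, Φ x) ≠ 0) :
    ∃ C : ℝ≥0, 0 < C ∧ ∀ (f : SchwartzMap (En n) ℂ) (ε : ℝ), 0 < ε →
      vlWQ n p (radMax n (⇑Φ) (brMeans n δ ε (⇑f))) ≤
        (C : ℝ≥0∞) * vlQ n p (radMax n (⇑Φ) (⇑f)) := by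
  exact final hn δ hδ p hpmeas hp hlogH hlow Φ hΦ
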